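/- (Angenent's zero-counting theorem) Let u(x,t) be continuous on [x₀,x₁] × [t₀,t₁] and a classical solution on (x₀,x₁) × (t₀,t₁] of ∂_t u = a ∂_x² u + b ∂_x u + c u, where a > 0 is C², b is C¹, and c is C⁰ on [x₀,x₁] × [t₀,t₁], and suppose u(x₀,t) ≠ 0 and u(x₁,t) ≠ 0 for all t ∈ [t₀,t₁]. Let z(t) denote the number of elements of the zero set Z(t) = { x ∈ [x₀,x₁] : u(x,t) = 0 }. Then: (i) z(t) is finite for every t ∈ (t₀,t₁]; and (ii) if for some t_c ∈ (t₀,t₁) there is x_c with u(x_c,t_c) = 0 and ∂_x u(x_c,t_c) = 0, then z(t₋) > z(t₊) for all t₋, t₊ ∈ (t₀,t₁] with t₋ < t_c ≤ t₊. -/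

import Mathlib

open Real MeasureTheory Set

namespace Ang
open ProbabilityTheory

noncomputable abbrev gm : Measure ℝ := gaussianReal 0 2

def GC (f : ℝ → ℝ) : Prop := Continuous f ∧ ∃ C : ℝ, ∃ k : ℕ, 0 ≤ C ∧ ∀ x, |f x| ≤ C * exp (k * |x|)

lemma GC.cont {f : ℝ → ℝ} (h : GC f) : Continuous f := h.1

lemma gc_const (c : ℝ) : GC (fun _ => c) :=
  ⟨continuous_const, |c|, 0, abs_nonneg c, fun x => by simp⟩

lemma gc_id : GC (fun x => x) := by
  refine ⟨continuous_id, 1, 1, zero_le_one, fun x => ?_⟩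
  have := add_one_le_exp |x|
  simp; linarith

lemma gc_bdd {f : ℝ → ℝ} (h : Continuous f) (C : ℝ) (hC : ∀ x, |f x| ≤ C) : GC f :=
  ⟨h, C, 0, (abs_nonneg _).trans (hC 0), fun x => by simpa using hC x⟩

lemma GC.mul {f g : ℝ → ℝ} (hf : GC f) (hg : GC g) : GC (fun x => f x * g x) := by
  obtain ⟨cf, C, k, hC, h⟩ := hf
  obtain ⟨cg, D, l, hD, h'⟩ := hg
  refine ⟨cf.mul cg, C * D, k + l, by positivity, fun x => ?_⟩
  rw [abs_mul]
  calc |f x| * |g x| ≤ (C * exp (k * |x|)) * (D * exp (l * |x|)) := by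
        gcongr
        · exact h x
        · exact h' x
    _ = _ := by push_cast; rw [add_mul, exp_add]; ring

lemma GC.add {f g : ℝ → ℝ} (hf : GC f) (hg : GC g) : GC (fun x => f x + g x) := by
  obtain ⟨cf, C, k, hC, h⟩ := hf
  obtain ⟨cg, D, l, hD, h'⟩ := hg
  refine ⟨cf.add cg, C + D, k + l, by positivity, fun x => ?_⟩
  have h1 : C * exp (k * |x|) ≤ C * exp ((k + l : ℕ) * |x|) := by
    gcongr; omega
  have h2 : D * exp (l * |x|) ≤ D * exp ((k + l : ℕ) * |x|) := by
    gcongr; omega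
  calc |f x + g x| ≤ |f x| + |g x| := abs_add_le _ _
    _ ≤ C * exp ((k + l : ℕ) * |x|) + D * exp ((k + l : ℕ) * |x|) := add_le_add ((h x).trans h1) ((h' x).trans h2)
    _ = _ := by ring

lemma GC.neg {f : ℝ → ℝ} (hf : GC f) : GC (fun x => - f x) := by
  simpa using (gc_const (-1)).mul hf

lemma GC.sub {f g : ℝ → ℝ} (hf : GC f) (hg : GC g) : GC (fun x => f x - g x) := by
  simpa [sub_eq_add_neg] using hf.add hg.neg

lemma GC.sq {f : ℝ → ℝ} (hf : GC f) : GC (fun x => f x ^ 2) := by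
  simpa [pow_two] using hf.mul hf

lemma GC.abs {f : ℝ → ℝ} (hf : GC f) : GC (fun x => |f x|) := by
  obtain ⟨cf, C, k, hC, h⟩ := hf
  exact ⟨cf.abs, C, k, hC, by simpa using h⟩

lemma GC.cmul {f : ℝ → ℝ} (hf : GC f) (c : ℝ) : GC (fun x => c * f x) := (gc_const c).mul hf

lemma gc_exp (y : ℝ) : GC (fun x => exp (y * x)) := by
  refine ⟨by fun_prop, 1, ⌈|y|⌉₊, zero_le_one, fun x => ?_⟩
  rw [abs_of_pos (exp_pos _), one_mul, exp_le_exp]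
  calc y * x ≤ |y * x| := le_abs_self _
    _ = |y| * |x| := abs_mul _ _
    _ ≤ _ := by gcongr; exact Nat.le_ceil _

lemma GC.shift {f : ℝ → ℝ} (hf : GC f) (y : ℝ) : GC (fun x => f (x + y)) := by
  obtain ⟨cf, C, k, hC, h⟩ := hf
  refine ⟨by fun_prop, C * exp (k * |y|), k, by positivity, fun x => (h _).trans ?_⟩
  rw [mul_assoc, ← exp_add]
  gcongr
  rw [← mul_add]
  gcongr
  linarith [abs_add_le x y]

lemma gc_poly (p : Polynomial ℝ) : GC (fun x => p.eval x) := by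
  induction p using Polynomial.induction_on' with
  | add p q hp hq => simpa using hp.add hq
  | monomial n a =>
    simp only [Polynomial.eval_monomial]
    apply GC.cmul
    induction n with
    | zero => simpa using gc_const 1
    | succ n ih => simpa [pow_succ] using ih.mul gc_id

lemma integrable_expabs (k : ℝ) : Integrable (fun x => exp (k * |x|)) gm := by
  have h := (integrable_exp_mul_gaussianReal (μ := 0) (v := 2) k).add
    (integrable_exp_mul_gaussianReal (μ := 0) (v := 2) (-k))
  refine h.mono' (by fun_prop) (Filter.Eventually.of_forall fun x => ?_)
  rw [norm_of_nonneg (exp_pos _).le]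
  simp only [Pi.add_apply]
  rcases abs_cases x with ⟨h, _⟩ | ⟨h, _⟩ <;> rw [h]
  · linarith [exp_pos (-k * x)]
  · have : k * -x = -k * x := by ring
    rw [this]; linarith [exp_pos (k * x)]

lemma GC.int {f : ℝ → ℝ} (hf : GC f) : Integrable f gm := by
  obtain ⟨cf, C, k, hC, h⟩ := hf
  refine ((integrable_expabs k).const_mul C).mono' cf.aestronglyMeasurable
    (Filter.Eventually.of_forall fun x => ?_)
  simpa using h x

noncomputable def rho (x : ℝ) : ℝ := gaussianPDFReal 0 2 x

lemma rho_pos (x : ℝ) : 0 < rho x := gaussianPDFReal_pos 0 2 x (by norm_num)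

lemma rho_eq (x : ℝ) : rho x = (√(2 * π * 2))⁻¹ * exp (-x ^ 2 / 4) := by
  rw [rho, gaussianPDFReal_def]; simp; left; ring

lemma rho_deriv (x : ℝ) : HasDerivAt rho (-(x / 2) * rho x) x := by
  have : rho = fun x => (√(2 * π * 2))⁻¹ * exp (-x ^ 2 / 4) := funext rho_eq
  rw [this]
  have h : HasDerivAt (fun x : ℝ => -x ^ 2 / 4) (-(2 * x) / 4) x := by
    have := ((hasDerivAt_pow 2 x).neg).div_const 4
    simpa using this
  refine ((h.exp).const_mul ((√(2 * π * 2))⁻¹)).congr_deriv ?_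
  ring

lemma gint_eq (f : ℝ → ℝ) : ∫ x, f x ∂gm = ∫ x, rho x * f x := by
  rw [integral_gaussianReal_eq_integral_smul (by norm_num)]
  rfl

lemma gint_able (f : ℝ → ℝ) (hf : Integrable f gm) : Integrable (fun x => rho x * f x) := by
  have : gm = volume.withDensity (gaussianPDF 0 2) := gaussianReal_of_var_ne_zero 0 (by norm_num)
  rw [this, integrable_withDensity_iff_integrable_smul' (measurable_gaussianPDF 0 2)
    (by simp [gaussianPDF])] at hf
  refine hf.congr (Filter.Eventually.of_forall fun x => ?_)
  simp [gaussianPDF, rho, ENNReal.toReal_ofReal (gaussianPDFReal_nonneg 0 2 x)]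

lemma stein {F F' : ℝ → ℝ} (hd : ∀ x, HasDerivAt F (F' x) x) (hF : GC F) (hF' : GC F') :
    ∫ x, F' x ∂gm = ∫ x, x / 2 * F x ∂gm := by
  have h2 : GC (fun x => x / 2 * F x) := by
    have := (gc_id.mul hF).cmul (1/2)
    convert this using 2; ring
  have i1 := gint_able _ hF'.int
  have i2 := gint_able _ h2.int
  have i3 := gint_able _ hF.int
  have := integral_eq_zero_of_hasDerivAt_of_integrable (f := fun x => rho x * F x)
    (f' := fun x => rho x * F' x - rho x * (x / 2 * F x)) (fun x => by
      refine ((rho_deriv x).mul (hd x)).congr_deriv ?_; ring) (i1.sub i2) i3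
  rw [integral_sub i1 i2, ← gint_eq, ← gint_eq] at this
  linarith

lemma gibp {f f' g g' : ℝ → ℝ} (hd : ∀ x, HasDerivAt f (f' x) x) (hg : ∀ x, HasDerivAt g (g' x) x)
    (cf : GC f) (cf' : GC f') (cg : GC g) (cg' : GC g') :
    ∫ x, f' x * g x ∂gm = ∫ x, f x * (x / 2 * g x - g' x) ∂gm := by
  have h := stein (F := fun x => f x * g x) (F' := fun x => f' x * g x + f x * g' x)
    (fun x => (hd x).mul (hg x)) (cf.mul cg) ((cf'.mul cg).add (cf.mul cg'))
  rw [integral_add (cf'.mul cg).int (cf.mul cg').int] at h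
  have h2 : GC (fun x => x / 2 * (f x * g x)) := by
    have := (gc_id.mul (cf.mul cg)).cmul (1/2)
    convert this using 2; ring
  have : ∫ x, f x * (x / 2 * g x - g' x) ∂gm = ∫ x, x / 2 * (f x * g x) ∂gm - ∫ x, f x * g' x ∂gm := by
    rw [← integral_sub h2.int (cf.mul cg').int]
    congr 1; ext x; ring
  linarith

lemma gcs {f g : ℝ → ℝ} (hf : GC f) (hg : GC g) :
    (∫ x, f x * g x ∂gm) ^ 2 ≤ (∫ x, f x ^ 2 ∂gm) * ∫ x, g x ^ 2 ∂gm := by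
  have key : ∀ s : ℝ, 0 ≤ (∫ x, f x ^ 2 ∂gm) * (s * s) + (2 * ∫ x, f x * g x ∂gm) * s + ∫ x, g x ^ 2 ∂gm := by
    intro s
    have : ∫ x, (s * f x + g x) ^ 2 ∂gm = (∫ x, f x ^ 2 ∂gm) * (s * s) + (2 * ∫ x, f x * g x ∂gm) * s + ∫ x, g x ^ 2 ∂gm := by
      have e : (fun x => (s * f x + g x) ^ 2) = fun x => ((s * s) * f x ^ 2 + (2 * s) * (f x * g x)) + g x ^ 2 := by
        ext x; ring
      rw [e, integral_add ((hf.sq.cmul _).add ((hf.mul hg).cmul _)).int hg.sq.int,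
        integral_add (hf.sq.cmul _).int ((hf.mul hg).cmul _).int, integral_const_mul, integral_const_mul]
      ring
    rw [← this]; positivity
  have := discrim_le_zero key
  rw [discrim] at this
  linarith

lemma gshift {f : ℝ → ℝ} (y : ℝ) :
    ∫ x, f (x + y) ∂gm = ∫ x, f x * (exp (-y ^ 2 / 4) * exp (y / 2 * x)) ∂gm := by
  rw [gint_eq, gint_eq, ← integral_sub_right_eq_self _ y]
  congr 1; ext x
  rw [rho_eq, rho_eq]
  have : exp (-(x - y) ^ 2 / 4) = exp (-x ^ 2 / 4) * (exp (-y ^ 2 / 4) * exp (y / 2 * x)) := by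
    rw [← exp_add, ← exp_add]; congr 1; ring
  rw [this, sub_add_cancel]; ring

lemma gshift_sq_le {f : ℝ → ℝ} (hf : GC f) (y : ℝ) :
    (∫ x, f (x + y) ∂gm) ^ 2 ≤ exp (y ^ 2 / 2) * ∫ x, f x ^ 2 ∂gm := by
  rw [gshift, mul_comm (exp (y ^ 2 / 2))]
  refine (gcs hf ((gc_exp (y/2)).cmul _)).trans_eq ?_
  congr 1
  have e : (fun x => (exp (-y ^ 2 / 4) * exp (y / 2 * x)) ^ 2) = fun x => exp (-y ^ 2 / 2) * exp (y * x) := by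
    ext x; rw [← exp_add, ← exp_add, ← exp_nat_mul]; congr 1; push_cast; ring
  rw [e, integral_const_mul]
  have := congrFun (mgf_fun_id_gaussianReal (μ := 0) (v := 2)) y
  rw [mgf] at this
  rw [this, ← exp_add]; congr 1; push_cast; ring

lemma gint_one : ∫ _x, (1 : ℝ) ∂gm = 1 := by simp

lemma gpos {f : ℝ → ℝ} (hf : GC f) (h0 : ∀ x, 0 ≤ f x) (x : ℝ) (hx : f x ≠ 0) : 0 < ∫ x, f x ∂gm := by
  rw [integral_pos_iff_support_of_nonneg h0 hf.int]
  have ho : IsOpen (Function.support f) := hf.cont.isOpen_support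
  have : 0 < volume (Function.support f) := ho.measure_pos _ ⟨x, hx⟩
  have hac : volume ≪ gm := gaussianReal_absolutelyContinuous' 0 (by norm_num)
  rw [pos_iff_ne_zero] at this ⊢
  exact fun h => this (hac h)


open Polynomial in
noncomputable def hp : ℕ → Polynomial ℝ
  | 0 => 1
  | n + 1 => C (1/2 : ℝ) * X * hp n - derivative (hp n)

open Polynomial in
lemma hp_deriv (n : ℕ) : derivative (hp (n + 1)) = C (((n : ℝ) + 1) / 2) * hp n := by
  induction n with
  | zero => simp [hp]
  | succ n ih =>
    have e : hp (n + 1 + 1) = C (1/2 : ℝ) * X * hp (n + 1) - derivative (hp (n + 1)) := rfl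
    have e0 : hp (n + 1) = C (1/2 : ℝ) * X * hp n - derivative (hp n) := rfl
    have e1 : C (((n + 1 : ℕ) : ℝ) + 1) = C ((n : ℝ) + 1) + 1 := by
      rw [← C_1, ← C_add]; push_cast; ring_nf
    have h2 : C ((((n + 1 : ℕ) : ℝ) + 1) / 2) = C (1 / 2 : ℝ) + C (((n : ℝ) + 1) / 2) := by
      rw [← C_add]; push_cast; ring_nf
    rw [e, derivative_sub, derivative_mul, derivative_mul, h2]
    rw [ih]
    simp only [derivative_C, derivative_X, derivative_mul, zero_mul, zero_add, mul_one]
    rw [add_mul, e0]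
    ring

lemma hp_hasDeriv (n : ℕ) (x : ℝ) : HasDerivAt (fun x => (hp n).eval x) ((hp n).derivative.eval x) x :=
  (hp n).hasDerivAt x

lemma hp_succ_eval (n : ℕ) (x : ℝ) :
    (hp (n+1)).eval x = x / 2 * (hp n).eval x - (hp n).derivative.eval x := by
  simp only [hp, Polynomial.eval_sub, Polynomial.eval_mul, Polynomial.eval_C, Polynomial.eval_X]; ring

lemma hp_move {f f' : ℝ → ℝ} (hd : ∀ x, HasDerivAt f (f' x) x) (cf : GC f) (cf' : GC f') (n : ℕ) :
    ∫ x, f' x * (hp n).eval x ∂gm = ∫ x, f x * (hp (n+1)).eval x ∂gm := by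
  rw [gibp hd (hp_hasDeriv n) cf cf' (gc_poly _) (gc_poly _)]
  simp only [hp_succ_eval]

lemma hp_norm (n : ℕ) : ∫ x, (hp (n+1)).eval x * (hp (n+1)).eval x ∂gm
    = ((n : ℝ) + 1) / 2 * ∫ x, (hp n).eval x * (hp n).eval x ∂gm := by
  rw [← hp_move (hp_hasDeriv (n+1)) (gc_poly _) (gc_poly _) n, ← integral_const_mul]
  congr 1; ext x
  rw [hp_deriv]; simp; ring

noncomputable def hn (n : ℕ) : ℝ := ∫ x, (hp n).eval x * (hp n).eval x ∂gm

lemma hn_eq (n : ℕ) : hn n = (n.factorial : ℝ) / 2 ^ n := by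
  induction n with
  | zero => simp [hn, hp]
  | succ n ih =>
    have : hn (n+1) = ((n : ℝ) + 1) / 2 * hn n := hp_norm n
    rw [this, ih, Nat.factorial_succ, pow_succ]; push_cast; field_simp

lemma hn_pos (n : ℕ) : 0 < hn n := by rw [hn_eq]; positivity

lemma hp_orth_lt (m k : ℕ) : ∫ x, (hp m).eval x * (hp (m + k + 1)).eval x ∂gm = 0 := by
  induction m with
  | zero =>
    rw [← hp_move (f := fun x => (hp 0).eval x) (hp_hasDeriv 0) (gc_poly _) (gc_poly _)]
    simp [hp]
  | succ m ih =>
    have : m + 1 + k + 1 = (m + k + 1) + 1 := by ring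
    rw [this, ← hp_move (hp_hasDeriv (m+1)) (gc_poly _) (gc_poly _), hp_deriv]
    have : (fun x => (Polynomial.C (((m : ℝ) + 1) / 2) * hp m).eval x * (hp (m + k + 1)).eval x) =
      fun x => (((m : ℝ) + 1) / 2) * ((hp m).eval x * (hp (m + k + 1)).eval x) := by
      ext x; simp; ring
    rw [this, integral_const_mul, ih, mul_zero]

lemma hp_orth {m n : ℕ} (h : m ≠ n) : ∫ x, (hp m).eval x * (hp n).eval x ∂gm = 0 := by
  rcases lt_or_gt_of_ne h with h | h
  · obtain ⟨k, rfl⟩ := Nat.exists_eq_add_of_lt h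
    exact hp_orth_lt m k
  · obtain ⟨k, rfl⟩ := Nat.exists_eq_add_of_lt h
    simp_rw [mul_comm (Polynomial.eval _ (hp (n + k + 1)))]
    exact hp_orth_lt n k

lemma dirichlet {f1 f2 g g1 : ℝ → ℝ} (h1 : ∀ x, HasDerivAt f1 (f2 x) x) (hg : ∀ x, HasDerivAt g (g1 x) x)
    (cf1 : GC f1) (cf2 : GC f2) (cg : GC g) (cg1 : GC g1) :
    ∫ x, g x * (x / 2 * f1 x - f2 x) ∂gm = ∫ x, g1 x * f1 x ∂gm :=
  (gibp hg h1 cg cg1 cf1 cf2).symm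

lemma hp_eig {f f1 f2 : ℝ → ℝ} (h0 : ∀ x, HasDerivAt f (f1 x) x) (h1 : ∀ x, HasDerivAt f1 (f2 x) x)
    (cf : GC f) (cf1 : GC f1) (cf2 : GC f2) (n : ℕ) :
    ∫ x, (x / 2 * f1 x - f2 x) * (hp n).eval x ∂gm = (n : ℝ) / 2 * ∫ x, f x * (hp n).eval x ∂gm := by
  simp_rw [mul_comm _ (Polynomial.eval _ (hp n))]
  rw [dirichlet h1 (hp_hasDeriv n) cf1 cf2 (gc_poly _) (gc_poly _)]
  cases n with
  | zero => simp [hp]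
  | succ n =>
    simp_rw [mul_comm (Polynomial.eval _ (hp (n+1)))]
    rw [← hp_move h0 cf cf1 n, hp_deriv, ← integral_const_mul]
    congr 1; ext x; simp; ring

lemma hp_shift (n : ℕ) (y : ℝ) : ∫ x, (hp n).eval (x + y) ∂gm = (y / 2) ^ n := by
  induction n with
  | zero => simp [hp]
  | succ n ih =>
    have hd : ∀ x, HasDerivAt (fun x => (hp n).eval (x + y)) ((hp n).derivative.eval (x + y)) x := by
      intro x
      exact (hp_hasDeriv n (x+y)).comp_add_const x y
    have c0 := (gc_poly (hp n)).shift y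
    have c1 := (gc_poly (Polynomial.derivative (hp n))).shift y
    have s := stein hd c0 c1
    have e : (fun x => (hp (n+1)).eval (x + y)) = fun x => (y / 2 * (hp n).eval (x + y) +
      x / 2 * (hp n).eval (x+y)) - (hp n).derivative.eval (x + y) := by
      ext x; rw [hp_succ_eval]; ring
    have c2 : GC (fun x => x / 2 * (hp n).eval (x+y)) := by
      have := (gc_id.mul c0).cmul (1/2)
      convert this using 2; ring
    rw [e, integral_sub ((c0.cmul _).add c2).int c1.int, integral_add (c0.cmul _).int c2.int,
      integral_const_mul, ih, s, pow_succ]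
    ring

lemma hp_span (q : Polynomial ℝ) : q ∈ Submodule.span ℝ (range hp) := by
  have hX : ∀ p ∈ Submodule.span ℝ (range hp), Polynomial.X * p ∈ Submodule.span ℝ (range hp) := by
    intro p hp'
    induction hp' using Submodule.span_induction with
    | mem p h =>
      obtain ⟨n, rfl⟩ := h
      have : Polynomial.X * hp n = (2:ℝ) • hp (n+1) + (2:ℝ) • Polynomial.derivative (hp n) := by
        have e0 : hp (n + 1) = Polynomial.C (1/2 : ℝ) * Polynomial.X * hp n - Polynomial.derivative (hp n) := rfl
        rw [e0, smul_sub, Polynomial.smul_eq_C_mul, ← mul_assoc, ← mul_assoc, ← Polynomial.C_mul]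
        simp
      rw [this]
      refine Submodule.add_mem _ (Submodule.smul_mem _ _ (Submodule.subset_span ⟨_, rfl⟩)) (Submodule.smul_mem _ _ ?_)
      cases n with
      | zero => simp [hp]
      | succ n =>
        rw [hp_deriv, ← Polynomial.smul_eq_C_mul]
        exact Submodule.smul_mem _ _ (Submodule.subset_span ⟨_, rfl⟩)
    | zero => simp
    | add p q _ _ h1 h2 => rw [mul_add]; exact Submodule.add_mem _ h1 h2
    | smul a p _ h => rw [mul_smul_comm]; exact Submodule.smul_mem _ _ h
  have hpow : ∀ n : ℕ, (Polynomial.X : Polynomial ℝ) ^ n ∈ Submodule.span ℝ (range hp) := by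
    intro n
    induction n with
    | zero => exact Submodule.subset_span ⟨0, by simp [hp]⟩
    | succ n ih => rw [pow_succ']; exact hX _ ih
  induction q using Polynomial.induction_on' with
  | add p q hp hq => exact Submodule.add_mem _ hp hq
  | monomial n a =>
    rw [← Polynomial.C_mul_X_pow_eq_monomial, ← Polynomial.smul_eq_C_mul]
    exact Submodule.smul_mem _ _ (hpow n)

lemma moments_zero {f : ℝ → ℝ} (hm : Measurable f) (hf : MemLp f 2 gm)
    (h : ∀ n : ℕ, ∫ x, f x * x ^ n ∂gm = 0) : f =ᵐ[gm] 0 := by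
  have hmn : Measurable (fun x => - f x) := hm.neg
  set μ := gm.withDensity (fun x => ENNReal.ofReal (f x)) with hμ
  set ν := gm.withDensity (fun x => ENNReal.ofReal (-f x)) with hν
  have hprod : ∀ g : ℝ → ℝ, GC g → Integrable (fun x => f x * g x) gm := by
    intro g hg
    have : MemLp g 2 gm := (memLp_two_iff_integrable_sq hg.cont.aestronglyMeasurable).2 hg.sq.int
    exact hf.integrable_mul this
  have hprod' : ∀ g : ℝ → ℝ, GC g → Integrable (fun x => max (f x) 0 * g x) gm := by
    intro g hg
    refine (hprod g hg).mono ((hm.max measurable_const).aestronglyMeasurable.mul hg.cont.aestronglyMeasurable)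
      (Filter.Eventually.of_forall fun x => ?_)
    rw [norm_mul, norm_mul]
    gcongr
    rw [Real.norm_eq_abs, Real.norm_eq_abs, abs_of_nonneg (le_max_right _ _)]
    exact max_le (le_abs_self _) (abs_nonneg _)
  have hprod'' : ∀ g : ℝ → ℝ, GC g → Integrable (fun x => max (-f x) 0 * g x) gm := by
    intro g hg
    refine (hprod g hg).mono ((hm.neg.max measurable_const).aestronglyMeasurable.mul hg.cont.aestronglyMeasurable)
      (Filter.Eventually.of_forall fun x => ?_)
    rw [norm_mul, norm_mul]
    gcongr
    rw [Real.norm_eq_abs, Real.norm_eq_abs, abs_of_nonneg (le_max_right _ _)]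
    exact max_le (neg_le_abs _) (abs_nonneg _)
  have fin1 : IsFiniteMeasure μ := isFiniteMeasure_withDensity_ofReal (hf.integrable (by norm_num)).2
  have fin2 : IsFiniteMeasure ν := isFiniteMeasure_withDensity_ofReal (hf.integrable (by norm_num)).neg.2
  have iμ : ∀ g : ℝ → ℝ, GC g → Integrable g μ := by
    intro g hg
    rw [hμ, integrable_withDensity_iff_integrable_smul' hm.ennreal_ofReal (by simp)]
    simpa [ENNReal.toReal_ofReal'] using hprod' g hg
  have iν : ∀ g : ℝ → ℝ, GC g → Integrable g ν := by
    intro g hg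
    rw [hν, integrable_withDensity_iff_integrable_smul' hmn.ennreal_ofReal (by simp)]
    simpa [ENNReal.toReal_ofReal'] using hprod'' g hg
  have eμ : ∀ g : ℝ → ℝ, ∫ x, g x ∂μ = ∫ x, max (f x) 0 * g x ∂gm := by
    intro g
    rw [hμ, integral_withDensity_eq_integral_toReal_smul hm.ennreal_ofReal (by simp)]
    simp [ENNReal.toReal_ofReal']
  have eν : ∀ g : ℝ → ℝ, ∫ x, g x ∂ν = ∫ x, max (-f x) 0 * g x ∂gm := by
    intro g
    rw [hν, integral_withDensity_eq_integral_toReal_smul hmn.ennreal_ofReal (by simp)]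
    simp [ENNReal.toReal_ofReal']
  have ediff : ∀ g : ℝ → ℝ, GC g → ∫ x, g x ∂μ - ∫ x, g x ∂ν = ∫ x, f x * g x ∂gm := by
    intro g hg
    rw [eμ, eν, ← integral_sub (hprod' g hg) (hprod'' g hg)]
    congr 1; ext x
    rcases le_total 0 (f x) with h | h
    · rw [max_eq_left h, max_eq_right (by linarith)]; ring
    · rw [max_eq_right h, max_eq_left (by linarith)]; ring
  have s1 : integrableExpSet id μ = univ := by
    ext t; simpa [integrableExpSet] using iμ _ (gc_exp t)
  have s2 : integrableExpSet id ν = univ := by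
    ext t; simpa [integrableExpSet] using iν _ (gc_exp t)
  have a1 : AnalyticOnNhd ℝ (mgf id μ) univ := by
    have := analyticOnNhd_mgf (X := id) (μ := μ); rwa [s1, interior_univ] at this
  have a2 : AnalyticOnNhd ℝ (mgf id ν) univ := by
    have := analyticOnNhd_mgf (X := id) (μ := ν); rwa [s2, interior_univ] at this
  have hgp : ∀ n : ℕ, GC (fun x => x ^ n) := fun n => by simpa using gc_poly (Polynomial.X ^ n)
  have hder : ∀ n, iteratedDeriv n (mgf id μ) 0 = iteratedDeriv n (mgf id ν) 0 := by
    intro n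
    rw [iteratedDeriv_mgf_zero (by rw [s1]; simp), iteratedDeriv_mgf_zero (by rw [s2]; simp)]
    have := ediff _ (hgp n)
    rw [h n] at this
    simp only [Pi.pow_apply, id]
    linarith
  have hmgf : mgf id μ = mgf id ν := by
    have p1 := (a1 0 (mem_univ _)).hasFPowerSeriesAt
    have p2 := (a2 0 (mem_univ _)).hasFPowerSeriesAt
    simp_rw [hder] at p1
    have p3 := p1.sub p2
    rw [sub_self] at p3
    have := p3.eventually_eq_zero
    have hev : mgf id μ =ᶠ[nhds 0] mgf id ν := by
      filter_upwards [this] with z hz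
      simpa [sub_eq_zero] using hz
    funext t
    exact a1.eqOn_of_preconnected_of_eventuallyEq a2 isPreconnected_univ (mem_univ 0) hev (mem_univ t)
  have hmass : μ univ = ν univ := by
    have := congrFun hmgf 0
    simp only [mgf_zero', Measure.real] at this
    exact (ENNReal.toReal_eq_toReal_iff' (measure_ne_top _ _) (measure_ne_top _ _)).1 this
  have heq : μ = ν := by
    refine Measure.ext_of_complexMGF_id_eq ?_
    have := eqOn_complexMGF_of_mgf' hmgf (by
      rw [← Measure.measure_univ_eq_zero, hmass, Measure.measure_univ_eq_zero])
    rw [s1] at this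
    funext z
    exact this (by simp)
  rw [hμ, hν, withDensity_eq_iff_of_sigmaFinite hm.ennreal_ofReal.aemeasurable hmn.ennreal_ofReal.aemeasurable] at heq
  filter_upwards [heq] with x hx
  have := congrArg ENNReal.toReal hx
  rw [ENNReal.toReal_ofReal', ENNReal.toReal_ofReal'] at this
  rcases le_total 0 (f x) with h | h
  · rw [max_eq_left h, max_eq_right (by linarith)] at this; exact this
  · rw [max_eq_right h, max_eq_left (by linarith)] at this; simp; linarith


lemma GC.memLp {f : ℝ → ℝ} (hf : GC f) : MemLp f 2 gm :=
  (memLp_two_iff_integrable_sq hf.cont.aestronglyMeasurable).2 hf.sq.int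

lemma inner_toLp {f g : ℝ → ℝ} (hf : MemLp f 2 gm) (hg : MemLp g 2 gm) :
    inner ℝ (hf.toLp f) (hg.toLp g) = ∫ x, f x * g x ∂gm := by
  rw [L2.inner_def]
  refine integral_congr_ae ?_
  filter_upwards [hf.coeFn_toLp, hg.coeFn_toLp] with x h1 h2
  rw [h1, h2]; simp [mul_comm]

noncomputable def hb (n : ℕ) (x : ℝ) : ℝ := (√(hn n))⁻¹ * (hp n).eval x

lemma hb_gc (n : ℕ) : GC (hb n) := (gc_poly (hp n)).cmul _

lemma parseval {f : ℝ → ℝ} (hf : GC f) :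
    HasSum (fun n => (∫ x, f x * (hp n).eval x ∂gm) ^ 2 / hn n) (∫ x, f x ^ 2 ∂gm) := by
  set v : ℕ → Lp ℝ 2 gm := fun n => (hb_gc n).memLp.toLp (hb n) with hv
  have ho : Orthonormal ℝ v := by
    rw [orthonormal_iff_ite]
    intro i j
    rw [hv, inner_toLp]
    have e : (fun x => hb i x * hb j x) = fun x => ((√(hn i))⁻¹ * (√(hn j))⁻¹) *
        ((hp i).eval x * (hp j).eval x) := by ext x; simp only [hb]; ring
    rw [e, integral_const_mul]
    split_ifs with h
    · subst h
      have : ∫ x, (hp i).eval x * (hp i).eval x ∂gm = hn i := rfl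
      rw [this, ← mul_inv, mul_self_sqrt (hn_pos i).le, inv_mul_cancel₀ (hn_pos i).ne']
    · rw [hp_orth h, mul_zero]
  have hb' : (Submodule.span ℝ (range v))ᗮ = ⊥ := by
    rw [Submodule.eq_bot_iff]
    intro F hF
    obtain ⟨F', hFm, hFe⟩ := (Lp.aestronglyMeasurable F)
    have hF'2 : MemLp F' 2 gm := (memLp_congr_ae hFe).1 (Lp.memLp F)
    have hFF : F = hF'2.toLp F' := by
      ext1; exact hFe.trans hF'2.coeFn_toLp.symm
    have hint : ∀ g : ℝ → ℝ, GC g → Integrable (fun x => F' x * g x) gm :=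
      fun g hg => hF'2.integrable_mul hg.memLp
    have h0 : ∀ n, ∫ x, F' x * (hp n).eval x ∂gm = 0 := by
      intro n
      have := (Submodule.mem_orthogonal' _ _).1 hF (v n) (Submodule.subset_span ⟨n, rfl⟩)
      rw [hFF, hv, inner_toLp] at this
      have e : (fun x => F' x * hb n x) = fun x => (√(hn n))⁻¹ * (F' x * (hp n).eval x) := by
        ext x; simp only [hb]; ring
      rw [e, integral_const_mul] at this
      have h2 : (√(hn n))⁻¹ ≠ 0 := inv_ne_zero (sqrt_pos.2 (hn_pos n)).ne'
      exact (mul_eq_zero.1 this).resolve_left h2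
    have h1 : ∀ q : Polynomial ℝ, ∫ x, F' x * q.eval x ∂gm = 0 := by
      intro q
      have := hp_span q
      induction this using Submodule.span_induction with
      | mem p h => obtain ⟨n, rfl⟩ := h; exact h0 n
      | zero => simp
      | add p q _ _ h1 h2 =>
        simp only [Polynomial.eval_add, mul_add]
        rw [integral_add (hint _ (gc_poly _)) (hint _ (gc_poly _)), h1, h2, add_zero]
      | smul a p _ h =>
        simp only [Polynomial.eval_smul, smul_eq_mul, mul_left_comm _ a]
        rw [integral_const_mul, h, mul_zero]
    have h2 : F' =ᵐ[gm] 0 := moments_zero hFm.measurable hF'2 (fun n => by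
      simpa using h1 (Polynomial.X ^ n))
    rw [Lp.eq_zero_iff_ae_eq_zero]
    exact hFe.trans h2
  set b := HilbertBasis.mkOfOrthogonalEqBot ho hb' with hbdef
  have hbc : ∀ n, b n = v n := fun n => by rw [hbdef, HilbertBasis.coe_mkOfOrthogonalEqBot]
  have := b.hasSum_inner_mul_inner (hf.memLp.toLp f) (hf.memLp.toLp f)
  rw [inner_toLp] at this
  simp_rw [pow_two]
  suffices hs : (fun n => (∫ x, f x * (hp n).eval x ∂gm) * (∫ x, f x * (hp n).eval x ∂gm) / hn n) =
      fun i => inner ℝ (hf.memLp.toLp f) (b i) * inner ℝ (b i) (hf.memLp.toLp f) by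
    rw [hs]; exact this
  funext n
  rw [hbc, hv, inner_toLp, inner_toLp]
  have e : (fun x => f x * hb n x) = fun x => (√(hn n))⁻¹ * (f x * (hp n).eval x) := by
        ext x; simp only [hb]; ring
  have e2 : (fun x => hb n x * f x) = fun x => (√(hn n))⁻¹ * (f x * (hp n).eval x) := by
        ext x; simp only [hb]; ring
  rw [e, e2, integral_const_mul]
  have h3 : √(hn n) * √(hn n) = hn n := mul_self_sqrt (hn_pos n).le
  have h4 : √(hn n) ≠ 0 := (sqrt_pos.2 (hn_pos n)).ne'
  generalize √(hn n) = q at h3 h4 ⊢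
  rw [← h3]; field_simp

lemma spectral (M : ℝ) : ∃ c > 0, ∀ (f f1 f2 : ℝ → ℝ) (N y : ℝ),
    (∀ x, HasDerivAt f (f1 x) x) → (∀ x, HasDerivAt f1 (f2 x) x) → GC f → GC f1 → GC f2 →
    0 ≤ N → N ≤ M → ∫ x, ((x / 2 * f1 x - f2 x) - N * f x) ^ 2 ∂gm ≤ c * ∫ x, f x ^ 2 ∂gm →
    1 ≤ |y| → |y| ≤ 2 → c * ∫ x, f x ^ 2 ∂gm ≤ (∫ x, f (x + y) ∂gm) ^ 2 := by
  set J : ℕ := ⌈2 * M⌉₊ + 1 with hJ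
  set κ : ℝ := 1 / (2 ^ J * J.factorial) with hκ
  have hκ0 : 0 < κ := by positivity
  have hκ1 : κ ≤ 1 := by
    rw [hκ, div_le_one (by positivity)]
    have h1 : (1:ℝ) ≤ 2 ^ J := one_le_pow₀ (by norm_num)
    have h2 : (1:ℝ) ≤ J.factorial := by exact_mod_cast Nat.factorial_pos J
    nlinarith
  refine ⟨κ / 1000, by positivity, ?_⟩
  intro f f1 f2 N y h0 h1 cf cf1 cf2 hN hNM hP hy1 hy2
  have cA : GC (fun x => x / 2 * f1 x - f2 x) := by
    have := ((gc_id.mul cf1).cmul (1/2)).sub cf2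
    convert this using 2; ring
  have cg : GC (fun x => (x / 2 * f1 x - f2 x) - N * f x) := cA.sub (cf.cmul N)
  set H := ∫ x, f x ^ 2 ∂gm with hH
  set P2 := ∫ x, ((x / 2 * f1 x - f2 x) - N * f x) ^ 2 ∂gm with hP2
  set α : ℕ → ℝ := fun n => ∫ x, f x * (hp n).eval x ∂gm with hα
  have hH0 : 0 ≤ H := integral_nonneg fun x => sq_nonneg _
  have hP0 : 0 ≤ P2 := integral_nonneg fun x => sq_nonneg _
  have s1 : HasSum (fun n => α n ^ 2 / hn n) H := parseval cf
  have s2 : HasSum (fun n : ℕ => ((n:ℝ) / 2 - N) ^ 2 * (α n ^ 2 / hn n)) P2 := by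
    convert parseval cg using 1
    funext n
    have : ∫ x, ((x / 2 * f1 x - f2 x) - N * f x) * (hp n).eval x ∂gm = ((n:ℝ) / 2 - N) * α n := by
      have e : (fun x => ((x / 2 * f1 x - f2 x) - N * f x) * (hp n).eval x) = fun x =>
        (x / 2 * f1 x - f2 x) * (hp n).eval x - N * (f x * (hp n).eval x) := by ext x; ring
      rw [e, integral_sub (cA.mul (gc_poly _)).int ((cf.mul (gc_poly _)).cmul _).int,
        hp_eig h0 h1 cf cf1 cf2, integral_const_mul]
      simp only [hα]; ring
    rw [this]; ring
  obtain ⟨n0, hn0, hn1⟩ : ∃ n0 : ℕ, n0 ≤ J ∧ ∀ n : ℕ, n ≠ n0 → 1 / 16 ≤ ((n:ℝ)/2 - N) ^ 2 := by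
    refine ⟨⌊2 * N + 1/2⌋₊, ?_, ?_⟩
    · have : (⌊2 * N + 1/2⌋₊ : ℝ) ≤ 2 * N + 1/2 := Nat.floor_le (by linarith)
      have h2 : 2 * M ≤ ⌈2 * M⌉₊ := Nat.le_ceil _
      have : (⌊2 * N + 1/2⌋₊ : ℝ) ≤ (J : ℝ) := by rw [hJ]; push_cast; linarith
      exact_mod_cast this
    · intro n hn
      have h3 : (⌊2 * N + 1/2⌋₊ : ℝ) ≤ 2 * N + 1/2 := Nat.floor_le (by linarith)
      have h4 : 2 * N + 1/2 < (⌊2 * N + 1/2⌋₊ : ℝ) + 1 := Nat.lt_floor_add_one _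
      rcases lt_or_gt_of_ne hn with h | h
      · have : (n:ℝ) + 1 ≤ (⌊2 * N + 1/2⌋₊ : ℝ) := by exact_mod_cast h
        nlinarith
      · have : (⌊2 * N + 1/2⌋₊ : ℝ) + 1 ≤ (n:ℝ) := by exact_mod_cast h
        nlinarith
  have s3 : H - α n0 ^ 2 / hn n0 ≤ 16 * P2 := by
    have t1 := s1.sub (hasSum_ite_eq n0 (α n0 ^ 2 / hn n0))
    refine hasSum_le (fun n => ?_) t1 (s2.mul_left 16)
    have hnn := hn_pos n
    have : 0 ≤ α n ^ 2 / hn n := by positivity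
    split_ifs with h
    · subst h; rw [sub_self]; positivity
    · have := hn1 n h
      nlinarith
  set β := α n0 / hn n0 with hβ
  have hnp := hn_pos n0
  have cr : GC (fun x => f x - β * (hp n0).eval x) := cf.sub ((gc_poly _).cmul _)
  have er : ∫ x, (f x - β * (hp n0).eval x) ^ 2 ∂gm = H - α n0 ^ 2 / hn n0 := by
    have e : (fun x => (f x - β * (hp n0).eval x) ^ 2) = fun x =>
      (f x ^ 2 - 2 * β * (f x * (hp n0).eval x)) + β ^ 2 * ((hp n0).eval x * (hp n0).eval x) := by
      ext x; ring
    rw [e, integral_add (cf.sq.sub ((cf.mul (gc_poly _)).cmul _)).int (((gc_poly _).mul (gc_poly _)).cmul _).int,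
      integral_sub cf.sq.int ((cf.mul (gc_poly _)).cmul _).int, integral_const_mul, integral_const_mul]
    change H - 2 * β * α n0 + β ^ 2 * hn n0 = _
    rw [hβ]; field_simp; ring
  have hsh := gshift_sq_le cr y
  rw [er] at hsh
  set B := ∫ x, (f (x + y) - β * (hp n0).eval (x + y)) ∂gm with hB
  have eB : ∫ x, f (x + y) ∂gm = β * (y / 2) ^ n0 + B := by
    rw [hB, integral_sub (cf.shift y).int (((gc_poly _).shift y).cmul _).int, integral_const_mul, hp_shift]
    ring
  have hexp : exp (y ^ 2 / 2) ≤ 9 := by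
    have : y ^ 2 ≤ 4 := by first | nlinarith only [sq_abs y, hy2, abs_nonneg y] | nlinarith [sq_abs y, abs_nonneg y]
    have h5 : exp (y ^ 2 / 2) ≤ exp 2 := exp_le_exp.2 (by linarith)
    have h6 : exp 2 = exp 1 * exp 1 := by rw [← exp_add]; norm_num
    have := exp_one_lt_d9
    first | nlinarith only [this, h6, h5, exp_pos 1] | nlinarith [exp_pos 1]
  have hB2 : B ^ 2 ≤ 144 * P2 := by
    have : 0 ≤ H - α n0 ^ 2 / hn n0 := by rw [← er]; positivity
    first | nlinarith only [this, hexp, hsh, s3, hP0, exp_pos (y ^ 2 / 2)] | nlinarith [exp_pos (y ^ 2 / 2)]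
  have hmain : κ * (H - 16 * P2) ≤ (β * (y / 2) ^ n0) ^ 2 := by
    have q1 : κ ≤ ((y / 2) ^ n0) ^ 2 / hn n0 := by
      have : (1 / 4 : ℝ) ^ n0 ≤ ((y / 2) ^ n0) ^ 2 := by
        rw [← pow_mul, mul_comm, pow_mul]
        gcongr
        first | nlinarith only [sq_abs y, hy1] | nlinarith [sq_abs y]
      calc κ ≤ 1 / (2 ^ n0 * n0.factorial) := by
            rw [hκ]; gcongr
            · norm_num
        _ = (1 / 4 : ℝ) ^ n0 / hn n0 := by
            rw [hn_eq, div_pow, one_pow]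
            have : (4:ℝ) ^ n0 = 2 ^ n0 * 2 ^ n0 := by rw [← mul_pow]; norm_num
            rw [this]; field_simp
        _ ≤ _ := by gcongr
    have q2 : (β * (y / 2) ^ n0) ^ 2 = (α n0 ^ 2 / hn n0) * (((y / 2) ^ n0) ^ 2 / hn n0) := by
      rw [hβ]; field_simp
    rw [q2]
    have q3 : 0 ≤ α n0 ^ 2 / hn n0 := by positivity
    first | nlinarith only [q1, q3, s3, hκ0, hP0] | nlinarith
  rw [eB]
  have hPb : P2 ≤ κ / 1000 * H := hP
  have : κ * P2 ≤ P2 := mul_le_of_le_one_left hP0 hκ1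
  linarith [sq_nonneg (β * (y / 2) ^ n0 + 2 * B)]


structure Flow (w w1 w2 e : ℝ → ℝ → ℝ) (Λ K C : ℝ) : Prop where
  hΛ : 0 < Λ
  hΛ1 : Λ ≤ 1
  hK : 0 ≤ K
  hC : 0 ≤ C
  d0 : ∀ l ∈ Ioo 0 Λ, ∀ x, HasDerivAt (w l) (w1 l x) x
  d1 : ∀ l ∈ Ioo 0 Λ, ∀ x, HasDerivAt (w1 l) (w2 l x) x
  dl : ∀ l ∈ Ioo 0 Λ, ∀ x, HasDerivAt (fun l => w l x)
    (2 / l * ((x / 2 * w1 l x - w2 l x) - l ^ 2 * e l x)) l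
  c2 : ∀ l ∈ Ioo 0 Λ, Continuous (w2 l)
  ce : ∀ l ∈ Ioo 0 Λ, Continuous (e l)
  cl1 : ∀ l ∈ Ioo 0 Λ, ∀ x, ContinuousAt (fun l => w1 l x) l
  cl2 : ∀ l ∈ Ioo 0 Λ, ∀ x, ContinuousAt (fun l => w2 l x) l
  b0 : ∀ l ∈ Ioo 0 Λ, ∀ x, |w l x| ≤ C
  b1 : ∀ l ∈ Ioo 0 Λ, ∀ x, |w1 l x| ≤ C
  b2 : ∀ l ∈ Ioo 0 Λ, ∀ x, |w2 l x| ≤ C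
  be : ∀ l ∈ Ioo 0 Λ, ∀ x, |e l x| ≤ C
  he : ∀ l ∈ Ioo 0 Λ, ∀ x, |e l x| ≤ K * (|w l x| + |w1 l x| / l)
  pos : ∀ l ∈ Ioo 0 Λ, 0 < ∫ x, w l x ^ 2 ∂gm

noncomputable def fH (w : ℝ → ℝ → ℝ) (l : ℝ) : ℝ := ∫ x, w l x ^ 2 ∂gm
noncomputable def fA (w1 w2 : ℝ → ℝ → ℝ) (l x : ℝ) : ℝ := x / 2 * w1 l x - w2 l x
noncomputable def fP (w w1 w2 : ℝ → ℝ → ℝ) (l : ℝ) : ℝ :=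
  ∫ x, (fA w1 w2 l x - fH w1 l / fH w l * w l x) ^ 2 ∂gm

namespace Flow
variable {w w1 w2 e : ℝ → ℝ → ℝ} {Λ K C : ℝ}

lemma g0 (h : Flow w w1 w2 e Λ K C) {l : ℝ} (hl : l ∈ Ioo 0 Λ) : GC (w l) :=
  gc_bdd (continuous_iff_continuousAt.2 fun x => (h.d0 l hl x).continuousAt) C (h.b0 l hl)
lemma g1 (h : Flow w w1 w2 e Λ K C) {l : ℝ} (hl : l ∈ Ioo 0 Λ) : GC (w1 l) :=
  gc_bdd (continuous_iff_continuousAt.2 fun x => (h.d1 l hl x).continuousAt) C (h.b1 l hl)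
lemma g2 (h : Flow w w1 w2 e Λ K C) {l : ℝ} (hl : l ∈ Ioo 0 Λ) : GC (w2 l) :=
  gc_bdd (h.c2 l hl) C (h.b2 l hl)
lemma ge (h : Flow w w1 w2 e Λ K C) {l : ℝ} (hl : l ∈ Ioo 0 Λ) : GC (e l) :=
  gc_bdd (h.ce l hl) C (h.be l hl)
lemma gA (h : Flow w w1 w2 e Λ K C) {l : ℝ} (hl : l ∈ Ioo 0 Λ) : GC (fA w1 w2 l) := by
  have := ((gc_id.mul (h.g1 hl)).cmul (1/2)).sub (h.g2 hl)
  convert this using 1; ext x; simp only [fA]; ring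

noncomputable def wl (w1 w2 e : ℝ → ℝ → ℝ) (l x : ℝ) : ℝ := 2 / l * (fA w1 w2 l x - l ^ 2 * e l x)

lemma gl (h : Flow w w1 w2 e Λ K C) {l : ℝ} (hl : l ∈ Ioo 0 Λ) : GC (wl w1 w2 e l) :=
  ((h.gA hl).sub ((h.ge hl).cmul _)).cmul _

lemma bA (h : Flow w w1 w2 e Λ K C) {l : ℝ} (hl : l ∈ Ioo 0 Λ) (x : ℝ) :
    |fA w1 w2 l x| ≤ C * (|x| + 1) := by
  have h1 := h.b1 l hl x
  have h2 := h.b2 l hl x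
  have h3 : |x / 2 * w1 l x| ≤ |x| * C := by
    rw [abs_mul, abs_div, abs_two]
    have := abs_nonneg x
    have := abs_nonneg (w1 l x)
    nlinarith
  calc |fA w1 w2 l x| ≤ |x / 2 * w1 l x| + |w2 l x| := abs_sub _ _
    _ ≤ _ := by linarith

lemma bl (h : Flow w w1 w2 e Λ K C) {l m : ℝ} (hm : 0 < m) (hml : m ≤ l) (hl : l ∈ Ioo 0 Λ) (x : ℝ) :
    |wl w1 w2 e l x| ≤ 2 / m * (C * (|x| + 2)) := by
  have h1 := h.bA hl x
  have h2 := h.be l hl x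
  have hl1 : l ^ 2 ≤ 1 := by nlinarith [hl.1, hl.2, h.hΛ1]
  have h3 : |l ^ 2 * e l x| ≤ C := by
    rw [abs_mul, abs_of_nonneg (sq_nonneg l)]
    nlinarith [abs_nonneg (e l x), h.hC, sq_nonneg l]
  have h4 : |fA w1 w2 l x - l ^ 2 * e l x| ≤ C * (|x| + 2) :=
    (abs_sub _ _).trans (by linarith)
  rw [wl, abs_mul, abs_of_pos (div_pos two_pos hl.1)]
  gcongr

lemma gbd (c : ℝ) : GC (fun x => c * (|x| + 2)) := ((gc_id.abs).add (gc_const 2)).cmul c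

lemma deriv_int (h : Flow w w1 w2 e Λ K C) {l : ℝ} (hl : l ∈ Ioo 0 Λ) {g : ℝ → ℝ} (hg : GC g) :
    HasDerivAt (fun l => ∫ x, w l x * g x ∂gm) (∫ x, wl w1 w2 e l x * g x ∂gm) l := by
  have hs : Ioo (l/2) Λ ∈ nhds l := Ioo_mem_nhds (by linarith [hl.1]) hl.2
  have hmem : ∀ m ∈ Ioo (l/2) Λ, m ∈ Ioo 0 Λ := fun m hm => ⟨by linarith [hm.1, hl.1], hm.2⟩
  refine (hasDerivAt_integral_of_dominated_loc_of_deriv_le (F := fun l x => w l x * g x)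
    (F' := fun l x => wl w1 w2 e l x * g x)
    (bound := fun x => (2 / (l/2) * (C * (|x| + 2))) * |g x|) hs ?_ ?_ ?_ ?_ ?_ ?_).2
  · filter_upwards [hs] with m hm
    exact ((h.g0 (hmem m hm)).mul hg).cont.aestronglyMeasurable
  · exact ((h.g0 hl).mul hg).int
  · exact ((h.gl hl).mul hg).cont.aestronglyMeasurable
  · refine Filter.Eventually.of_forall fun x m hm => ?_
    rw [norm_mul, Real.norm_eq_abs, Real.norm_eq_abs]
    exact mul_le_mul_of_nonneg_right (h.bl (by linarith [hl.1]) hm.1.le (hmem m hm) x) (abs_nonneg _)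
  · exact (((gbd C).cmul _).mul hg.abs).int
  · refine Filter.Eventually.of_forall fun x m hm => ?_
    exact (h.dl m (hmem m hm) x).mul_const _

lemma deriv_H (h : Flow w w1 w2 e Λ K C) {l : ℝ} (hl : l ∈ Ioo 0 Λ) :
    HasDerivAt (fH w) (4 / l * (fH w1 l - l ^ 2 * ∫ x, w l x * e l x ∂gm)) l := by
  have hs : Ioo (l/2) Λ ∈ nhds l := Ioo_mem_nhds (by linarith [hl.1]) hl.2
  have hmem : ∀ m ∈ Ioo (l/2) Λ, m ∈ Ioo 0 Λ := fun m hm => ⟨by linarith [hm.1, hl.1], hm.2⟩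
  have key := (hasDerivAt_integral_of_dominated_loc_of_deriv_le (μ := gm) (F := fun l x => w l x ^ 2)
    (F' := fun l x => 2 * w l x * wl w1 w2 e l x)
    (bound := fun x => 2 * C * (2 / (l/2) * (C * (|x| + 2)))) hs ?_ ?_ ?_ ?_ ?_ ?_).2
  · refine key.congr_deriv ?_
    have e1 : ∫ x, w l x * fA w1 w2 l x ∂gm = fH w1 l := by
      have := dirichlet (h.d1 l hl) (h.d0 l hl) (h.g1 hl) (h.g2 hl) (h.g0 hl) (h.g1 hl)
      rw [fH]; simp only [pow_two]; exact this
    have e2 : (fun x => 2 * w l x * wl w1 w2 e l x) = fun x =>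
        4 / l * (w l x * fA w1 w2 l x) - 4 / l * l ^ 2 * (w l x * e l x) := by
      ext x; simp only [wl]; ring
    rw [e2, integral_sub (((h.g0 hl).mul (h.gA hl)).cmul _).int (((h.g0 hl).mul (h.ge hl)).cmul _).int,
      integral_const_mul, integral_const_mul, e1]
    ring
  · filter_upwards [hs] with m hm
    exact (h.g0 (hmem m hm)).sq.cont.aestronglyMeasurable
  · exact (h.g0 hl).sq.int
  · exact (((h.g0 hl).cmul 2).mul (h.gl hl)).cont.aestronglyMeasurable
  · refine Filter.Eventually.of_forall fun x m hm => ?_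
    have hh := h.b0 m (hmem m hm) x
    have h5 := h.bl (by linarith [hl.1]) hm.1.le (hmem m hm) x
    rw [norm_mul, norm_mul, Real.norm_eq_abs, Real.norm_eq_abs, Real.norm_eq_abs, abs_two]
    have := h.hC
    gcongr
  · exact (((gbd C).cmul _).cmul _).int
  · refine Filter.Eventually.of_forall fun x m hm => ?_
    have := (h.dl m (hmem m hm) x).pow 2
    refine (this.congr_deriv ?_)
    simp [wl, fA]

lemma deriv_E (h : Flow w w1 w2 e Λ K C) {l : ℝ} (hl : l ∈ Ioo 0 Λ) :
    HasDerivAt (fH w1) (4 / l * (∫ x, fA w1 w2 l x ^ 2 ∂gm - l ^ 2 * ∫ x, e l x * fA w1 w2 l x ∂gm)) l := by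
  have hs : Ioo (l/2) Λ ∈ nhds l := Ioo_mem_nhds (by linarith [hl.1]) hl.2
  have hmem : ∀ m ∈ Ioo (l/2) Λ, m ∈ Ioo 0 Λ := fun m hm => ⟨by linarith [hm.1, hl.1], hm.2⟩
  have hl' : l ∈ Ioo (l/2) Λ := ⟨by linarith [hl.1], hl.2⟩
  rw [hasDerivAt_iff_tendsto_slope]
  have hid : ∀ m ∈ Ioo (l/2) Λ, m ≠ l → slope (fH w1) l m =
      ∫ x, (m - l)⁻¹ * (w m x - w l x) * (fA w1 w2 m x + fA w1 w2 l x) ∂gm := by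
    intro m hm _
    have hm' := hmem m hm
    have := dirichlet (f1 := fun x => w1 m x + w1 l x) (f2 := fun x => w2 m x + w2 l x)
      (g := fun x => w m x - w l x) (g1 := fun x => w1 m x - w1 l x)
      (fun x => (h.d1 m hm' x).add (h.d1 l hl x)) (fun x => (h.d0 m hm' x).sub (h.d0 l hl x))
      ((h.g1 hm').add (h.g1 hl)) ((h.g2 hm').add (h.g2 hl)) ((h.g0 hm').sub (h.g0 hl))
      ((h.g1 hm').sub (h.g1 hl))
    rw [slope_def_field, fH, fH, ← integral_sub (h.g1 hm').sq.int (h.g1 hl).sq.int, div_eq_inv_mul]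
    simp only [mul_assoc]
    rw [integral_const_mul]
    congr 1
    have e1 : (fun x => w1 m x ^ 2 - w1 l x ^ 2) = fun x => (w1 m x - w1 l x) * (w1 m x + w1 l x) := by
      ext x; ring
    rw [e1, ← this]
    congr 1; ext x; simp only [fA]; ring
  have hlim : (4 / l * (∫ x, fA w1 w2 l x ^ 2 ∂gm - l ^ 2 * ∫ x, e l x * fA w1 w2 l x ∂gm)) =
      ∫ x, wl w1 w2 e l x * (fA w1 w2 l x + fA w1 w2 l x) ∂gm := by
    have e2 : (fun x => wl w1 w2 e l x * (fA w1 w2 l x + fA w1 w2 l x)) = fun x =>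
      4 / l * fA w1 w2 l x ^ 2 - 4 / l * l ^ 2 * (e l x * fA w1 w2 l x) := by
      ext x; simp only [wl]; ring
    rw [e2, integral_sub ((h.gA hl).sq.cmul _).int (((h.ge hl).mul (h.gA hl)).cmul _).int,
      integral_const_mul, integral_const_mul]
    ring
  rw [hlim]
  have hev : ∀ᶠ m in nhdsWithin l {l}ᶜ, m ∈ Ioo (l/2) Λ ∧ m ≠ l :=
    (Filter.Eventually.and (nhdsWithin_le_nhds hs) self_mem_nhdsWithin)
  refine Filter.Tendsto.congr' (f₁ := fun m => ∫ x, (m - l)⁻¹ * (w m x - w l x) *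
    (fA w1 w2 m x + fA w1 w2 l x) ∂gm) (hev.mono fun m hm => (hid m hm.1 hm.2).symm) ?_
  refine tendsto_integral_filter_of_dominated_convergence
    (fun x => (2 / (l/2) * (C * (|x| + 2))) * (2 * (C * (|x| + 2)))) ?_ ?_ ?_ ?_
  · filter_upwards [hev] with m hm
    have hm' := hmem m hm.1
    exact ((((h.g0 hm').sub (h.g0 hl)).cmul _).mul ((h.gA hm').add (h.gA hl))).cont.aestronglyMeasurable
  · filter_upwards [hev] with m hm
    refine Filter.Eventually.of_forall fun x => ?_
    have hm' := hmem m hm.1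
    have hsub : |w m x - w l x| ≤ (2 / (l/2) * (C * (|x| + 2))) * |m - l| := by
      have := Convex.norm_image_sub_le_of_norm_hasDerivWithin_le (f := fun l => w l x)
        (f' := fun l => wl w1 w2 e l x) (s := Ioo (l/2) Λ) (C := 2 / (l/2) * (C * (|x| + 2)))
        (fun k hk => (h.dl k (hmem k hk) x).hasDerivWithinAt)
        (fun k hk => h.bl (by linarith [hl.1]) hk.1.le (hmem k hk) x) (convex_Ioo _ _) hl' hm.1
      simpa using this
    have hml : 0 < |m - l| := abs_pos.2 (sub_ne_zero.2 hm.2)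
    rw [norm_mul, norm_mul, Real.norm_eq_abs, Real.norm_eq_abs, Real.norm_eq_abs, abs_inv]
    have hC := h.hC
    have hl0 := hl.1
    apply mul_le_mul
    · rw [inv_mul_le_iff₀ hml, mul_comm]; exact hsub
    · have q1 := h.bA hm' x
      have q2 := h.bA hl x
      refine (abs_add_le _ _).trans ?_
      linarith
    · exact abs_nonneg _
    · positivity
  · exact (((gbd C).cmul _).mul ((gbd C).cmul _)).int
  · refine Filter.Eventually.of_forall fun x => ?_
    have t1 : Filter.Tendsto (fun m => (m - l)⁻¹ * (w m x - w l x)) (nhdsWithin l {l}ᶜ) (nhds (wl w1 w2 e l x)) := by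
      have := hasDerivAt_iff_tendsto_slope.1 (h.dl l hl x)
      refine this.congr fun m => ?_
      rw [slope_def_field, div_eq_inv_mul]
    have t2 : Filter.Tendsto (fun m => fA w1 w2 m x) (nhdsWithin l {l}ᶜ) (nhds (fA w1 w2 l x)) := by
      have c : ContinuousAt (fun m => fA w1 w2 m x) l :=
        ((h.cl1 l hl x).const_mul _).sub (h.cl2 l hl x)
      exact c.tendsto.mono_left nhdsWithin_le_nhds
    exact t1.mul (t2.add tendsto_const_nhds)

lemma e_sq (h : Flow w w1 w2 e Λ K C) {l : ℝ} (hl : l ∈ Ioo 0 Λ) :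
    ∫ x, e l x ^ 2 ∂gm ≤ 2 * K ^ 2 * (fH w l + fH w1 l / l ^ 2) := by
  have hl0 := hl.1
  have hK := h.hK
  have e1 : 2 * K ^ 2 * (fH w l + fH w1 l / l ^ 2) = ∫ x, (2 * K ^ 2 * w l x ^ 2 + 2 * K ^ 2 / l ^ 2 * w1 l x ^ 2) ∂gm := by
    rw [integral_add ((h.g0 hl).sq.cmul _).int ((h.g1 hl).sq.cmul _).int, integral_const_mul, integral_const_mul]
    simp only [fH]; ring
  rw [e1]
  refine integral_mono (h.ge hl).sq.int (((h.g0 hl).sq.cmul _).add ((h.g1 hl).sq.cmul _)).int fun x => ?_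
  have h1 := h.he l hl x
  have h2 : e l x ^ 2 ≤ (K * (|w l x| + |w1 l x| / l)) ^ 2 := by
    rw [← sq_abs (e l x)]; exact pow_le_pow_left₀ (abs_nonneg _) h1 2
  refine h2.trans ?_
  have h3 : 2 * K ^ 2 * w l x ^ 2 + 2 * K ^ 2 / l ^ 2 * w1 l x ^ 2 - (K * (|w l x| + |w1 l x| / l)) ^ 2
    = K ^ 2 * (|w l x| - |w1 l x| / l) ^ 2 := by
    rw [← sq_abs (w l x), ← sq_abs (w1 l x)]; field_simp; ring
  linarith [mul_nonneg (sq_nonneg K) (sq_nonneg (|w l x| - |w1 l x| / l))]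

noncomputable def fN (w w1 : ℝ → ℝ → ℝ) (l : ℝ) : ℝ := fH w1 l / fH w l

lemma N_nonneg (l : ℝ) : 0 ≤ fN w w1 l :=
  div_nonneg (integral_nonneg fun _ => sq_nonneg _) (integral_nonneg fun _ => sq_nonneg _)

lemma P_nonneg (l : ℝ) : 0 ≤ fP w w1 w2 l := integral_nonneg fun _ => sq_nonneg _

noncomputable def ff (w w1 : ℝ → ℝ → ℝ) (K l : ℝ) : ℝ := (fN w w1 l + 1) * exp (2 * K ^ 2 * l ^ 2)

lemma deriv_f (h : Flow w w1 w2 e Λ K C) {l : ℝ} (hl : l ∈ Ioo 0 Λ) :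
    ∃ d, HasDerivAt (ff w w1 K) d l ∧ 2 * fP w w1 w2 l / (l * fH w l) ≤ d := by
  have hl0 := hl.1
  have hl1 : l ≤ 1 := hl.2.le.trans h.hΛ1
  have hH : 0 < fH w l := h.pos l hl
  set H := fH w l with hHd
  set E := fH w1 l with hEd
  set N := fN w w1 l with hNd
  set Q := ∫ x, fA w1 w2 l x ^ 2 ∂gm with hQ
  set I := ∫ x, w l x * e l x ∂gm with hI
  set G := ∫ x, e l x * fA w1 w2 l x ∂gm with hG
  set P := fP w w1 w2 l with hPd
  have hNE : N = E / H := rfl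
  have hN0 : 0 ≤ N := N_nonneg l
  have dN := (h.deriv_E hl).div (h.deriv_H hl) hH.ne'
  have dexp : HasDerivAt (fun l => exp (2 * K ^ 2 * l ^ 2)) (exp (2 * K ^ 2 * l ^ 2) * (2 * K ^ 2 * (2 * l))) l := by
    have : HasDerivAt (fun l : ℝ => 2 * K ^ 2 * l ^ 2) (2 * K ^ 2 * (2 * l)) l := by
      simpa using (hasDerivAt_pow 2 l).const_mul (2 * K ^ 2)
    exact this.exp
  have dF := (dN.add_const 1).mul dexp
  have ewA : ∫ x, w l x * fA w1 w2 l x ∂gm = E := by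
    have := dirichlet (h.d1 l hl) (h.d0 l hl) (h.g1 hl) (h.g2 hl) (h.g0 hl) (h.g1 hl)
    rw [hEd, fH]; simp only [pow_two]; exact this
  have hPQ : P = Q - E ^ 2 / H := by
    have e1 : (fun x => (fA w1 w2 l x - N * w l x) ^ 2) = fun x =>
      (fA w1 w2 l x ^ 2 - 2 * N * (w l x * fA w1 w2 l x)) + N ^ 2 * w l x ^ 2 := by ext x; ring
    have e2 : P = ∫ x, (fA w1 w2 l x - N * w l x) ^ 2 ∂gm := rfl
    rw [e2, e1, integral_add ((h.gA hl).sq.sub (((h.g0 hl).mul (h.gA hl)).cmul _)).int ((h.g0 hl).sq.cmul _).int,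
      integral_sub (h.gA hl).sq.int (((h.g0 hl).mul (h.gA hl)).cmul _).int, integral_const_mul,
      integral_const_mul, ewA]
    change Q - 2 * N * E + N ^ 2 * H = _
    rw [hNE]; field_simp; ring
  have gB : GC (fun x => fA w1 w2 l x - N * w l x) := (h.gA hl).sub ((h.g0 hl).cmul _)
  set S := ∫ x, e l x ^ 2 ∂gm with hS
  have hcs : (G - N * I) ^ 2 ≤ S * P := by
    have := gcs (h.ge hl) gB
    have e1 : ∫ x, e l x * (fA w1 w2 l x - N * w l x) ∂gm = G - N * I := by
      have : (fun x => e l x * (fA w1 w2 l x - N * w l x)) = fun x => e l x * fA w1 w2 l x - N * (w l x * e l x) := by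
        ext x; ring
      rw [this, integral_sub ((h.ge hl).mul (h.gA hl)).int (((h.g0 hl).mul (h.ge hl)).cmul _).int,
        integral_const_mul]
    rw [e1] at this; exact this
  have hSb : S ≤ 2 * K ^ 2 * (H + E / l ^ 2) := h.e_sq hl
  have hP0 : 0 ≤ P := P_nonneg l
  have hS0 : 0 ≤ S := integral_nonneg fun _ => sq_nonneg _
  have hEN : E = N * H := by rw [hNE]; field_simp
  have hb : l ^ 2 * (G - N * I) ≤ P / 2 + l ^ 4 * S / 2 := by
    have h1 : (l ^ 2 * (G - N * I)) ^ 2 ≤ (P / 2 + l ^ 4 * S / 2) ^ 2 := by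
      have : (l ^ 2 * (G - N * I)) ^ 2 ≤ l ^ 4 * (S * P) := by
        rw [mul_pow]; have : (l ^ 2) ^ 2 = l ^ 4 := by ring
        rw [this]; gcongr
      linarith [sq_nonneg (P - l ^ 4 * S)]
    exact (abs_le_of_sq_le_sq' h1 (by positivity)).2
  refine ⟨_, dF, ?_⟩
  have hd : (4 / l * (Q - l ^ 2 * G) * H - E * (4 / l * (E - l ^ 2 * I))) / H ^ 2 =
      4 / (l * H) * (P - l ^ 2 * (G - N * I)) := by
    rw [hPQ, hEN]; field_simp; ring
  have hd2 : 2 * P / (l * H) - 4 * K ^ 2 * l * (N + 1) ≤ 4 / (l * H) * (P - l ^ 2 * (G - N * I)) := by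
    have h1 : 4 / (l * H) * (P / 2 - l ^ 4 * (2 * K ^ 2 * (H + E / l ^ 2)) / 2) ≤
        4 / (l * H) * (P - l ^ 2 * (G - N * I)) := by
      have : l ^ 4 * S ≤ l ^ 4 * (2 * K ^ 2 * (H + E / l ^ 2)) := by gcongr
      exact mul_le_mul_of_nonneg_left (by linarith) (by positivity)
    refine le_trans ?_ h1
    have h2 : 4 / (l * H) * (P / 2 - l ^ 4 * (2 * K ^ 2 * (H + E / l ^ 2)) / 2) =
      2 * P / (l * H) - 4 * K ^ 2 * l * (N + l ^ 2) := by
      rw [hEN]; field_simp; ring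
    rw [h2]
    have : l ^ 2 ≤ 1 := by first | exact pow_le_one₀ hl.1.le (hl.2.le.trans h.hΛ1) | nlinarith
    have : 4 * K ^ 2 * l * (N + l ^ 2) ≤ 4 * K ^ 2 * l * (N + 1) := by gcongr
    linarith
  change _ ≤ (4 / l * (Q - l ^ 2 * G) * H - E * (4 / l * (E - l ^ 2 * I))) / H ^ 2 * exp (2 * K ^ 2 * l ^ 2) +
    (N + 1) * (exp (2 * K ^ 2 * l ^ 2) * (2 * K ^ 2 * (2 * l)))
  rw [hd]
  set X := 4 / (l * H) * (P - l ^ 2 * (G - N * I)) with hX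
  have hexp : 1 ≤ exp (2 * K ^ 2 * l ^ 2) := one_le_exp (by positivity)
  have h0 : 0 ≤ 2 * P / (l * H) := by positivity
  have hfin : 2 * P / (l * H) ≤ X + (N + 1) * (2 * K ^ 2 * (2 * l)) := by linarith
  calc 2 * P / (l * H) ≤ (X + (N + 1) * (2 * K ^ 2 * (2 * l))) * 1 := by linarith
    _ ≤ (X + (N + 1) * (2 * K ^ 2 * (2 * l))) * exp (2 * K ^ 2 * l ^ 2) := by
        gcongr; linarith
    _ = _ := by ring

lemma f_mono (h : Flow w w1 w2 e Λ K C) : MonotoneOn (ff w w1 K) (Ioo 0 Λ) := by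
  refine monotoneOn_of_deriv_nonneg (convex_Ioo _ _) ?_ ?_ ?_
  · intro l hl
    obtain ⟨d, hd, _⟩ := h.deriv_f hl
    exact hd.continuousAt.continuousWithinAt
  · intro l hl
    rw [interior_Ioo] at hl
    obtain ⟨d, hd, _⟩ := h.deriv_f hl
    exact hd.differentiableAt.differentiableWithinAt
  · intro l hl
    rw [interior_Ioo] at hl
    obtain ⟨d, hd, h2⟩ := h.deriv_f hl
    rw [hd.deriv]
    refine le_trans ?_ h2
    have := h.pos l hl
    have := P_nonneg (w := w) (w1 := w1) (w2 := w2) l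
    exact div_nonneg (by linarith) (mul_nonneg hl.1.le (h.pos l hl).le)

lemma N_le (h : Flow w w1 w2 e Λ K C) {l l' : ℝ} (hl : l ∈ Ioo 0 Λ) (hl' : l' ∈ Ioo 0 Λ) (hll : l ≤ l') :
    fN w w1 l ≤ (fN w w1 l' + 1) * exp (2 * K ^ 2) := by
  have h1 := h.f_mono hl hl' hll
  have h2 : fN w w1 l + 1 ≤ ff w w1 K l := by
    rw [ff]
    have : 1 ≤ exp (2 * K ^ 2 * l ^ 2) := one_le_exp (by positivity)
    have := N_nonneg (w := w) (w1 := w1) l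
    nlinarith
  have h3 : ff w w1 K l' ≤ (fN w w1 l' + 1) * exp (2 * K ^ 2) := by
    rw [ff]
    have := N_nonneg (w := w) (w1 := w1) l'
    have : l' ^ 2 ≤ 1 := by nlinarith [hl'.1, hl'.2, h.hΛ1]
    refine mul_le_mul_of_nonneg_left (exp_le_exp.2 ?_) (by linarith)
    nlinarith [sq_nonneg K]
  linarith

lemma exists_P (h : Flow w w1 w2 e Λ K C) {l1 l2 : ℝ} (h1 : l1 ∈ Ioo 0 Λ) (h2 : l2 ∈ Ioo 0 Λ) (h12 : l1 < l2) :
    ∃ l ∈ Ioo l1 l2, 2 * fP w w1 w2 l / (l * fH w l) * (l2 - l1) ≤ ff w w1 K l2 - ff w w1 K l1 := by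
  have hmem : ∀ l ∈ Icc l1 l2, l ∈ Ioo 0 Λ := fun l hl => ⟨h1.1.trans_le hl.1, hl.2.trans_lt h2.2⟩
  have hd : ∀ l ∈ Icc l1 l2, ∃ d, HasDerivAt (ff w w1 K) d l ∧ 2 * fP w w1 w2 l / (l * fH w l) ≤ d :=
    fun l hl => h.deriv_f (hmem l hl)
  choose! d hd1 hd2 using hd
  obtain ⟨l, hl, hs⟩ := exists_hasDerivAt_eq_slope (ff w w1 K) d h12
    (fun l hl => (hd1 l hl).continuousAt.continuousWithinAt) (fun l hl => hd1 l (Ioo_subset_Icc_self hl))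
  refine ⟨l, hl, ?_⟩
  have := hd2 l (Ioo_subset_Icc_self hl)
  rw [hs, le_div_iff₀ (sub_pos.2 h12)] at this
  exact this

end Flow

namespace Flow
variable {w w1 w2 e : ℝ → ℝ → ℝ} {Λ K C : ℝ}

lemma H_nonneg (w : ℝ → ℝ → ℝ) (l : ℝ) : 0 ≤ fH w l := integral_nonneg fun _ => sq_nonneg _

lemma E_le (h : Flow w w1 w2 e Λ K C) {l M : ℝ} (hl : l ∈ Ioo 0 Λ) (hN : fN w w1 l ≤ M) :
    fH w1 l ≤ M * fH w l := by
  have : 0 < fH w l := h.pos l hl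
  rwa [fN, div_le_iff₀ this] at hN

lemma I_le (h : Flow w w1 w2 e Λ K C) {l M : ℝ} (hl : l ∈ Ioo 0 Λ) (hN : fN w w1 l ≤ M) :
    4 * l * |∫ x, w l x * e l x ∂gm| ≤ 4 * K * (2 + M) * fH w l := by
  have hl0 := hl.1
  have hl1 : l ≤ 1 := hl.2.le.trans h.hΛ1
  have hK := h.hK
  have hH : 0 < fH w l := h.pos l hl
  have hE := h.E_le hl hN
  have hE0 := H_nonneg w1 l
  have h1 : |∫ x, w l x * e l x ∂gm| ≤ ∫ x, (K * (1 + 1 / (2 * l)) * w l x ^ 2 + K / (2 * l) * w1 l x ^ 2) ∂gm := by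
    refine (abs_integral_le_integral_abs).trans ?_
    refine integral_mono ((h.g0 hl).mul (h.ge hl)).abs.int
      (((h.g0 hl).sq.cmul _).add ((h.g1 hl).sq.cmul _)).int fun x => ?_
    simp only
    rw [abs_mul]
    have h2 := h.he l hl x
    have h3 : |w l x| * |e l x| ≤ |w l x| * (K * (|w l x| + |w1 l x| / l)) := by gcongr
    refine h3.trans ?_
    have : K * (1 + 1 / (2 * l)) * w l x ^ 2 + K / (2 * l) * w1 l x ^ 2 - |w l x| * (K * (|w l x| + |w1 l x| / l))
      = K / (2 * l) * (|w l x| - |w1 l x|) ^ 2 := by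
      rw [← sq_abs (w l x), ← sq_abs (w1 l x)]; field_simp; ring
    have h4 : 0 ≤ K / (2 * l) * (|w l x| - |w1 l x|) ^ 2 := by positivity
    linarith
  rw [integral_add ((h.g0 hl).sq.cmul _).int ((h.g1 hl).sq.cmul _).int, integral_const_mul, integral_const_mul] at h1
  change _ ≤ K * (1 + 1 / (2 * l)) * fH w l + K / (2 * l) * fH w1 l at h1
  calc 4 * l * |∫ x, w l x * e l x ∂gm| ≤ 4 * l * (K * (1 + 1 / (2 * l)) * fH w l + K / (2 * l) * fH w1 l) := by gcongr
    _ = K * (4 * l * fH w l + 2 * fH w l + 2 * fH w1 l) := by field_simp; ring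
    _ ≤ K * (4 * 1 * fH w l + 4 * fH w l + 4 * (M * fH w l)) := by gcongr <;> norm_num
    _ = _ := by ring

lemma H_dbl (h : Flow w w1 w2 e Λ K C) {M l0 : ℝ} (hl0 : l0 < Λ) (hN : ∀ l ∈ Ioc 0 l0, fN w w1 l ≤ M)
    {l l' : ℝ} (hl : 0 < l) (hll : l ≤ l') (hl' : l' ≤ l0) :
    fH w l ≤ exp (4 * K * (2 + M)) * fH w l' := by
  set D := 4 * K * (2 + M) with hD
  have hmem : ∀ s ∈ Icc l l', s ∈ Ioo 0 Λ := fun s hs => ⟨hl.trans_le hs.1, by linarith [hs.2]⟩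
  have hM : 0 ≤ M := (N_nonneg l).trans (hN l ⟨hl, hll.trans hl'⟩)
  have hK := h.hK
  have hD0 : 0 ≤ D := by positivity
  have hder : ∀ s ∈ Icc l l', HasDerivAt (fun s => fH w s * exp (D * s))
      ((4 / s * (fH w1 s - s ^ 2 * ∫ x, w s x * e s x ∂gm)) * exp (D * s) + fH w s * (exp (D * s) * (D * 1))) s :=
    fun s hs => (h.deriv_H (hmem s hs)).mul (((hasDerivAt_id s).const_mul D).exp)
  have hmono : MonotoneOn (fun s => fH w s * exp (D * s)) (Icc l l') := by
    refine monotoneOn_of_deriv_nonneg (convex_Icc _ _) (fun s hs => (hder s hs).continuousAt.continuousWithinAt) ?_ ?_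
    · intro s hs
      exact (hder s (interior_subset hs)).differentiableAt.differentiableWithinAt
    · intro s hs
      have hs := interior_subset hs
      have hsm := hmem s hs
      rw [(hder s hs).deriv]
      have hI := h.I_le hsm (hN s ⟨hsm.1, hs.2.trans hl'⟩)
      have hs0 := hsm.1
      have hE := H_nonneg w1 s
      set I := ∫ x, w s x * e s x ∂gm
      have e1 : 4 / s * (fH w1 s - s ^ 2 * I) = 4 / s * fH w1 s - 4 * s * I := by field_simp
      have e2 : 0 ≤ 4 / s * fH w1 s := by positivity
      have e3 : 4 * s * I ≤ 4 * s * |I| := by gcongr; exact le_abs_self _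
      have e4 : 0 ≤ 4 / s * (fH w1 s - s ^ 2 * I) + D * fH w s := by rw [e1]; linarith
      have := mul_nonneg e4 (exp_pos (D * s)).le
      linarith
  have := hmono ⟨le_rfl, hll⟩ ⟨hll, le_rfl⟩ hll
  simp only at this
  have hH := H_nonneg w l
  have hH' := H_nonneg w l'
  have hl1 : l' ≤ 1 := by linarith [h.hΛ1]
  calc fH w l ≤ fH w l * exp (D * l) := le_mul_of_one_le_right hH (one_le_exp (by positivity))
    _ ≤ fH w l' * exp (D * l') := this
    _ ≤ fH w l' * exp D := by
      refine mul_le_mul_of_nonneg_left (exp_le_exp.2 ?_) hH'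
      nlinarith
    _ = _ := mul_comm _ _

lemma H_low (h : Flow w w1 w2 e Λ K C) {M l0 : ℝ} (hl0 : l0 < Λ) (hN : ∀ l ∈ Ioc 0 l0, fN w w1 l ≤ M)
    (n : ℕ) (hn : 4 * M + 4 * K * (2 + M) ≤ n)
    {l l' : ℝ} (hl : 0 < l) (hll : l ≤ l') (hl' : l' ≤ l0) :
    fH w l' * l ^ n ≤ fH w l * l' ^ n := by
  have hmem : ∀ s ∈ Icc l l', s ∈ Ioo 0 Λ := fun s hs => ⟨hl.trans_le hs.1, by linarith [hs.2]⟩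
  have hder : ∀ s ∈ Icc l l', HasDerivAt (fun s => fH w s / s ^ n)
      (((4 / s * (fH w1 s - s ^ 2 * ∫ x, w s x * e s x ∂gm)) * s ^ n - fH w s * (n * s ^ (n - 1))) / (s ^ n) ^ 2) s :=
    fun s hs => (h.deriv_H (hmem s hs)).div (hasDerivAt_pow n s) (pow_ne_zero _ (hmem s hs).1.ne')
  have hmono : AntitoneOn (fun s => fH w s / s ^ n) (Icc l l') := by
    refine antitoneOn_of_deriv_nonpos (convex_Icc _ _) (fun s hs => (hder s hs).continuousAt.continuousWithinAt) ?_ ?_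
    · intro s hs
      exact (hder s (interior_subset hs)).differentiableAt.differentiableWithinAt
    · intro s hs
      have hs := interior_subset hs
      have hsm := hmem s hs
      have hs0 := hsm.1
      rw [(hder s hs).deriv]
      have hNs := hN s ⟨hsm.1, hs.2.trans hl'⟩
      have hI := h.I_le hsm hNs
      have hE := h.E_le hsm hNs
      have hH := H_nonneg w s
      have hs1 : s ≤ 1 := hsm.2.le.trans h.hΛ1
      have hK := h.hK
      have hM : 0 ≤ M := (N_nonneg s).trans hNs
      set I := ∫ x, w s x * e s x ∂gm
      refine div_nonpos_of_nonpos_of_nonneg ?_ (sq_nonneg _)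
      have e1 : 4 / s * (fH w1 s - s ^ 2 * I) = (4 * fH w1 s - s * (4 * s * I)) / s := by field_simp
      have e3 : -(4 * s * I) ≤ 4 * s * |I| := by
        have := neg_abs_le I
        have : -I ≤ |I| := by linarith
        nlinarith
      have e4 : s * (-(4 * s * I)) ≤ 4 * K * (2 + M) * fH w s := by
        calc s * (-(4 * s * I)) ≤ s * (4 * K * (2 + M) * fH w s) := by
              apply mul_le_mul_of_nonneg_left _ hs0.le; linarith
          _ ≤ 1 * (4 * K * (2 + M) * fH w s) := by
              apply mul_le_mul_of_nonneg_right hs1; positivity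
          _ = _ := one_mul _
      have e5 : 4 * fH w1 s - s * (4 * s * I) ≤ n * fH w s := by nlinarith
      rcases Nat.eq_zero_or_pos n with rfl | hn0
      · rw [e1]; simp at e5 ⊢
        exact div_nonpos_of_nonpos_of_nonneg (by linarith) hs0.le
      · obtain ⟨k, rfl⟩ : ∃ k, n = k + 1 := ⟨n - 1, by omega⟩
        rw [e1, Nat.add_sub_cancel, pow_succ]
        have : (4 * fH w1 s - s * (4 * s * I)) / s * (s ^ k * s) = (4 * fH w1 s - s * (4 * s * I)) * s ^ k := by
          field_simp
        rw [this]
        have hk : 0 ≤ s ^ k := by positivity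
        nlinarith
  have := hmono ⟨le_rfl, hll⟩ ⟨hll, le_rfl⟩ hll
  simp only at this
  rwa [div_le_div_iff₀ (pow_pos (hl.trans_le hll) n) (pow_pos hl n)] at this

noncomputable def D0 (K M : ℝ) : ℝ := 2 * (√(2 * K ^ 2 * (1 + M)) * √(exp (4 * K * (2 + M))))

lemma D0_nonneg (K M : ℝ) : 0 ≤ D0 K M := by unfold D0; positivity

lemma eg_le (h : Flow w w1 w2 e Λ K C) {M l0 : ℝ} (hl0 : l0 < Λ) (hN : ∀ l ∈ Ioc 0 l0, fN w w1 l ≤ M)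
    {l l' : ℝ} (hl : 0 < l) (hll : l ≤ l') (hl' : l' ≤ l0) {g : ℝ → ℝ} (hg : GC g) :
    2 * l * |∫ x, e l x * g x ∂gm| ≤ D0 K M * √(fH w l') * √(∫ x, g x ^ 2 ∂gm) := by
  have hlm : l ∈ Ioo 0 Λ := ⟨hl, by linarith⟩
  have hl1 : l ≤ 1 := hlm.2.le.trans h.hΛ1
  have hNl := hN l ⟨hl, hll.trans hl'⟩
  have hM : 0 ≤ M := (N_nonneg l).trans hNl
  have h1 := gcs (h.ge hlm) hg
  have h2 := h.e_sq hlm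
  have hE := h.E_le hlm hNl
  have hH := H_nonneg w l
  have hH' := H_nonneg w l'
  have h3 : l ^ 2 * ∫ x, e l x ^ 2 ∂gm ≤ 2 * K ^ 2 * (1 + M) * fH w l := by
    calc l ^ 2 * ∫ x, e l x ^ 2 ∂gm ≤ l ^ 2 * (2 * K ^ 2 * (fH w l + fH w1 l / l ^ 2)) := by gcongr
      _ = 2 * K ^ 2 * (l ^ 2 * fH w l + fH w1 l) := by field_simp
      _ ≤ 2 * K ^ 2 * (1 * fH w l + M * fH w l) := by gcongr; nlinarith
      _ = _ := by ring
  have h4 := h.H_dbl hl0 hN hl hll hl'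
  have hG : 0 ≤ ∫ x, g x ^ 2 ∂gm := integral_nonneg fun _ => sq_nonneg _
  set G := ∫ x, g x ^ 2 ∂gm
  set J := ∫ x, e l x * g x ∂gm
  have h5 : (l * |J|) ^ 2 ≤ (2 * K ^ 2 * (1 + M)) * (exp (4 * K * (2 + M)) * fH w l') * G := by
    calc (l * |J|) ^ 2 = l ^ 2 * J ^ 2 := by rw [mul_pow, sq_abs]
      _ ≤ l ^ 2 * ((∫ x, e l x ^ 2 ∂gm) * G) := by gcongr
      _ = (l ^ 2 * ∫ x, e l x ^ 2 ∂gm) * G := by ring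
      _ ≤ (2 * K ^ 2 * (1 + M) * fH w l) * G := by gcongr
      _ ≤ _ := by gcongr
  have h6 : l * |J| ≤ √(2 * K ^ 2 * (1 + M)) * √(exp (4 * K * (2 + M))) * √(fH w l') * √G := by
    rw [← sqrt_mul (by positivity), ← sqrt_mul (by positivity), ← sqrt_mul (by positivity)]
    refine le_sqrt_of_sq_le (h5.trans_eq ?_)
    ring
  calc 2 * l * |J| = 2 * (l * |J|) := by ring
    _ ≤ 2 * (√(2 * K ^ 2 * (1 + M)) * √(exp (4 * K * (2 + M))) * √(fH w l') * √G) := by gcongr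
    _ = _ := by unfold D0; ring

lemma m0_deriv (h : Flow w w1 w2 e Λ K C) {l : ℝ} (hl : l ∈ Ioo 0 Λ) :
    HasDerivAt (fun l => ∫ x, w l x ∂gm) (- (2 * l * ∫ x, e l x * 1 ∂gm)) l := by
  have := h.deriv_int hl (gc_const 1)
  simp only [mul_one] at this ⊢
  refine this.congr_deriv ?_
  have hl0 := hl.1
  have e0 : ∫ x, fA w1 w2 l x ∂gm = 0 := by
    have := dirichlet (g := fun _ => 1) (g1 := fun _ => 0) (h.d1 l hl) (fun x => hasDerivAt_const x 1)
      (h.g1 hl) (h.g2 hl) (gc_const 1) (gc_const 0)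
    simpa [fA] using this
  simp only [wl]
  rw [integral_const_mul, integral_sub (h.gA hl).int ((h.ge hl).cmul _).int, e0, integral_const_mul]
  field_simp; ring

lemma m1_deriv (h : Flow w w1 w2 e Λ K C) {l : ℝ} (hl : l ∈ Ioo 0 Λ) :
    HasDerivAt (fun l => (∫ x, w l x * x ∂gm) / l) (- (2 * ∫ x, e l x * x ∂gm)) l := by
  have hl0 := hl.1
  have := (h.deriv_int hl gc_id).div (hasDerivAt_id l) hl0.ne'
  refine this.congr_deriv ?_
  have e0 : ∫ x, fA w1 w2 l x * x ∂gm = (∫ x, w l x * x ∂gm) / 2 := by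
    have h1 := dirichlet (g := fun x => x) (g1 := fun _ => 1) (h.d1 l hl) (fun x => hasDerivAt_id x)
      (h.g1 hl) (h.g2 hl) gc_id (gc_const 1)
    have h2 := stein (h.d0 l hl) (h.g0 hl) (h.g1 hl)
    have e1 : (fun x => fA w1 w2 l x * x) = fun x => x * (x / 2 * w1 l x - w2 l x) := by
      ext x; simp only [fA]; ring
    rw [e1, h1]; simp only [one_mul]; rw [h2, ← integral_div]
    congr 1; ext x; ring
  have e2 : ∫ x, wl w1 w2 e l x * x ∂gm = (∫ x, w l x * x ∂gm) / l - 2 * l * ∫ x, e l x * x ∂gm := by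
    have e3 : (fun x => wl w1 w2 e l x * x) = fun x => 2 / l * (fA w1 w2 l x * x) - 2 * l * (e l x * x) := by
      ext x; simp only [wl]; field_simp
    rw [e3, integral_sub (((h.gA hl).mul gc_id).cmul _).int (((h.ge hl).mul gc_id).cmul _).int,
      integral_const_mul, integral_const_mul, e0]
    ring
  simp only [id]
  rw [e2]; field_simp; ring

lemma m0_le (h : Flow w w1 w2 e Λ K C) {M l0 : ℝ} (hl0 : l0 < Λ) (hN : ∀ l ∈ Ioc 0 l0, fN w w1 l ≤ M)
    {s l : ℝ} (hs : 0 < s) (hsl : s ≤ l) (hl : l ≤ l0) :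
    |∫ x, w l x ∂gm - ∫ x, w s x ∂gm| ≤ D0 K M * √(fH w l) * l := by
  have hmem : ∀ t ∈ Icc s l, t ∈ Ioo 0 Λ := fun t ht => ⟨hs.trans_le ht.1, by linarith [ht.2]⟩
  have := Convex.norm_image_sub_le_of_norm_hasDerivWithin_le (f := fun l => ∫ x, w l x ∂gm)
    (f' := fun l => - (2 * l * ∫ x, e l x * 1 ∂gm)) (s := Icc s l) (C := D0 K M * √(fH w l))
    (fun t ht => (h.m0_deriv (hmem t ht)).hasDerivWithinAt) (fun t ht => by
      rw [norm_neg, norm_mul, Real.norm_eq_abs, Real.norm_eq_abs, abs_of_pos (by linarith [hs, ht.1])]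
      have := h.eg_le hl0 hN (hs.trans_le ht.1) ht.2 hl (gc_const 1)
      simpa using this) (convex_Icc _ _) ⟨le_rfl, hsl⟩ ⟨hsl, le_rfl⟩
  simp only [Real.norm_eq_abs] at this
  refine this.trans ?_
  have h2 := D0_nonneg K M
  rw [abs_of_nonneg (by linarith)]
  gcongr
  linarith

lemma m0_lim (h : Flow w w1 w2 e Λ K C) {M l0 V : ℝ} (hl0 : l0 < Λ) (hN : ∀ l ∈ Ioc 0 l0, fN w w1 l ≤ M)
    (hV : Filter.Tendsto (fun l => ∫ x, w l x ∂gm) (nhdsWithin 0 (Ioi 0)) (nhds V))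
    {l : ℝ} (hlp : 0 < l) (hl : l ≤ l0) :
    |∫ x, w l x ∂gm - V| ≤ D0 K M * √(fH w l) * l := by
  have t : Filter.Tendsto (fun s => |∫ x, w l x ∂gm - ∫ x, w s x ∂gm|) (nhdsWithin 0 (Ioi 0))
    (nhds |∫ x, w l x ∂gm - V|) := (tendsto_const_nhds.sub hV).abs
  refine le_of_tendsto t ?_
  filter_upwards [Ioo_mem_nhdsGT hlp] with s hs
  exact h.m0_le hl0 hN hs.1 hs.2.le hl

lemma gm_x2 : ∫ x, x ^ 2 ∂gm = 2 := by
  have := stein (F := fun x => x) (F' := fun _ => 1) (fun x => hasDerivAt_id x) gc_id (gc_const 1)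
  rw [gint_one] at this
  have e : (fun x : ℝ => x ^ 2) = fun x => 2 * (x / 2 * x) := by ext x; ring
  rw [e, integral_const_mul, ← this]; norm_num

lemma m1_le (h : Flow w w1 w2 e Λ K C) {M l0 : ℝ} (hl0 : l0 < Λ) (hN : ∀ l ∈ Ioc 0 l0, fN w w1 l ≤ M)
    {s l : ℝ} (hs : 0 < s) (hsl : s ≤ l) (hl : l ≤ l0) :
    |(∫ x, w l x * x ∂gm) / l - (∫ x, w s x * x ∂gm) / s| ≤ 2 * D0 K M * √(fH w l) * log (l / s) := by
  have hlp : 0 < l := hs.trans_le hsl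
  have hmem : ∀ r ∈ Icc (log s) (log l), exp r ∈ Ioo 0 Λ ∧ exp r ≤ l := fun r hr => by
    have : exp r ≤ l := by rw [← exp_log hlp]; exact exp_le_exp.2 hr.2
    exact ⟨⟨exp_pos _, by linarith⟩, this⟩
  have hss : log s ≤ log l := log_le_log hs hsl
  have := Convex.norm_image_sub_le_of_norm_hasDerivWithin_le
    (f := fun r => (∫ x, w (exp r) x * x ∂gm) / exp r)
    (f' := fun r => - (2 * ∫ x, e (exp r) x * x ∂gm) * exp r) (s := Icc (log s) (log l)) (C := 2 * D0 K M * √(fH w l))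
    (fun t ht => (HasDerivAt.comp t (h.m1_deriv (hmem t ht).1) (hasDerivAt_exp t)).hasDerivWithinAt) (fun t ht => by
      have h1 := h.eg_le hl0 hN (exp_pos t) (hmem t ht).2 hl gc_id
      rw [gm_x2] at h1
      rw [norm_mul, norm_neg, norm_mul, Real.norm_eq_abs, Real.norm_eq_abs, Real.norm_eq_abs, abs_two, abs_of_pos (exp_pos t)]
      have h2 : √2 ≤ 2 := by rw [sqrt_le_left (by norm_num)]; norm_num
      have h3 := D0_nonneg K M
      have h4 : 0 ≤ D0 K M * √(fH w l) := by positivity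
      nlinarith) (convex_Icc _ _) ⟨le_rfl, hss⟩ ⟨hss, le_rfl⟩
  simp only [Real.norm_eq_abs, exp_log hs, exp_log hlp] at this
  rw [abs_of_nonneg (sub_nonneg.2 hss), ← log_div hlp.ne' hs.ne'] at this
  exact this

lemma m1_small (h : Flow w w1 w2 e Λ K C) {M l0 C' : ℝ} (hl0p : 0 < l0) (hl0 : l0 < Λ)
    (hN : ∀ l ∈ Ioc 0 l0, fN w w1 l ≤ M)
    (hs : ∀ s ∈ Ioc 0 l0, |∫ x, w s x * x ∂gm| ≤ C' * s ^ 2) {ε : ℝ} (hε : 0 < ε) :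
    ∃ δ ∈ Ioc 0 l0, ∀ l ∈ Ioo 0 δ, |∫ x, w l x * x ∂gm| ≤ ε * √(fH w l) := by
  obtain ⟨n, hn⟩ := exists_nat_ge (4 * M + 4 * K * (2 + M))
  have hl01 : l0 ≤ 1 := hl0.le.trans h.hΛ1
  set c := fH w l0 with hc
  have hc0 : 0 < c := h.pos l0 ⟨hl0p, hl0⟩
  have hC' : 0 ≤ C' := by
    have := (abs_nonneg _).trans (hs l0 ⟨hl0p, le_rfl⟩)
    by_contra hcon
    nlinarith [pow_pos hl0p 2]
  have hD := D0_nonneg K M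
  have t : Filter.Tendsto (fun l : ℝ => C' / √c * l - 2 * D0 K M * n * (log l * l)) (nhdsWithin 0 (Ioi 0)) (nhds 0) := by
    have t1 : Filter.Tendsto (fun l : ℝ => log l * l) (nhdsWithin 0 (Ioi 0)) (nhds 0) := by
      simpa using tendsto_log_mul_rpow_nhdsGT_zero (r := 1) zero_lt_one
    have t2 : Filter.Tendsto (fun l : ℝ => C' / √c * l) (nhdsWithin 0 (Ioi 0)) (nhds (C' / √c * 0)) :=
      ((Filter.tendsto_id (α := ℝ)).mono_left nhdsWithin_le_nhds).const_mul _
    simpa using t2.sub (t1.const_mul (2 * D0 K M * n))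
  have hev := (t.eventually (gt_mem_nhds hε)).and (Ioo_mem_nhdsGT hl0p)
  obtain ⟨δ, hδ, hδ2⟩ := (mem_nhdsGT_iff_exists_Ioo_subset).1 hev
  refine ⟨min δ l0, ⟨lt_min hδ hl0p, min_le_right _ _⟩, fun l hl => ?_⟩
  obtain ⟨hl1, hl2⟩ := hδ2 ⟨hl.1, hl.2.trans_le (min_le_left _ _)⟩
  have hlp := hl.1
  have hll0 : l < l0 := hl2.2
  have hl1' : l ≤ 1 := by linarith
  set s := l ^ (n + 1) with hsd
  have hsp : 0 < s := by positivity
  have hsl : s ≤ l := by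
    rw [hsd, pow_succ]
    have : l ^ n ≤ 1 := pow_le_one₀ hlp.le hl1'
    nlinarith
  have hlow := h.H_low hl0 hN n hn hlp hll0.le le_rfl
  have hH : 0 < fH w l := h.pos l ⟨hlp, by linarith⟩
  have hlow2 : c * l ^ n ≤ fH w l := by
    refine hlow.trans ?_
    have : l0 ^ n ≤ 1 := pow_le_one₀ hl0p.le hl01
    nlinarith
  have hlow3 : √c * l ^ n ≤ √(fH w l) := by
    refine le_sqrt_of_sq_le ?_
    rw [mul_pow, sq_sqrt hc0.le]
    refine le_trans ?_ hlow2
    have : (l ^ n) ^ 2 ≤ l ^ n := by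
      have h1 : l ^ n ≤ 1 := pow_le_one₀ hlp.le hl1'
      have h2 : 0 ≤ l ^ n := by positivity
      first | exact pow_le_of_le_one h2 h1 two_ne_zero | nlinarith
    gcongr
  have hm := h.m1_le hl0 hN hsp hsl hll0.le
  have hlog : log (l / s) = - (n * log l) := by
    rw [log_div hlp.ne' hsp.ne', hsd, log_pow]; push_cast; ring
  rw [hlog] at hm
  have hs1 := hs s ⟨hsp, hsl.trans hll0.le⟩
  have hs2 : |(∫ x, w s x * x ∂gm) / s| ≤ C' * s := by
    rw [abs_div, abs_of_pos hsp, div_le_iff₀ hsp]; linarith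
  have hs3 : |(∫ x, w l x * x ∂gm) / l| ≤ C' * s + 2 * D0 K M * √(fH w l) * -(n * log l) := by
    have := abs_sub_abs_le_abs_sub ((∫ x, w l x * x ∂gm) / l) ((∫ x, w s x * x ∂gm) / s)
    linarith
  rw [abs_div, abs_of_pos hlp, div_le_iff₀ hlp] at hs3
  refine hs3.trans ?_
  have hq : 0 < √c := sqrt_pos.2 hc0
  have hs4 : s ≤ √(fH w l) / √c := by
    rw [le_div_iff₀ hq, hsd, pow_succ]
    have : 0 ≤ l ^ n := by positivity
    calc l ^ n * l * √c = (√c * l ^ n) * l := by ring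
      _ ≤ (√c * l ^ n) * 1 := by gcongr
      _ ≤ _ := by linarith
  have hs5 : C' * s * l ≤ C' * (√(fH w l) / √c) * l := by gcongr
  have hs6 : (C' / √c * l - 2 * D0 K M * n * (log l * l)) * √(fH w l) ≤ ε * √(fH w l) := by gcongr
  calc _ = C' * s * l - 2 * D0 K M * n * (log l * l) * √(fH w l) := by ring
    _ ≤ C' * (√(fH w l) / √c) * l - 2 * D0 K M * n * (log l * l) * √(fH w l) := by linarith
    _ = (C' / √c * l - 2 * D0 K M * n * (log l * l)) * √(fH w l) := by ring
    _ ≤ _ := hs6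

end Flow

lemma x2_le {f f1 : ℝ → ℝ} (hd : ∀ x, HasDerivAt f (f1 x) x) (cf : GC f) (cf1 : GC f1) :
    ∫ x, x ^ 2 * f x ^ 2 ∂gm ≤ 4 * (∫ x, f x ^ 2 ∂gm) + 16 * ∫ x, f1 x ^ 2 ∂gm := by
  have gF : GC (fun x => x * f x ^ 2) := gc_id.mul cf.sq
  have gF' : GC (fun x => f x ^ 2 + (2 * x) * (f x * f1 x)) := cf.sq.add ((gc_id.cmul 2).mul (cf.mul cf1))
  have gX : GC (fun x => x ^ 2 * f x ^ 2) := gc_id.sq.mul cf.sq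
  have h := stein (F := fun x => x * f x ^ 2) (F' := fun x => f x ^ 2 + (2 * x) * (f x * f1 x))
    (fun x => by
      refine ((hasDerivAt_id x).mul ((hd x).pow 2)).congr_deriv ?_
      simp; ring) gF gF'
  rw [integral_add cf.sq.int ((gc_id.cmul 2).mul (cf.mul cf1)).int] at h
  have e1 : ∫ x, x / 2 * (x * f x ^ 2) ∂gm = (1/2) * ∫ x, x ^ 2 * f x ^ 2 ∂gm := by
    rw [← integral_const_mul]; congr 1; ext x; ring
  have e2 : ∫ x, (2 * x) * (f x * f1 x) ∂gm ≤ (1/4) * (∫ x, x ^ 2 * f x ^ 2 ∂gm) + 4 * ∫ x, f1 x ^ 2 ∂gm := by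
    rw [← integral_const_mul, ← integral_const_mul, ← integral_add (gX.cmul _).int (cf1.sq.cmul _).int]
    refine integral_mono ((gc_id.cmul 2).mul (cf.mul cf1)).int ((gX.cmul _).add (cf1.sq.cmul _)).int fun x => ?_
    simp only
    linarith [sq_nonneg (1/2 * (x * f x) - 2 * f1 x)]
  rw [e1] at h
  linarith

lemma sup_le {f f1 : ℝ → ℝ} (hd : ∀ x, HasDerivAt f (f1 x) x) (cf : GC f) (cf1 : GC f1) (x : ℝ) :
    rho x * f x ^ 2 ≤ 3 * (∫ x, f x ^ 2 ∂gm) + 5 * ∫ x, f1 x ^ 2 ∂gm := by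
  set G : ℝ → ℝ := fun x => 2 * (f x * f1 x) - (1/2 * x) * f x ^ 2 with hG
  have gG : GC G := ((cf.mul cf1).cmul 2).sub ((gc_id.cmul (1/2)).mul cf.sq)
  have gX : GC (fun x => x ^ 2 * f x ^ 2) := gc_id.sq.mul cf.sq
  have hD : ∀ x, HasDerivAt (fun x => rho x * f x ^ 2) (rho x * G x) x := fun x => by
    refine ((rho_deriv x).mul ((hd x).pow 2)).congr_deriv ?_
    simp [hG]; ring
  have i1 := gint_able _ gG.int
  have i2 := gint_able _ cf.sq.int
  have t := tendsto_zero_of_hasDerivAt_of_integrableOn_Iic (a := x) (fun y _ => hD y) i1.integrableOn i2.integrableOn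
  have h1 := integral_Iic_of_hasDerivAt_of_tendsto' (a := x) (fun y _ => hD y) i1.integrableOn t
  rw [sub_zero] at h1
  have h2 : rho x * f x ^ 2 ≤ ∫ y, |rho y * G y| := by
    rw [← h1]
    calc ∫ y in Iic x, rho y * G y ≤ ∫ y in Iic x, |rho y * G y| :=
          integral_mono i1.integrableOn i1.abs.integrableOn fun y => le_abs_self _
      _ ≤ _ := setIntegral_le_integral i1.abs (Filter.Eventually.of_forall fun y => abs_nonneg _)
  have h3 : ∫ y, |rho y * G y| = ∫ y, |G y| ∂gm := by
    rw [gint_eq]; congr 1; ext y; rw [abs_mul, abs_of_pos (rho_pos y)]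
  have gB : GC (fun y => (5/4 * f y ^ 2 + f1 y ^ 2) + 1/4 * (y ^ 2 * f y ^ 2)) :=
    ((cf.sq.cmul _).add cf1.sq).add (gX.cmul _)
  have h4 : ∫ y, |G y| ∂gm ≤ ∫ y, (5/4 * f y ^ 2 + f1 y ^ 2) + 1/4 * (y ^ 2 * f y ^ 2) ∂gm := by
    refine integral_mono gG.abs.int gB.int fun y => ?_
    simp only [hG]
    rw [abs_le]
    constructor
    · linarith [sq_nonneg (f y + f1 y), sq_nonneg (f y * (y - 1)), sq_nonneg (f y * (y + 1))]
    · linarith [sq_nonneg (f y - f1 y), sq_nonneg (f y * (y - 1)), sq_nonneg (f y * (y + 1))]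
  rw [integral_add ((cf.sq.cmul _).add cf1.sq).int (gX.cmul _).int, integral_add (cf.sq.cmul _).int cf1.sq.int,
    integral_const_mul, integral_const_mul] at h4
  have h5 := x2_le hd cf cf1
  have h6 : 0 ≤ ∫ x, f x ^ 2 ∂gm := integral_nonneg fun _ => sq_nonneg _
  linarith [h3]

lemma rho_le_one (x : ℝ) : rho x ≤ 1 := by
  rw [rho_eq]
  have h1 : (√(2 * π * 2))⁻¹ ≤ 1 := by
    apply inv_le_one_of_one_le₀
    rw [one_le_sqrt]; linarith [pi_gt_three]
  have h2 : exp (-x ^ 2 / 4) ≤ 1 := exp_le_one_iff.2 (by linarith [sq_nonneg x])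
  exact mul_le_one₀ h1 (exp_pos _).le h2

lemma rho_anti {x R : ℝ} (h : |x| ≤ R) : rho R ≤ rho x := by
  rw [rho_eq, rho_eq]
  have : x ^ 2 ≤ R ^ 2 := by rw [← sq_abs x]; gcongr
  gcongr

lemma gm_Icc (m r : ℝ) (hr : 0 ≤ r) : ∫ x, (Icc (m - r) (m + r)).indicator (fun _ => (1 : ℝ)) x ∂gm ≤ 2 * r := by
  have e : ∀ x, rho x * (Icc (m - r) (m + r)).indicator (fun _ => (1 : ℝ)) x = (Icc (m - r) (m + r)).indicator rho x := by
    intro x; by_cases hx : x ∈ Icc (m - r) (m + r) <;> simp [hx]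
  rw [gint_eq]
  simp_rw [e]
  rw [integral_indicator measurableSet_Icc]
  have hc : Continuous rho := continuous_iff_continuousAt.2 fun x => (rho_deriv x).continuousAt
  calc ∫ x in Icc (m - r) (m + r), rho x ≤ ∫ x in Icc (m - r) (m + r), (1 : ℝ) := by
        refine integral_mono (hc.integrableOn_Icc) ?_ fun x => rho_le_one x
        exact integrableOn_const (by simp)
    _ = 2 * r := by
        simp [hr]
        ring_nf

lemma sign_lemma {M : ℝ} (hM : 0 ≤ M) : ∃ ε > 0, ∀ (f f1 : ℝ → ℝ) (α β : ℝ), (∀ x, HasDerivAt f (f1 x) x) → GC f → GC f1 →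
    ∫ x, f1 x ^ 2 ∂gm ≤ M * ∫ x, f x ^ 2 ∂gm → 0 < ∫ x, f x ^ 2 ∂gm →
    |∫ x, f x ∂gm| ≤ ε * √(∫ x, f x ^ 2 ∂gm) → |∫ x, f x * x ∂gm| ≤ ε * √(∫ x, f x ^ 2 ∂gm) →
    |α| + |β| = 1 → (∀ x, 0 ≤ f x * (α + β * x)) → False := by
  set R := √(16 + 64 * M) with hR
  have hR2 : R ^ 2 = 16 + 64 * M := sq_sqrt (by positivity)
  have hR0 : 0 < R := sqrt_pos.2 (by positivity)
  set b := (3 + 5 * M) / rho R with hb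
  have hb0 : 0 < b := div_pos (by positivity) (rho_pos R)
  set κ := min (1/2) (1 / (16 * b * (1 + R))) with hκ
  have hκ0 : 0 < κ := lt_min (by norm_num) (by positivity)
  have hκ1 : κ ≤ 1/2 := min_le_left _ _
  have hκ2 : b * (4 * κ * (1 + R)) ≤ 1/4 := by
    have : κ ≤ 1 / (16 * b * (1 + R)) := min_le_right _ _
    rw [le_div_iff₀ (by positivity)] at this
    linarith
  have hsb : 0 < √b := sqrt_pos.2 hb0
  refine ⟨κ / (4 * √b), by positivity, fun f f1 α β hd cf cf1 hE hH h0 h1 hab hs => ?_⟩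
  set H := ∫ x, f x ^ 2 ∂gm with hHd
  have gX : GC (fun x => x ^ 2 * f x ^ 2) := gc_id.sq.mul cf.sq
  have hx2 := x2_le hd cf cf1
  rw [← hHd] at hx2
  have hsup : ∀ x, |x| ≤ R → f x ^ 2 ≤ b * H := by
    intro x hx
    have h1 := sup_le hd cf cf1 x
    have h2 := rho_anti hx
    have h3 := rho_pos R
    rw [← hHd] at h1
    rw [hb, div_mul_eq_mul_div, le_div_iff₀ h3]
    first | nlinarith only [h1, h2, h3, sq_nonneg (f x)] | nlinarith [sq_nonneg (f x)]
  have hsup' : ∀ x, |x| ≤ R → |f x| ≤ √b * √H := by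
    intro x hx
    rw [← sqrt_mul hb0.le]
    exact abs_le_sqrt (hsup x hx)
  set r := 2 * κ * (1 + R) with hr
  set S : Set ℝ := Icc (-α / β - r) (-α / β + r) with hS
  have hpt : ∀ x, f x ^ 2 ≤ (1 / R ^ 2) * (x ^ 2 * f x ^ 2) + (b * H) * S.indicator (fun _ => (1 : ℝ)) x
      + (√b * √H / κ) * (f x * (α + β * x)) := by
    intro x
    have n1 : 0 ≤ (1 / R ^ 2) * (x ^ 2 * f x ^ 2) := by positivity
    have n2 : 0 ≤ (b * H) * S.indicator (fun _ => (1 : ℝ)) x :=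
      mul_nonneg (by positivity) (indicator_nonneg (fun _ _ => zero_le_one) x)
    have n3 : 0 ≤ (√b * √H / κ) * (f x * (α + β * x)) := mul_nonneg (by positivity) (hs x)
    by_cases hxR : |x| ≤ R
    · by_cases hxk : κ ≤ |α + β * x|
      · have : f x ^ 2 ≤ (√b * √H / κ) * (f x * (α + β * x)) := by
          rw [div_mul_eq_mul_div, le_div_iff₀ hκ0]
          have e : f x * (α + β * x) = |f x| * |α + β * x| := by rw [← abs_mul, abs_of_nonneg (hs x)]
          rw [e, ← sq_abs (f x)]
          have := hsup' x hxR
          have a1 := abs_nonneg (f x)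
          calc |f x| ^ 2 * κ = |f x| * (|f x| * κ) := by ring
            _ ≤ (√b * √H) * (|f x| * |α + β * x|) := by gcongr
        linarith
      · push Not at hxk
        have hβ : 1 / (2 * (1 + R)) ≤ |β| := by
          rw [div_le_iff₀ (by positivity)]
          have : |α| - |β * x| ≤ |α + β * x| := by
            have := abs_sub_abs_le_abs_sub α (-(β * x)); rwa [abs_neg, sub_neg_eq_add] at this
          rw [abs_mul] at this
          nlinarith [abs_nonneg β]
        have hβ0 : 0 < |β| := lt_of_lt_of_le (by positivity) hβ
        have hβn : β ≠ 0 := abs_pos.1 hβ0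
        have hxS : x ∈ S := by
          have : |x - -α / β| ≤ r := by
            have e : x - -α / β = (α + β * x) / β := by field_simp; ring
            rw [e, abs_div, div_le_iff₀ hβ0]
            rw [div_le_iff₀ (by positivity)] at hβ
            calc |α + β * x| ≤ κ * 1 := by linarith
              _ ≤ κ * (|β| * (2 * (1 + R))) := by gcongr
              _ = r * |β| := by rw [hr]; ring
          rw [abs_le] at this
          exact ⟨by linarith, by linarith⟩
        have : f x ^ 2 ≤ (b * H) * S.indicator (fun _ => (1 : ℝ)) x := by
          rw [indicator_of_mem hxS, mul_one]; exact hsup x hxR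
        linarith
    · have : f x ^ 2 ≤ (1 / R ^ 2) * (x ^ 2 * f x ^ 2) := by
        push Not at hxR
        have : R ^ 2 ≤ x ^ 2 := by rw [← sq_abs x]; gcongr
        rw [div_mul_eq_mul_div, le_div_iff₀ (by positivity)]
        nlinarith [sq_nonneg (f x)]
      linarith
  have gL : GC (fun x => f x * (α + β * x)) := cf.mul ((gc_const α).add (gc_id.cmul β))
  have iS : Integrable (S.indicator (fun _ => (1 : ℝ))) gm := (integrable_const (1 : ℝ)).indicator measurableSet_Icc
  have iA : Integrable (fun x => (1 / R ^ 2) * (x ^ 2 * f x ^ 2) + (b * H) * S.indicator (fun _ => (1 : ℝ)) x) gm :=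
    ((gX.cmul (1 / R ^ 2)).int).add (iS.const_mul (b * H))
  have hint := integral_mono cf.sq.int (iA.add (gL.cmul (√b * √H / κ)).int) hpt
  simp only [Pi.add_apply] at hint
  rw [integral_add iA (gL.cmul (√b * √H / κ)).int, integral_add (gX.cmul (1 / R ^ 2)).int (iS.const_mul (b * H)),
    integral_const_mul, integral_const_mul, integral_const_mul] at hint
  have q1 : (1 / R ^ 2) * ∫ x, x ^ 2 * f x ^ 2 ∂gm ≤ H / 4 := by
    rw [div_mul_eq_mul_div, div_le_iff₀ (by positivity), hR2]
    linarith
  have q2 : b * H * ∫ x, S.indicator (fun _ => (1 : ℝ)) x ∂gm ≤ H / 4 := by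
    have := gm_Icc (-α / β) r (by positivity)
    calc b * H * ∫ x, S.indicator (fun _ => (1 : ℝ)) x ∂gm ≤ b * H * (2 * r) := by gcongr
      _ = (b * (4 * κ * (1 + R))) * H := by rw [hr]; ring
      _ ≤ 1/4 * H := by gcongr
      _ = _ := by ring
  have q3 : ∫ x, f x * (α + β * x) ∂gm ≤ κ / (4 * √b) * √H := by
    have e : ∫ x, f x * (α + β * x) ∂gm = α * (∫ x, f x ∂gm) + β * ∫ x, f x * x ∂gm := by
      rw [← integral_const_mul, ← integral_const_mul, ← integral_add (cf.cmul _).int ((cf.mul gc_id).cmul _).int]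
      congr 1; ext x; ring
    rw [e]
    calc α * (∫ x, f x ∂gm) + β * ∫ x, f x * x ∂gm ≤ |α| * |∫ x, f x ∂gm| + |β| * |∫ x, f x * x ∂gm| := by
          rw [← abs_mul, ← abs_mul]; exact add_le_add (le_abs_self _) (le_abs_self _)
      _ ≤ |α| * (κ / (4 * √b) * √H) + |β| * (κ / (4 * √b) * √H) := by gcongr
      _ = (|α| + |β|) * (κ / (4 * √b) * √H) := by ring
      _ = _ := by rw [hab, one_mul]
  have q4 : √b * √H / κ * ∫ x, f x * (α + β * x) ∂gm ≤ H / 4 := by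
    calc √b * √H / κ * ∫ x, f x * (α + β * x) ∂gm ≤ √b * √H / κ * (κ / (4 * √b) * √H) := by gcongr
      _ = √H * √H / 4 := by field_simp
      _ = H / 4 := by rw [mul_self_sqrt hH.le]
  linarith


structure Core (v vy vyy vt : ℝ → ℝ → ℝ) (τ T L K C : ℝ) : Prop where
  hT : τ < T
  hK : 0 ≤ K
  hC : 0 ≤ C
  d0 : ∀ t ∈ Ioo τ T, ∀ y, HasDerivAt (fun y => v y t) (vy y t) y
  d1 : ∀ t ∈ Ioo τ T, ∀ y, HasDerivAt (fun y => vy y t) (vyy y t) y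
  dj : ∀ t ∈ Ioo τ T, ∀ y, HasFDerivAt (fun p : ℝ × ℝ => v p.1 p.2)
    (vy y t • ContinuousLinearMap.fst ℝ ℝ ℝ + vt y t • ContinuousLinearMap.snd ℝ ℝ ℝ) (y, t)
  c1 : ∀ t ∈ Ioo τ T, ∀ y, ContinuousAt (fun p : ℝ × ℝ => vy p.1 p.2) (y, t)
  c2 : ∀ t ∈ Ioo τ T, ∀ y, ContinuousAt (fun p : ℝ × ℝ => vyy p.1 p.2) (y, t)
  ct : ∀ t ∈ Ioo τ T, Continuous (fun y => vt y t)
  b0 : ∀ t ∈ Ioo τ T, ∀ y, |v y t| ≤ C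
  b1 : ∀ t ∈ Ioo τ T, ∀ y, |vy y t| ≤ C
  b2 : ∀ t ∈ Ioo τ T, ∀ y, |vyy y t| ≤ C
  bt : ∀ t ∈ Ioo τ T, ∀ y, |vt y t| ≤ C
  cv : ∀ y, ContinuousWithinAt (fun p : ℝ × ℝ => v p.1 p.2) (univ ×ˢ Iic T) (y, T)
  far : ∀ t ∈ Ioo τ T, ∀ y, L ≤ |y| → 1 ≤ |v y t|
  eq : ∀ t ∈ Ioo τ T, ∀ y, |vt y t - vyy y t| ≤ K * (|v y t| + |vy y t|)

namespace Core
variable {v vy vyy vt : ℝ → ℝ → ℝ} {τ T L K C : ℝ}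

def cw (v : ℝ → ℝ → ℝ) (T x l η : ℝ) : ℝ := v (x + l * η) (T - l ^ 2)
def cw1 (vy : ℝ → ℝ → ℝ) (T x l η : ℝ) : ℝ := l * vy (x + l * η) (T - l ^ 2)
def cw2 (vyy : ℝ → ℝ → ℝ) (T x l η : ℝ) : ℝ := l ^ 2 * vyy (x + l * η) (T - l ^ 2)
def cwe (vyy vt : ℝ → ℝ → ℝ) (T x l η : ℝ) : ℝ := vt (x + l * η) (T - l ^ 2) - vyy (x + l * η) (T - l ^ 2)
noncomputable def La (τ T : ℝ) : ℝ := min 1 (√(T - τ))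

lemma La_mem {l : ℝ} (hl : l ∈ Ioo 0 (La τ T)) : T - l ^ 2 ∈ Ioo τ T := by
  have h1 : l < √(T - τ) := hl.2.trans_le (min_le_right _ _)
  have h2 := (lt_sqrt hl.1.le).1 h1
  exact ⟨by linarith, by have := pow_pos hl.1 2; linarith⟩

lemma La_pos (h : τ < T) : 0 < La τ T := lt_min one_pos (sqrt_pos.2 (by linarith))

lemma flow (h : Core v vy vyy vt τ T L K C) (x : ℝ) :
    Flow (cw v T x) (cw1 vy T x) (cw2 vyy T x) (cwe vyy vt T x) (La τ T) K (2 * C) := by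
  have hC := h.hC
  have hl1 : ∀ l ∈ Ioo 0 (La τ T), |l| ≤ 1 := fun l hl => by
    rw [abs_of_pos hl.1]; exact hl.2.le.trans (min_le_left _ _)
  have hlin : ∀ l η : ℝ, HasDerivAt (fun η => x + l * η) l η := fun l η => by
    simpa using ((hasDerivAt_id η).const_mul l).const_add x
  refine ⟨La_pos h.hT, min_le_left _ _, h.hK, by linarith, ?_, ?_, ?_, ?_, ?_, ?_, ?_, ?_, ?_, ?_, ?_, ?_, ?_⟩
  · intro l hl η
    have := (h.d0 _ (La_mem hl) (x + l * η)).comp η (hlin l η)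
    rw [mul_comm] at this
    exact this
  · intro l hl η
    have := ((h.d1 _ (La_mem hl) (x + l * η)).comp η (hlin l η)).const_mul l
    refine this.congr_deriv ?_
    simp only [cw2]; ring
  · intro l hl η
    have hl0 := hl.1.ne'
    have d : HasDerivAt (fun l : ℝ => (x + l * η, T - l ^ 2)) (η, -(2 * l)) l := by
      refine HasDerivAt.prodMk ?_ ?_
      · simpa using ((hasDerivAt_id l).mul_const η).const_add x
      · simpa using ((hasDerivAt_id l).pow 2).const_sub T
    have := (h.dj _ (La_mem hl) (x + l * η)).comp_hasDerivAt l d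
    refine this.congr_deriv ?_
    simp only [cw1, cw2, cwe, add_apply, smul_apply,
      ContinuousLinearMap.coe_fst', ContinuousLinearMap.coe_snd', smul_eq_mul]
    field_simp
    ring
  · intro l hl
    refine continuous_const.mul (continuous_iff_continuousAt.2 fun η => ?_)
    exact ContinuousAt.comp (f := fun η : ℝ => (x + l * η, T - l ^ 2)) (h.c2 _ (La_mem hl) (x + l * η)) (by fun_prop)
  · intro l hl
    refine ((h.ct _ (La_mem hl)).comp (by fun_prop)).sub (continuous_iff_continuousAt.2 fun η => ?_)
    exact ContinuousAt.comp (f := fun η : ℝ => (x + l * η, T - l ^ 2)) (h.c2 _ (La_mem hl) (x + l * η)) (by fun_prop)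
  · intro l hl η
    refine continuousAt_id.mul ?_
    exact ContinuousAt.comp (f := fun l : ℝ => (x + l * η, T - l ^ 2)) (h.c1 _ (La_mem hl) (x + l * η)) (by fun_prop)
  · intro l hl η
    refine (continuousAt_id.pow 2).mul ?_
    exact ContinuousAt.comp (f := fun l : ℝ => (x + l * η, T - l ^ 2)) (h.c2 _ (La_mem hl) (x + l * η)) (by fun_prop)
  · intro l hl η
    exact (h.b0 _ (La_mem hl) _).trans (by linarith)
  · intro l hl η
    rw [cw1, abs_mul]
    nlinarith [h.b1 _ (La_mem hl) (x + l * η), hl1 l hl, abs_nonneg l, abs_nonneg (vy (x + l * η) (T - l ^ 2))]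
  · intro l hl η
    rw [cw2, abs_mul, abs_pow]
    have : |l| ^ 2 ≤ 1 := pow_le_one₀ (abs_nonneg _) (hl1 l hl)
    nlinarith [h.b2 _ (La_mem hl) (x + l * η), sq_nonneg |l|, abs_nonneg (vyy (x + l * η) (T - l ^ 2))]
  · intro l hl η
    have := abs_sub (vt (x + l * η) (T - l ^ 2)) (vyy (x + l * η) (T - l ^ 2))
    rw [cwe]
    linarith [h.b2 _ (La_mem hl) (x + l * η), h.bt _ (La_mem hl) (x + l * η)]
  · intro l hl η
    have e : |cw1 vy T x l η| / l = |vy (x + l * η) (T - l ^ 2)| := by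
      rw [cw1, abs_mul, abs_of_pos hl.1]; field_simp [hl.1.ne']
    rw [e]
    exact h.eq _ (La_mem hl) _
  · intro l hl
    have hc : Continuous (cw v T x l) := by
      refine continuous_iff_continuousAt.2 fun η => ?_
      exact ((h.d0 _ (La_mem hl) (x + l * η)).continuousAt).comp (f := fun η => x + l * η) (by fun_prop)
    have g : GC (cw v T x l) := gc_bdd hc C fun η => h.b0 _ (La_mem hl) _
    refine gpos g.sq (fun _ => sq_nonneg _) ((|L| - x) / l) ?_
    have : x + l * ((|L| - x) / l) = |L| := by field_simp [hl.1.ne']; ring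
    have h1 := h.far _ (La_mem hl) |L| (by rw [abs_abs]; exact le_abs_self L)
    simp only [cw, this]
    intro h0
    rw [pow_eq_zero_iff two_ne_zero] at h0
    rw [h0] at h1; norm_num at h1

lemma unifM (h : Core v vy vyy vt τ T L K C) (X : ℝ) : ∃ M ≥ 0, ∀ x, |x| ≤ X → ∀ l ∈ Ioc 0 (La τ T / 2),
    Flow.fN (cw v T x) (cw1 vy T x) l ≤ M := by
  have hLa := La_pos h.hT
  set l0 := La τ T / 2 with hl0
  have hl0p : 0 < l0 := by positivity
  have hl0m : l0 ∈ Ioo 0 (La τ T) := ⟨hl0p, by linarith⟩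
  set R := (|L| + X) / l0 with hR
  set c := ∫ η, (Ioi R).indicator (fun _ => (1 : ℝ)) η ∂gm with hc
  have hcp : 0 < c := by
    rw [hc, integral_indicator measurableSet_Ioi, setIntegral_const, smul_eq_mul, mul_one]
    have h1 : volume (Ioi R) ≠ 0 := by simp
    have hac : volume ≪ gm := gaussianReal_absolutelyContinuous' 0 (by norm_num)
    refine ENNReal.toReal_pos (fun h0 => h1 (hac h0)) (measure_ne_top _ _)
  refine ⟨((2 * C) ^ 2 / c + 1) * exp (2 * K ^ 2), by positivity, fun x hx l hl => ?_⟩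
  have F := h.flow x
  refine (F.N_le ⟨hl.1, hl.2.trans_lt hl0m.2⟩ hl0m hl.2).trans ?_
  gcongr
  rw [Flow.fN]
  have hE : fH (cw1 vy T x) l0 ≤ (2 * C) ^ 2 := by
    calc fH (cw1 vy T x) l0 ≤ ∫ _, (2 * C) ^ 2 ∂gm :=
          integral_mono (F.g1 hl0m).sq.int (integrable_const _) fun η => by
            rw [← sq_abs]; exact pow_le_pow_left₀ (abs_nonneg _) (F.b1 _ hl0m η) 2
      _ = _ := by simp
  have hH : c ≤ fH (cw v T x) l0 := by
    refine integral_mono ((integrable_const (1 : ℝ)).indicator measurableSet_Ioi) (F.g0 hl0m).sq.int fun η => ?_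
    by_cases hη : η ∈ Ioi R
    · simp only [indicator_of_mem hη]
      have h1 : |L| + X < l0 * η := by
        rw [mem_Ioi, hR, div_lt_iff₀ hl0p] at hη; linarith
      have h2 : L ≤ |x + l0 * η| := by
        have := le_abs_self L
        have := le_abs_self (x + l0 * η)
        have := neg_abs_le x
        linarith
      have h3 := h.far _ (La_mem hl0m) _ h2
      rw [← sq_abs]
      exact one_le_pow₀ h3
    · simp only [indicator_of_notMem hη]; positivity
  gcongr

lemma m0_tendsto (h : Core v vy vyy vt τ T L K C) (x : ℝ) :
    Filter.Tendsto (fun l => ∫ η, cw v T x l η ∂gm) (nhdsWithin 0 (Ioi 0)) (nhds (v x T)) := by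
  have F := h.flow x
  have e : v x T = ∫ _, v x T ∂gm := by simp
  rw [e]
  refine tendsto_integral_filter_of_dominated_convergence (fun _ => 2 * C) ?_ ?_ (integrable_const _) ?_
  · filter_upwards [Ioo_mem_nhdsGT (La_pos h.hT)] with l hl
    exact (F.g0 hl).int.aestronglyMeasurable
  · filter_upwards [Ioo_mem_nhdsGT (La_pos h.hT)] with l hl
    exact Filter.Eventually.of_forall fun η => F.b0 l hl η
  · refine Filter.Eventually.of_forall fun η => ?_
    refine (h.cv x).tendsto.comp (f := fun l : ℝ => (x + l * η, T - l ^ 2)) ?_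
    refine tendsto_nhdsWithin_iff.2 ⟨?_, Filter.Eventually.of_forall fun l => ⟨mem_univ _, ?_⟩⟩
    · have : Continuous (fun l : ℝ => (x + l * η, T - l ^ 2)) := by fun_prop
      have := this.tendsto 0
      simp only [zero_mul, add_zero, ne_eq, OfNat.ofNat_ne_zero, not_false_eq_true, zero_pow, sub_zero] at this
      exact this.mono_left nhdsWithin_le_nhds
    · simp only [mem_Iic]; linarith [sq_nonneg l]

lemma cw_shift (x l y η : ℝ) : cw v T x l (η + y) = cw v T (x + l * y) l η := by
  simp only [cw]; ring_nf

lemma H_shift (h : Core v vy vyy vt τ T L K C) {M x l y : ℝ} (hM0 : 0 ≤ M) (hl : l ∈ Ioc 0 (La τ T / 2))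
    (hM : ∀ x', |x' - x| ≤ 2 → Flow.fN (cw v T x') (cw1 vy T x') l ≤ M) (hy : |y| ≤ 2) :
    fH (cw v T (x + l * y)) l ≤ fH (cw v T x) l * exp (2 * (1 + M)) := by
  have hlm : l ∈ Ioo 0 (La τ T) := ⟨hl.1, by have := La_pos h.hT; linarith [hl.2]⟩
  have hl1 : l ≤ 1 := hlm.2.le.trans (min_le_left _ _)
  set G : ℝ → ℝ := fun s => fH (cw v T (x + l * (s * y))) l with hG
  have hGd : ∀ s, HasDerivAt G (∫ η, 2 * y * (cw v T (x + l * (s * y)) l η * cw1 vy T (x + l * (s * y)) l η) ∂gm) s := by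
    intro s
    have hF := h.flow
    have := hasDerivAt_integral_of_dominated_loc_of_deriv_le (μ := gm) (x₀ := s) (s := univ)
      (F := fun s η => cw v T (x + l * (s * y)) l η ^ 2)
      (F' := fun s η => 2 * y * (cw v T (x + l * (s * y)) l η * cw1 vy T (x + l * (s * y)) l η))
      (bound := fun _ => 2 * |y| * ((2 * C) * (2 * C))) Filter.univ_mem
      (Filter.Eventually.of_forall fun s => ((hF _).g0 hlm).sq.int.aestronglyMeasurable)
      ((hF _).g0 hlm).sq.int
      ((((hF _).g0 hlm).mul ((hF _).g1 hlm)).cmul _).int.aestronglyMeasurable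
      (Filter.Eventually.of_forall fun η s _ => ?_) (integrable_const _)
      (Filter.Eventually.of_forall fun η s _ => ?_)
    · exact this.2
    · rw [norm_eq_abs, abs_mul, abs_mul, abs_mul, abs_two]
      have := h.hC
      have := (hF (x + l * (s * y))).b0 l hlm η
      have := (hF (x + l * (s * y))).b1 l hlm η
      gcongr
    · have d := (hF x).d0 l hlm (η + s * y)
      have d2 := d.comp s (h := fun s => η + s * y) (by simpa using ((hasDerivAt_id s).mul_const y).const_add η)
      have d3 := d2.pow 2
      simp only [Function.comp_def, cw_shift] at d3
      refine d3.congr_deriv ?_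
      simp only [cw1]; push_cast; ring_nf
  have hbd : ∀ s ∈ Ico (0:ℝ) 1, ‖∫ η, 2 * y * (cw v T (x + l * (s * y)) l η * cw1 vy T (x + l * (s * y)) l η) ∂gm‖ ≤
      (2 * (1 + M)) * ‖G s‖ + 0 := by
    intro s hs
    have F := h.flow (x + l * (s * y))
    have hN := hM (x + l * (s * y)) (by
      rw [add_sub_cancel_left, abs_mul, abs_mul, abs_of_pos hl.1, abs_of_nonneg hs.1]
      have : s * |y| ≤ 1 * 2 := mul_le_mul hs.2.le hy (abs_nonneg _) zero_le_one
      have : l * (s * |y|) ≤ 1 * 2 := mul_le_mul hl1 (by linarith) (mul_nonneg hs.1 (abs_nonneg _)) zero_le_one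
      linarith)
    have hE := F.E_le hlm hN
    have hG0 : 0 ≤ G s := Flow.H_nonneg _ _
    rw [norm_eq_abs, norm_eq_abs, abs_of_nonneg hG0, integral_const_mul, abs_mul, abs_mul, abs_two]
    have hi : |∫ η, cw v T (x + l * (s * y)) l η * cw1 vy T (x + l * (s * y)) l η ∂gm| ≤ (1/2) * ((1 + M) * G s) := by
      calc |∫ η, cw v T (x + l * (s * y)) l η * cw1 vy T (x + l * (s * y)) l η ∂gm|
          ≤ ∫ η, |cw v T (x + l * (s * y)) l η * cw1 vy T (x + l * (s * y)) l η| ∂gm := abs_integral_le_integral_abs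
        _ ≤ ∫ η, (1/2) * (cw v T (x + l * (s * y)) l η ^ 2 + cw1 vy T (x + l * (s * y)) l η ^ 2) ∂gm := by
            refine integral_mono ((F.g0 hlm).mul (F.g1 hlm)).abs.int (((F.g0 hlm).sq.add (F.g1 hlm).sq).cmul _).int fun η => ?_
            simp only [abs_mul]
            rw [← sq_abs (cw v T (x + l * (s * y)) l η), ← sq_abs (cw1 vy T (x + l * (s * y)) l η)]
            linarith [sq_nonneg (|cw v T (x + l * (s * y)) l η| - |cw1 vy T (x + l * (s * y)) l η|)]
        _ = (1/2) * (fH (cw v T (x + l * (s * y))) l + fH (cw1 vy T (x + l * (s * y))) l) := by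
            rw [integral_const_mul, integral_add (F.g0 hlm).sq.int (F.g1 hlm).sq.int]; rfl
        _ ≤ (1/2) * ((1 + M) * G s) := by
            have : G s = fH (cw v T (x + l * (s * y))) l := rfl
            rw [this]
            linarith
    have := abs_nonneg y
    have h0 := abs_nonneg (∫ η, cw v T (x + l * (s * y)) l η * cw1 vy T (x + l * (s * y)) l η ∂gm)
    calc 2 * |y| * |∫ η, cw v T (x + l * (s * y)) l η * cw1 vy T (x + l * (s * y)) l η ∂gm|
        ≤ 2 * 2 * ((1/2) * ((1 + M) * G s)) := by gcongr
      _ = _ := by ring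
  have := norm_le_gronwallBound_of_norm_deriv_right_le (f := G) (δ := ‖G 0‖) (K := 2 * (1 + M)) (ε := 0) (a := 0) (b := 1)
    (fun s _ => (hGd s).continuousAt.continuousWithinAt) (fun s _ => (hGd s).hasDerivWithinAt) le_rfl hbd 1 (by simp)
  rw [gronwallBound_ε0, norm_eq_abs, norm_eq_abs, abs_of_nonneg (Flow.H_nonneg _ _), abs_of_nonneg (Flow.H_nonneg _ _)] at this
  simpa [hG] using this

lemma isolated (h : Core v vy vyy vt τ T L K C) (xc : ℝ) :
    ∃ δ > 0, ∀ x, x ≠ xc → |x - xc| < δ → v x T ≠ 0 := by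
  have hLa := La_pos h.hT
  obtain ⟨M, hM0, hM⟩ := h.unifM (|xc| + 4)
  obtain ⟨c, hc, hsp⟩ := spectral M
  have F := h.flow xc
  set f := Flow.ff (cw v T xc) (cw1 vy T xc) K with hf
  have hbdd : BddBelow (f '' Ioo 0 (La τ T)) := by
    refine ⟨0, ?_⟩
    rintro _ ⟨l, _, rfl⟩
    exact mul_nonneg (by linarith [Flow.N_nonneg (w := cw v T xc) (w1 := cw1 vy T xc) l]) (exp_pos _).le
  have hne : (f '' Ioo 0 (La τ T)).Nonempty := ⟨_, La τ T / 2, ⟨by positivity, by linarith⟩, rfl⟩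
  obtain ⟨_, ⟨ls, hls, rfl⟩, hlt⟩ := exists_lt_of_csInf_lt hne (show sInf (f '' Ioo 0 (La τ T)) < sInf (f '' Ioo 0 (La τ T)) + c by linarith)
  set q := Flow.D0 K M ^ 2 * exp (2 * (1 + M)) with hq
  have hq0 : 0 ≤ q := by positivity
  have hA : 0 < √(c / (q + 1)) := sqrt_pos.2 (by positivity)
  refine ⟨min (min ls (La τ T / 2)) (min 1 (√(c / (q + 1)))), ?_, ?_⟩
  · exact lt_min (lt_min hls.1 (by positivity)) (lt_min one_pos hA)
  intro x hx hd hv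
  set d := |x - xc| with hdd
  have hd0 : 0 < d := abs_pos.2 (sub_ne_zero.2 hx)
  have hd1 : d < ls := hd.trans_le ((min_le_left _ _).trans (min_le_left _ _))
  have hd2 : d < La τ T / 2 := hd.trans_le ((min_le_left _ _).trans (min_le_right _ _))
  have hd3 : d < 1 := hd.trans_le ((min_le_right _ _).trans (min_le_left _ _))
  have hd4 : d < √(c / (q + 1)) := hd.trans_le ((min_le_right _ _).trans (min_le_right _ _))
  have hdm : d ∈ Ioo 0 (La τ T) := ⟨hd0, by linarith⟩
  have hdm2 : d / 2 ∈ Ioo 0 (La τ T) := ⟨by positivity, by linarith⟩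
  obtain ⟨l, hl, hP⟩ := F.exists_P hdm2 hdm (by linarith)
  have hlp : 0 < l := by linarith [hl.1]
  have hlm : l ∈ Ioo 0 (La τ T) := ⟨hlp, by linarith [hl.2, hdm.2]⟩
  have hl2 : l ∈ Ioc 0 (La τ T / 2) := ⟨hlp, by linarith [hl.2]⟩
  have h1 : f d ≤ f ls := F.f_mono hdm hls hd1.le
  have h2 : sInf (f '' Ioo 0 (La τ T)) ≤ f (d / 2) := csInf_le hbdd ⟨_, hdm2, rfl⟩
  have hH : 0 < fH (cw v T xc) l := F.pos l hlm
  have hPc : fP (cw v T xc) (cw1 vy T xc) (cw2 vyy T xc) l ≤ c * fH (cw v T xc) l := by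
    have h3 : 2 * fP (cw v T xc) (cw1 vy T xc) (cw2 vyy T xc) l / (l * fH (cw v T xc) l) * (d - d / 2) ≤ c := by linarith
    have e : 2 * fP (cw v T xc) (cw1 vy T xc) (cw2 vyy T xc) l / (l * fH (cw v T xc) l) * (d - d / 2) =
      fP (cw v T xc) (cw1 vy T xc) (cw2 vyy T xc) l * d / (l * fH (cw v T xc) l) := by ring
    rw [e, div_le_iff₀ (by positivity)] at h3
    have hP0 := Flow.P_nonneg (w := cw v T xc) (w1 := cw1 vy T xc) (w2 := cw2 vyy T xc) l
    have h4 : fP (cw v T xc) (cw1 vy T xc) (cw2 vyy T xc) l * l ≤ fP (cw v T xc) (cw1 vy T xc) (cw2 vyy T xc) l * d := by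
      gcongr; exact hl.2.le
    refine le_of_mul_le_mul_right ?_ hlp
    linarith
  set y := (x - xc) / l with hy
  have hya : |y| = d / l := by rw [hy, abs_div, abs_of_pos hlp]
  have hy1 : 1 ≤ |y| := by rw [hya, le_div_iff₀ hlp]; linarith [hl.2]
  have hy2 : |y| ≤ 2 := by rw [hya, div_le_iff₀ hlp]; linarith [hl.1]
  have hxy : xc + l * y = x := by rw [hy]; field_simp; ring
  have hs := hsp (cw v T xc l) (cw1 vy T xc l) (cw2 vyy T xc l) (Flow.fN (cw v T xc) (cw1 vy T xc) l) y
    (F.d0 l hlm) (F.d1 l hlm) (F.g0 hlm) (F.g1 hlm) (F.g2 hlm) (Flow.N_nonneg l)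
    (hM xc (by linarith [abs_nonneg xc]) l hl2) hPc hy1 hy2
  simp only [cw_shift, hxy] at hs
  have habs : ∀ x', |x' - xc| ≤ 2 → |x'| ≤ |xc| + 4 := fun x' hx' => by
    have := abs_sub_abs_le_abs_sub x' xc
    linarith
  have hm := (h.flow x).m0_lim (M := M) (l0 := La τ T / 2) (V := 0) (by linarith)
    (fun l hl => hM x (habs x (by linarith)) l hl) (by have := h.m0_tendsto x; rwa [hv] at this) hlp hl2.2
  rw [sub_zero] at hm
  have hsh := h.H_shift (x := xc) (y := y) hM0 hl2 (fun x' hx' => hM x' (habs x' hx') l hl2) hy2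
  rw [hxy] at hsh
  have hsq : (∫ η, cw v T x l η ∂gm) ^ 2 ≤ Flow.D0 K M ^ 2 * fH (cw v T x) l * l ^ 2 := by
    rw [← sq_abs]
    calc _ ≤ (Flow.D0 K M * √(fH (cw v T x) l) * l) ^ 2 := by gcongr
      _ = Flow.D0 K M ^ 2 * (√(fH (cw v T x) l)) ^ 2 * l ^ 2 := by ring
      _ = _ := by rw [sq_sqrt (Flow.H_nonneg _ _)]
  have hfin : c * fH (cw v T xc) l ≤ q * l ^ 2 * fH (cw v T xc) l := by
    calc c * fH (cw v T xc) l ≤ _ := hs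
      _ ≤ _ := hsq
      _ ≤ Flow.D0 K M ^ 2 * (fH (cw v T xc) l * exp (2 * (1 + M))) * l ^ 2 := by gcongr
      _ = _ := by rw [hq]; ring
  have hcq := le_of_mul_le_mul_right hfin hH
  have hl4 : l ^ 2 < c / (q + 1) := (lt_sqrt hlp.le).1 (hl.2.trans hd4)
  rw [lt_div_iff₀ (by positivity)] at hl4
  linarith [pow_pos hlp 2]

lemma nosign (h : Core v vy vyy vt τ T L K C) (h0 : v 0 T = 0) {C' σ : ℝ} (hσ : 0 < σ)
    (hb : ∀ s ∈ Ioo 0 σ, ∀ z, |v z (T - s)| ≤ C' * (z ^ 2 + s)) :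
    ∃ σ1 > 0, ∀ t ∈ Ioo (T - σ1) T, ∀ α β : ℝ, |α| + |β| = 1 → ¬ ∀ z, 0 ≤ v z t * (α + β * z) := by
  have hLa := La_pos h.hT
  obtain ⟨M, hM0, hM⟩ := h.unifM 0
  obtain ⟨ε, hε, hsl⟩ := sign_lemma hM0
  have F := h.flow 0
  set l0 := min (La τ T / 2) (√σ / 2) with hl0
  have hsσ : 0 < √σ := sqrt_pos.2 hσ
  have hl0p : 0 < l0 := lt_min (by positivity) (by positivity)
  have hl0L : l0 ≤ La τ T / 2 := min_le_left _ _
  have hN : ∀ l ∈ Ioc 0 l0, Flow.fN (cw v T 0) (cw1 vy T 0) l ≤ M := fun l hl =>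
    hM 0 (by simp) l ⟨hl.1, hl.2.trans hl0L⟩
  have gW : GC (fun η => (η ^ 2 + 1) * |η|) := (gc_id.sq.add (gc_const 1)).mul gc_id.abs
  have hm1 : ∀ s ∈ Ioc 0 l0, |∫ η, cw v T 0 s η * η ∂gm| ≤ (C' * ∫ η, (η ^ 2 + 1) * |η| ∂gm) * s ^ 2 := by
    intro s hs
    have hsm : s ∈ Ioo 0 (La τ T) := ⟨hs.1, by linarith [hs.2]⟩
    have hs2 : s ^ 2 ∈ Ioo 0 σ := by
      refine ⟨pow_pos hs.1 2, (lt_sqrt hs.1.le).1 ?_⟩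
      have : l0 ≤ √σ / 2 := min_le_right _ _
      linarith [hs.2]
    calc |∫ η, cw v T 0 s η * η ∂gm| ≤ ∫ η, |cw v T 0 s η * η| ∂gm := abs_integral_le_integral_abs
      _ ≤ ∫ η, (C' * s ^ 2) * ((η ^ 2 + 1) * |η|) ∂gm := by
          refine integral_mono ((F.g0 hsm).mul gc_id).abs.int (gW.cmul _).int fun η => ?_
          simp only [abs_mul]
          have := hb _ hs2 (0 + s * η)
          calc |cw v T 0 s η| * |η| ≤ (C' * ((0 + s * η) ^ 2 + s ^ 2)) * |η| := by
                gcongr; exact this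
            _ = _ := by ring
      _ = _ := by rw [integral_const_mul]; ring
  obtain ⟨δ, hδ, hδ2⟩ := F.m1_small hl0p (by linarith) hN hm1 hε
  have hD := Flow.D0_nonneg K M
  set l1 := min δ (ε / (Flow.D0 K M + 1)) with hl1
  have hl1p : 0 < l1 := lt_min hδ.1 (by positivity)
  refine ⟨l1 ^ 2, by positivity, fun t ht α β hab hs => ?_⟩
  set l := √(T - t) with hl
  have hTt : 0 < T - t := by linarith [ht.2]
  have hlp : 0 < l := sqrt_pos.2 hTt
  have hl2 : l ^ 2 = T - t := sq_sqrt hTt.le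
  have hll1 : l < l1 := by
    rw [hl, sqrt_lt' hl1p]; linarith [ht.1]
  have hlδ : l < δ := hll1.trans_le (min_le_left _ _)
  have hlε : l < ε / (Flow.D0 K M + 1) := hll1.trans_le (min_le_right _ _)
  have hll0 : l ≤ l0 := hlδ.le.trans hδ.2
  have hlm : l ∈ Ioo 0 (La τ T) := ⟨hlp, by linarith⟩
  have hm0 := F.m0_lim (M := M) (l0 := l0) (V := 0) (by linarith) hN
    (by have := h.m0_tendsto 0; rwa [h0] at this) hlp hll0
  rw [sub_zero] at hm0
  have hm0' : |∫ η, cw v T 0 l η ∂gm| ≤ ε * √(fH (cw v T 0) l) := by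
    refine hm0.trans ?_
    rw [lt_div_iff₀ (by positivity)] at hlε
    have := sqrt_nonneg (fH (cw v T 0) l)
    first | linarith only [mul_nonneg (sub_nonneg.2 hlε.le) this, mul_nonneg hlp.le this] | nlinarith
  have hn : 0 < |α| + |β| * l := by
    by_cases hα : α = 0
    · have : |β| = 1 := by rw [hα] at hab; simpa using hab
      rw [this]; positivity
    · have := abs_pos.2 hα; positivity
  refine hsl (cw v T 0 l) (cw1 vy T 0 l) (α / (|α| + |β| * l)) (β * l / (|α| + |β| * l)) (F.d0 l hlm) (F.g0 hlm) (F.g1 hlm)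
    (F.E_le hlm (hN l ⟨hlp, hll0⟩)) (F.pos l hlm) hm0' (hδ2 l ⟨hlp, hlδ⟩) ?_ fun η => ?_
  · rw [abs_div, abs_div, abs_of_pos hn, abs_mul, abs_of_pos hlp]; field_simp
  · have := hs (0 + l * η)
    have e : T - l ^ 2 = t := by linarith
    have e2 : α / (|α| + |β| * l) + β * l / (|α| + |β| * l) * η = (α + β * (0 + l * η)) / (|α| + |β| * l) := by ring
    rw [cw, e, e2, ← mul_div_assoc]
    exact div_nonneg this hn.le

end Core

lemma joint_diff {f fx ft : ℝ → ℝ → ℝ} {x t : ℝ}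
    (h1 : ∀ᶠ p : ℝ × ℝ in nhds (x, t), HasDerivAt (fun y => f y p.2) (fx p.1 p.2) p.1)
    (h2 : ∀ᶠ p : ℝ × ℝ in nhds (x, t), HasDerivAt (fun s => f p.1 s) (ft p.1 p.2) p.2)
    (c1 : ContinuousAt (fun p : ℝ × ℝ => fx p.1 p.2) (x, t))
    (c2 : ContinuousAt (fun p : ℝ × ℝ => ft p.1 p.2) (x, t)) :
    HasFDerivAt (fun p : ℝ × ℝ => f p.1 p.2)
      (fx x t • ContinuousLinearMap.fst ℝ ℝ ℝ + ft x t • ContinuousLinearMap.snd ℝ ℝ ℝ) (x, t) := by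
  have k : Continuous (fun r : ℝ => ContinuousLinearMap.toSpanSingleton ℝ r) :=
    (ContinuousLinearMap.toSpanSingletonCLE (𝕜 := ℝ) (E := ℝ)).continuous
  have := (hasStrictFDerivAt_uncurry_coprod (𝕜 := ℝ) (u := (x, t)) (f := f)
    (f₁ := fun y s => ContinuousLinearMap.toSpanSingleton ℝ (fx y s))
    (f₂ := fun y s => ContinuousLinearMap.toSpanSingleton ℝ (ft y s))
    (h1.mono fun p hp => hp.hasFDerivAt) (h2.mono fun p hp => hp.hasFDerivAt)
    (k.continuousAt.comp c1) (k.continuousAt.comp c2)).hasFDerivAt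
  refine this.congr_fderiv ?_
  ext <;> simp [Function.HasUncurry.uncurry]

structure Pre (U Ux Uxx Ut g gx gt : ℝ → ℝ → ℝ) (τ T xc L K C c0 : ℝ) : Prop where
  hT : τ < T
  hK : 0 ≤ K
  hC : 0 ≤ C
  hc0 : 0 < c0
  dx : ∀ t ∈ Ioo τ T, ∀ x, HasDerivAt (fun x => U x t) (Ux x t) x
  dxx : ∀ t ∈ Ioo τ T, ∀ x, HasDerivAt (fun x => Ux x t) (Uxx x t) x
  dt : ∀ t ∈ Ioo τ T, ∀ x, HasDerivAt (fun t => U x t) (Ut x t) t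
  cx : ∀ t ∈ Ioo τ T, ∀ x, ContinuousAt (fun p : ℝ × ℝ => Ux p.1 p.2) (x, t)
  cxx : ∀ t ∈ Ioo τ T, ∀ x, ContinuousAt (fun p : ℝ × ℝ => Uxx p.1 p.2) (x, t)
  ct : ∀ t ∈ Ioo τ T, ∀ x, ContinuousAt (fun p : ℝ × ℝ => Ut p.1 p.2) (x, t)
  b0 : ∀ t ∈ Ioo τ T, ∀ y, |U y t| ≤ C
  bx : ∀ t ∈ Ioo τ T, ∀ y, |Ux y t| ≤ C
  bxx : ∀ t ∈ Ioo τ T, ∀ y, |Uxx y t| ≤ C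
  bt : ∀ t ∈ Ioo τ T, ∀ y, |Ut y t| ≤ C
  cU : ∀ y, ContinuousWithinAt (fun p : ℝ × ℝ => U p.1 p.2) (univ ×ˢ Iic T) (y, T)
  far : ∀ t ∈ Ioo τ T, ∀ y, L ≤ |y - xc| → 1 ≤ |U y t| ∧ Ux y t = 0
  eq : ∀ t ∈ Ioo τ T, ∀ y, |Ut y t - Uxx y t / g y t ^ 2| ≤ K * (|U y t| + |Ux y t|)
  gc : Continuous (fun p : ℝ × ℝ => g p.1 p.2)
  gxc : Continuous (fun p : ℝ × ℝ => gx p.1 p.2)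
  gtc : Continuous (fun p : ℝ × ℝ => gt p.1 p.2)
  gl : ∀ x t, c0 ≤ g x t
  gb : ∀ x t, |g x t| ≤ C
  gxb : ∀ x t, |gx x t| ≤ C
  gtb : ∀ x t, |gt x t| ≤ C
  gdx : ∀ t ∈ Ioo τ T, ∀ x, HasDerivAt (fun x => g x t) (gx x t) x
  gdt : ∀ t ∈ Ioo τ T, ∀ x, HasDerivAt (fun t => g x t) (gt x t) t

namespace Pre
variable {U Ux Uxx Ut g gx gt : ℝ → ℝ → ℝ} {τ T xc L K C c0 : ℝ}

noncomputable def Y (g : ℝ → ℝ → ℝ) (xc x t : ℝ) : ℝ := ∫ ξ in xc..x, g ξ t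

lemma Y_cont {g : ℝ → ℝ → ℝ} (hg : Continuous (fun p : ℝ × ℝ => g p.1 p.2)) (xc : ℝ) : Continuous (fun p : ℝ × ℝ => Y g xc p.1 p.2) := by
  refine intervalIntegral.continuous_parametric_intervalIntegral_of_continuous (f := fun (p : ℝ × ℝ) ξ => g ξ p.2) ?_ continuous_fst
  exact hg.comp (f := fun q : (ℝ × ℝ) × ℝ => (q.2, q.1.2)) (by fun_prop)

lemma sec_cont {g : ℝ → ℝ → ℝ} (hg : Continuous (fun p : ℝ × ℝ => g p.1 p.2)) (t : ℝ) : Continuous (fun x => g x t) :=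
  hg.comp (f := fun x : ℝ => (x, t)) (by fun_prop)

lemma gpos (h : Pre U Ux Uxx Ut g gx gt τ T xc L K C c0) (x t : ℝ) : 0 < g x t := h.hc0.trans_le (h.gl x t)

lemma Y_dx (h : Pre U Ux Uxx Ut g gx gt τ T xc L K C c0) (x t : ℝ) : HasDerivAt (fun x => Y g xc x t) (g x t) x :=
  ((sec_cont h.gc t).integral_hasStrictDerivAt xc x).hasDerivAt

lemma Y_low (h : Pre U Ux Uxx Ut g gx gt τ T xc L K C c0) (x x' t : ℝ) : c0 * |x - x'| ≤ |Y g xc x t - Y g xc x' t| := by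
  have key : ∀ x x', x' ≤ x → c0 * (x - x') ≤ Y g xc x t - Y g xc x' t := by
    intro x x' hx
    have := Convex.mul_sub_le_image_sub_of_le_deriv (convex_univ) (f := fun x => Y g xc x t) (C := c0)
      (fun y _ => (h.Y_dx y t).continuousAt.continuousWithinAt) (fun y _ => (h.Y_dx y t).differentiableAt.differentiableWithinAt)
      (fun y _ => by rw [(h.Y_dx y t).deriv]; exact h.gl y t) x' (mem_univ _) x (mem_univ _) hx
    exact this
  rcases le_total x' x with hx | hx
  · have := key x x' hx
    rw [abs_of_nonneg (sub_nonneg.2 hx)]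
    exact this.trans (le_abs_self _)
  · have := key x' x hx
    rw [abs_sub_comm, abs_of_nonneg (sub_nonneg.2 hx), abs_sub_comm (Y g xc x t)]
    exact this.trans (le_abs_self _)

lemma Y_up (h : Pre U Ux Uxx Ut g gx gt τ T xc L K C c0) (x t : ℝ) : |Y g xc x t| ≤ C * |x - xc| :=
  intervalIntegral.norm_integral_le_of_norm_le_const (f := fun ξ => g ξ t) fun ξ _ => h.gb ξ t

lemma Yt_up (h : Pre U Ux Uxx Ut g gx gt τ T xc L K C c0) (x t : ℝ) : |Y gt xc x t| ≤ C * |x - xc| :=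
  intervalIntegral.norm_integral_le_of_norm_le_const (f := fun ξ => gt ξ t) fun ξ _ => h.gtb ξ t

lemma exists_X (h : Pre U Ux Uxx Ut g gx gt τ T xc L K C c0) (y t : ℝ) : ∃ x, Y g xc x t = y := by
  set R := |y| / c0 with hR
  have hR0 : 0 ≤ R := div_nonneg (abs_nonneg _) h.hc0.le
  have hy : c0 * R = |y| := by rw [hR]; field_simp [h.hc0.ne']
  have h0 : Y g xc xc t = 0 := by simp [Y]
  have hm : ∀ x x', x' ≤ x → c0 * (x - x') ≤ Y g xc x t - Y g xc x' t := by
    intro x x' hx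
    have := Convex.mul_sub_le_image_sub_of_le_deriv (convex_univ) (f := fun x => Y g xc x t) (C := c0)
      (fun y _ => (h.Y_dx y t).continuousAt.continuousWithinAt) (fun y _ => (h.Y_dx y t).differentiableAt.differentiableWithinAt)
      (fun y _ => by rw [(h.Y_dx y t).deriv]; exact h.gl y t) x' (mem_univ _) x (mem_univ _) hx
    exact this
  have h1 := hm (xc + R) xc (by linarith)
  have h2 := hm xc (xc - R) (by linarith)
  rw [h0] at h1 h2
  have hc : ContinuousOn (fun x => Y g xc x t) (Icc (xc - R) (xc + R)) := fun x _ => (h.Y_dx x t).continuousAt.continuousWithinAt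
  obtain ⟨x, -, hx⟩ := intermediate_value_Icc (by linarith) hc (show y ∈ Icc _ _ from
    ⟨by have := neg_abs_le y; linarith, by have := le_abs_self y; linarith⟩)
  exact ⟨x, hx⟩

lemma Y_dt (h : Pre U Ux Uxx Ut g gx gt τ T xc L K C c0) {t : ℝ} (ht : t ∈ Ioo τ T) (x : ℝ) : HasDerivAt (fun t => Y g xc x t) (Y gt xc x t) t := by
  refine (intervalIntegral.hasDerivAt_integral_of_dominated_loc_of_deriv_le (F := fun t ξ => g ξ t) (F' := fun t ξ => gt ξ t)
    (bound := fun _ => C) (s := Ioo τ T) (isOpen_Ioo.mem_nhds ht) (Filter.Eventually.of_forall fun s => (sec_cont h.gc s).aestronglyMeasurable)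
    ((sec_cont h.gc t).intervalIntegrable _ _) (sec_cont h.gtc t).aestronglyMeasurable
    (Filter.Eventually.of_forall fun ξ _ s _ => h.gtb ξ s) intervalIntegrable_const
    (Filter.Eventually.of_forall fun ξ _ s hs => h.gdt s hs ξ)).2

lemma core (h : Pre U Ux Uxx Ut g gx gt τ T xc L K C c0) {X : ℝ → ℝ → ℝ} (hX : ∀ y t, Y g xc (X y t) t = y) :
    ∃ L' K' C', Core (fun y t => U (X y t) t) (fun y t => Ux (X y t) t / g (X y t) t)
      (fun y t => Uxx (X y t) t / g (X y t) t ^ 2 - Ux (X y t) t * gx (X y t) t / g (X y t) t ^ 3)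
      (fun y t => Ut (X y t) t - Ux (X y t) t * (Y gt xc (X y t) t / g (X y t) t)) τ T L' K' C' := by
  have hc0 := h.hc0
  have hC := h.hC
  have hK := h.hK
  have hCc : c0 ≤ C := (h.gl 0 0).trans ((le_abs_self _).trans (h.gb 0 0))
  have hCp : 0 < C := hc0.trans_le hCc
  have Xc : Continuous (fun p : ℝ × ℝ => X p.1 p.2) := by
    rw [continuous_iff_continuousAt]
    rintro ⟨y, t⟩
    have hb : ∀ p : ℝ × ℝ, dist (X p.1 p.2) (X y t) ≤ |p.1 - Y g xc (X y t) p.2| / c0 := by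
      intro p
      rw [dist_eq, le_div_iff₀ hc0]
      have := h.Y_low (X p.1 p.2) (X y t) p.2
      rw [hX] at this
      linarith
    have hz : Continuous (fun p : ℝ × ℝ => |p.1 - Y g xc (X y t) p.2| / c0) := by
      have := (Y_cont h.gc xc).comp (f := fun p : ℝ × ℝ => (X y t, p.2)) (by fun_prop)
      exact ((continuous_fst.sub this).abs).div_const _
    have hz0 := hz.tendsto (y, t)
    simp only [hX, sub_self, abs_zero, zero_div] at hz0
    exact tendsto_iff_dist_tendsto_zero.2 (squeeze_zero (fun _ => dist_nonneg) hb hz0)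
  have Xj : Continuous (fun p : ℝ × ℝ => (X p.1 p.2, p.2)) := Xc.prodMk continuous_snd
  have Xdy : ∀ y t, HasDerivAt (fun y => X y t) (g (X y t) t)⁻¹ y := fun y t =>
    HasDerivAt.of_local_left_inverse (f := fun x => Y g xc x t) (sec_cont Xc t).continuousAt (h.Y_dx _ t) (h.gpos _ _).ne'
      (Filter.Eventually.of_forall fun y => hX y t)
  have hopen : ∀ t ∈ Ioo τ T, ∀ x : ℝ, ∀ᶠ p : ℝ × ℝ in nhds (x, t), p.2 ∈ Ioo τ T := fun t ht x =>
    continuous_snd.continuousAt.eventually (isOpen_Ioo.mem_nhds ht)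
  have Xj_d : ∀ t ∈ Ioo τ T, ∀ y, HasFDerivAt (fun p : ℝ × ℝ => (X p.1 p.2, p.2))
      (((g (X y t) t)⁻¹ • ContinuousLinearMap.fst ℝ ℝ ℝ + (-(Y gt xc (X y t) t / g (X y t) t)) • ContinuousLinearMap.snd ℝ ℝ ℝ).prod
        (ContinuousLinearMap.snd ℝ ℝ ℝ)) (y, t) := by
    intro t ht y
    have hY := joint_diff (f := Y g xc) (fx := g) (ft := Y gt xc) (x := X y t) (t := t)
      (Filter.Eventually.of_forall fun p => h.Y_dx _ _) ((hopen t ht _).mono fun p hp => h.Y_dt hp _)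
      h.gc.continuousAt (Y_cont h.gtc xc).continuousAt
    have hF := hY.prodMk (hasFDerivAt_snd (𝕜 := ℝ) (p := (X y t, t)))
    have gn := (h.gpos (X y t) t).ne'
    set A : ℝ × ℝ →L[ℝ] ℝ × ℝ := (g (X y t) t • ContinuousLinearMap.fst ℝ ℝ ℝ + Y gt xc (X y t) t • ContinuousLinearMap.snd ℝ ℝ ℝ).prod
      (ContinuousLinearMap.snd ℝ ℝ ℝ) with hA
    set B : ℝ × ℝ →L[ℝ] ℝ × ℝ := ((g (X y t) t)⁻¹ • ContinuousLinearMap.fst ℝ ℝ ℝ + (-(Y gt xc (X y t) t / g (X y t) t)) • ContinuousLinearMap.snd ℝ ℝ ℝ).prod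
        (ContinuousLinearMap.snd ℝ ℝ ℝ) with hB
    have e1 : Function.LeftInverse B A := by
      rintro ⟨a, b⟩
      ext
      · simp [hA, hB]; field_simp; ring
      · simp [hA, hB]
    have e2 : Function.RightInverse B A := by
      rintro ⟨a, b⟩
      ext
      · simp [hA, hB]; field_simp; ring
      · simp [hA, hB]
    exact HasFDerivAt.of_local_left_inverse (f' := ContinuousLinearEquiv.equivOfInverse A B e1 e2)
      (f := fun p : ℝ × ℝ => (Y g xc p.1 p.2, p.2)) Xj.continuousAt hF (Filter.Eventually.of_forall fun p => by simp [hX])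
  have hgi : ∀ x t, |g x t| ≥ c0 := fun x t => (h.gl x t).trans (le_abs_self _)
  have hga : ∀ x t, |g x t| = g x t := fun x t => abs_of_pos (h.gpos x t)
  have hLn : 0 ≤ |L| := abs_nonneg L
  have hYU : ∀ t ∈ Ioo τ T, ∀ x, |Ux x t * (Y gt xc x t / g x t)| ≤ |Ux x t| * (C * |L| / c0) := by
    intro t ht x
    by_cases hx : L ≤ |x - xc|
    · rw [(h.far t ht x hx).2]; simp
    · push Not at hx
      rw [abs_mul, abs_div]
      have h1 := h.Yt_up x t
      have h2 : C * |x - xc| ≤ C * |L| := by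
        exact mul_le_mul_of_nonneg_left (hx.le.trans (le_abs_self L)) hC
      gcongr
      · linarith
      · exact hgi x t
  have hgU : ∀ t ∈ Ioo τ T, ∀ x, |Ux x t * gx x t / g x t ^ 3| ≤ |Ux x t| * (C / c0 ^ 3) := by
    intro t ht x
    rw [abs_div, abs_mul, abs_pow, mul_div_assoc]
    gcongr
    · exact h.gxb x t
    · exact hgi x t
  refine ⟨C * |L|, K * (1 + C) + (C * |L| / c0 + C / c0 ^ 3) * C, C + C / c0 + (C / c0 ^ 2 + C * (C / c0 ^ 3)) + C * (C * |L| / c0),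
    h.hT, by positivity, by positivity, ?_, ?_, ?_, ?_, ?_, ?_, ?_, ?_, ?_, ?_, ?_, ?_, ?_⟩
  · intro t ht y
    exact ((h.dx t ht _).comp y (Xdy y t)).congr_deriv (by rw [div_eq_mul_inv])
  · intro t ht y
    have gn := (h.gpos (X y t) t).ne'
    have d1 := (h.dxx t ht _).comp y (Xdy y t)
    have d2 := (h.gdx t ht _).comp y (Xdy y t)
    refine (d1.div d2 gn).congr_deriv ?_
    simp only [Function.comp_apply]
    field_simp
  · intro t ht y
    have hU := joint_diff (f := U) (fx := Ux) (ft := Ut) (x := X y t) (t := t)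
      ((hopen t ht _).mono fun p hp => h.dx _ hp _) ((hopen t ht _).mono fun p hp => h.dt _ hp _) (h.cx t ht _) (h.ct t ht _)
    have := HasFDerivAt.comp (f := fun p : ℝ × ℝ => (X p.1 p.2, p.2)) (y, t) hU (Xj_d t ht y)
    refine this.congr_fderiv ?_
    ext <;> simp <;> ring
  · intro t ht y
    have c1 := ContinuousAt.comp (f := fun p : ℝ × ℝ => (X p.1 p.2, p.2)) (x := (y, t)) (h.cx t ht (X y t)) Xj.continuousAt
    have c2 := ContinuousAt.comp (f := fun p : ℝ × ℝ => (X p.1 p.2, p.2)) (x := (y, t)) h.gc.continuousAt Xj.continuousAt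
    exact c1.div c2 (h.gpos _ _).ne'
  · intro t ht y
    have c1 := ContinuousAt.comp (f := fun p : ℝ × ℝ => (X p.1 p.2, p.2)) (x := (y, t)) (h.cx t ht (X y t)) Xj.continuousAt
    have c2 := ContinuousAt.comp (f := fun p : ℝ × ℝ => (X p.1 p.2, p.2)) (x := (y, t)) h.gc.continuousAt Xj.continuousAt
    have c3 := ContinuousAt.comp (f := fun p : ℝ × ℝ => (X p.1 p.2, p.2)) (x := (y, t)) (h.cxx t ht (X y t)) Xj.continuousAt
    have c4 := ContinuousAt.comp (f := fun p : ℝ × ℝ => (X p.1 p.2, p.2)) (x := (y, t)) h.gxc.continuousAt Xj.continuousAt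
    exact (c3.div (c2.pow 2) (pow_ne_zero _ (h.gpos _ _).ne')).sub ((c1.mul c4).div (c2.pow 3) (pow_ne_zero _ (h.gpos _ _).ne'))
  · intro t ht
    have Xt : Continuous (fun y => (X y t, t)) := (sec_cont Xc t).prodMk continuous_const
    refine continuous_iff_continuousAt.2 fun y => ?_
    have c1 := ContinuousAt.comp (f := fun y : ℝ => (X y t, t)) (x := y) (h.cx t ht (X y t)) Xt.continuousAt
    have c2 := ContinuousAt.comp (f := fun y : ℝ => (X y t, t)) (x := y) h.gc.continuousAt Xt.continuousAt
    have c3 := ContinuousAt.comp (f := fun y : ℝ => (X y t, t)) (x := y) (h.ct t ht (X y t)) Xt.continuousAt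
    have c4 := ContinuousAt.comp (f := fun y : ℝ => (X y t, t)) (x := y) (Y_cont h.gtc xc).continuousAt Xt.continuousAt
    exact c3.sub (c1.mul (c4.div c2 (h.gpos _ _).ne'))
  · intro t ht y
    refine (h.b0 t ht _).trans ?_
    have : 0 ≤ C / c0 + (C / c0 ^ 2 + C * (C / c0 ^ 3)) + C * (C * |L| / c0) := by positivity
    linarith
  · intro t ht y
    have : |Ux (X y t) t / g (X y t) t| ≤ C / c0 := by
      rw [abs_div]; gcongr; exacts [h.bx t ht _, hgi _ _]
    have : 0 ≤ C + (C / c0 ^ 2 + C * (C / c0 ^ 3)) + C * (C * |L| / c0) := by positivity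
    linarith
  · intro t ht y
    have h1 : |Uxx (X y t) t / g (X y t) t ^ 2| ≤ C / c0 ^ 2 := by
      rw [abs_div, abs_pow]; gcongr; exacts [h.bxx t ht _, hgi _ _]
    have h2 : |Ux (X y t) t * gx (X y t) t / g (X y t) t ^ 3| ≤ C * (C / c0 ^ 3) :=
      (hgU t ht _).trans (by gcongr; exact h.bx t ht _)
    have := abs_sub (Uxx (X y t) t / g (X y t) t ^ 2) (Ux (X y t) t * gx (X y t) t / g (X y t) t ^ 3)
    have : 0 ≤ C + C / c0 + C * (C * |L| / c0) := by positivity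
    linarith
  · intro t ht y
    have h1 := h.bt t ht (X y t)
    have h2 : |Ux (X y t) t * (Y gt xc (X y t) t / g (X y t) t)| ≤ C * (C * |L| / c0) :=
      (hYU t ht _).trans (by gcongr; exact h.bx t ht _)
    have := abs_sub (Ut (X y t) t) (Ux (X y t) t * (Y gt xc (X y t) t / g (X y t) t))
    have : 0 ≤ C / c0 + (C / c0 ^ 2 + C * (C / c0 ^ 3)) := by positivity
    linarith
  · intro y
    refine ContinuousWithinAt.comp (f := fun p : ℝ × ℝ => (X p.1 p.2, p.2)) (x := (y, T)) (t := univ ×ˢ Iic T) (h.cU (X y T)) Xj.continuousWithinAt ?_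
    rintro ⟨a, b⟩ ⟨_, hb⟩
    exact ⟨mem_univ _, hb⟩
  · intro t ht y hy
    refine (h.far t ht (X y t) ?_).1
    have := h.Y_up (X y t) t
    rw [hX] at this
    exact (le_abs_self L).trans (le_of_mul_le_mul_left (hy.trans this) hCp)
  · intro t ht y
    have h1 := h.eq t ht (X y t)
    have h2 := hYU t ht (X y t)
    have h3 := hgU t ht (X y t)
    have h4 : |Ux (X y t) t| ≤ C * |Ux (X y t) t / g (X y t) t| := by
      rw [abs_div, mul_div_assoc', le_div_iff₀ (hc0.trans_le (hgi _ _)), mul_comm C]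
      gcongr; exact h.gb _ _
    set P := |Ux (X y t) t| with hP
    set Q := |Ux (X y t) t / g (X y t) t| with hQ
    have hQ0 : 0 ≤ Q := abs_nonneg _
    have hU0 : 0 ≤ |U (X y t) t| := abs_nonneg _
    have e : Ut (X y t) t - Ux (X y t) t * (Y gt xc (X y t) t / g (X y t) t) -
        (Uxx (X y t) t / g (X y t) t ^ 2 - Ux (X y t) t * gx (X y t) t / g (X y t) t ^ 3) =
        (Ut (X y t) t - Uxx (X y t) t / g (X y t) t ^ 2) - Ux (X y t) t * (Y gt xc (X y t) t / g (X y t) t)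
        + Ux (X y t) t * gx (X y t) t / g (X y t) t ^ 3 := by ring
    rw [e]
    refine (abs_add_le _ _).trans ?_
    have h5 := abs_sub (Ut (X y t) t - Uxx (X y t) t / g (X y t) t ^ 2) (Ux (X y t) t * (Y gt xc (X y t) t / g (X y t) t))
    have h6 : K * (|U (X y t) t| + P) + P * (C * |L| / c0) + P * (C / c0 ^ 3)
        ≤ K * (|U (X y t) t| + C * Q) + (C * Q) * (C * |L| / c0) + (C * Q) * (C / c0 ^ 3) := by gcongr
    have h7 : 0 ≤ K * C * |U (X y t) t| + K * Q + (C * |L| / c0 + C / c0 ^ 3) * C * |U (X y t) t| := by positivity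
    linarith
end Pre

lemma exists_clamp {p q r : ℝ} (hpq : p < q) (hr : 0 < r) : ∃ s s1 s2 : ℝ → ℝ, (∀ x, HasDerivAt s (s1 x) x) ∧
    (∀ x, HasDerivAt s1 (s2 x) x) ∧ Continuous s2 ∧ (∀ x ∈ Icc p q, s x = x) ∧ (∀ x ∈ Ioo p q, s1 x = 1 ∧ s2 x = 0) ∧
    (∀ x ≤ p, s x ∈ Icc (p - r) p) ∧ (∀ x, q ≤ x → s x ∈ Icc q (q + r)) ∧ (∀ x, |s1 x| ≤ 1) ∧
    (∃ B, ∀ x, |s2 x| ≤ B) ∧ ∀ x, x ≤ p - r ∨ q + r ≤ x → s1 x = 0 := by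
  let χ : ContDiffBump ((p + q) / 2) := ⟨(q - p) / 2, (q - p) / 2 + r, by linarith, by linarith⟩
  have hcd : ContDiff ℝ 2 χ := χ.contDiff
  have hc : Continuous χ := χ.continuous
  have hone : ∀ x ∈ Icc p q, χ x = 1 := fun x hx => χ.one_of_mem_closedBall (by
    rw [Metric.mem_closedBall, dist_eq, abs_le]; constructor <;> simp only [χ] <;> linarith [hx.1, hx.2])
  have hzero : ∀ x, x ≤ p - r ∨ q + r ≤ x → χ x = 0 := fun x hx => χ.zero_of_le_dist (by
    rw [dist_eq, le_abs]
    simp only [χ]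
    rcases hx with hx | hx
    · right; linarith
    · left; linarith)
  have hn : ∀ x, 0 ≤ χ x := fun x => χ.nonneg
  have hle : ∀ x, χ x ≤ 1 := fun x => χ.le_one
  have hint : ∀ a b, IntervalIntegrable χ volume a b := fun a b => hc.intervalIntegrable a b
  have hid : ∀ x ∈ Icc p q, p + ∫ ξ in p..x, χ ξ = x := by
    intro x hx
    have : ∫ ξ in p..x, χ ξ = ∫ ξ in p..x, (1 : ℝ) := by
      refine intervalIntegral.integral_congr fun ξ hξ => ?_
      rw [uIcc_of_le hx.1] at hξ
      exact hone ξ ⟨hξ.1, hξ.2.trans hx.2⟩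
    rw [this]; simp
  have hb : ∀ a b, a ≤ b → 0 ≤ ∫ ξ in a..b, χ ξ ∧ ∫ ξ in a..b, χ ξ ≤ b - a := by
    intro a b hab
    refine ⟨intervalIntegral.integral_nonneg hab fun x _ => hn x, ?_⟩
    calc ∫ ξ in a..b, χ ξ ≤ ∫ ξ in a..b, (1 : ℝ) := intervalIntegral.integral_mono_on hab (hint a b) intervalIntegrable_const fun x _ => hle x
      _ = b - a := by simp
  have hz : ∀ a b, a ≤ b → (b ≤ p - r ∨ q + r ≤ a) → ∫ ξ in a..b, χ ξ = 0 := by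
    intro a b hab h
    have : ∫ ξ in a..b, χ ξ = ∫ ξ in a..b, (0 : ℝ) := by
      refine intervalIntegral.integral_congr fun ξ hξ => ?_
      rw [uIcc_of_le hab] at hξ
      exact hzero ξ (h.imp (fun h => hξ.2.trans h) (fun h => h.trans hξ.1))
    rw [this]; simp
  refine ⟨fun x => p + ∫ ξ in p..x, χ ξ, χ, deriv χ, ?_, ?_, ?_, hid, ?_, ?_, ?_, ?_, ?_, hzero⟩
  · intro x
    exact ((hc.integral_hasStrictDerivAt p x).hasDerivAt).const_add p
  · intro x
    exact (hcd.differentiable (by norm_num) x).hasDerivAt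
  · exact hcd.continuous_deriv (by norm_num)
  · intro x hx
    refine ⟨hone x ⟨hx.1.le, hx.2.le⟩, ?_⟩
    have : (χ : ℝ → ℝ) =ᶠ[nhds x] fun _ => 1 := by
      filter_upwards [isOpen_Ioo.mem_nhds hx] with y hy
      exact hone y ⟨hy.1.le, hy.2.le⟩
    rw [this.deriv_eq]; simp
  · intro x hx
    have e : ∫ ξ in p..x, χ ξ = - ∫ ξ in x..p, χ ξ := intervalIntegral.integral_symm _ _
    have h1 := hb x p hx
    simp only [e]
    refine ⟨?_, by linarith⟩
    rcases le_total x (p - r) with h | h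
    · have h2 := hz x (p - r) h (Or.inl le_rfl)
      have h3 := hb (p - r) p (by linarith)
      have h4 := intervalIntegral.integral_add_adjacent_intervals (hint x (p - r)) (hint (p - r) p)
      linarith
    · linarith
  · intro x hx
    have h0 := hid q ⟨hpq.le, le_rfl⟩
    have e := intervalIntegral.integral_add_adjacent_intervals (hint p q) (hint q x)
    have h1 := hb q x hx
    simp only [← e]
    refine ⟨by linarith, ?_⟩
    rcases le_total x (q + r) with h | h
    · linarith
    · have h2 := hz (q + r) x h (Or.inr le_rfl)
      have h3 := hb q (q + r) (by linarith)
      have h4 := intervalIntegral.integral_add_adjacent_intervals (hint q (q + r)) (hint (q + r) x)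
      linarith
  · intro x
    rw [abs_of_nonneg (hn x)]; exact hle x
  · have := (χ.hasCompactSupport.deriv).exists_bound_of_continuous (hcd.continuous_deriv (by norm_num))
    exact this

structure Sol (x0 x1 t0 te : ℝ) (u ux uxx ut a b c : ℝ → ℝ → ℝ) : Prop where
  cu : ContinuousOn (fun p : ℝ × ℝ => u p.1 p.2) (Icc x0 x1 ×ˢ Icc t0 te)
  apos : ∀ x ∈ Icc x0 x1, ∀ t ∈ Icc t0 te, 0 < a x t
  areg : ContDiffOn ℝ 1 (fun p : ℝ × ℝ => a p.1 p.2) (Icc x0 x1 ×ˢ Icc t0 te)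
  cb : ContinuousOn (fun p : ℝ × ℝ => b p.1 p.2) (Icc x0 x1 ×ˢ Icc t0 te)
  cc : ContinuousOn (fun p : ℝ × ℝ => c p.1 p.2) (Icc x0 x1 ×ˢ Icc t0 te)
  dx : ∀ x ∈ Ioo x0 x1, ∀ t ∈ Ioc t0 te, HasDerivAt (fun x => u x t) (ux x t) x
  dxx : ∀ x ∈ Ioo x0 x1, ∀ t ∈ Ioc t0 te, HasDerivAt (fun x => ux x t) (uxx x t) x
  dt : ∀ x ∈ Ioo x0 x1, ∀ t ∈ Ioc t0 te, HasDerivAt (fun t => u x t) (ut x t) t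
  cx : ContinuousOn (fun p : ℝ × ℝ => ux p.1 p.2) (Ioo x0 x1 ×ˢ Ioc t0 te)
  cxx : ContinuousOn (fun p : ℝ × ℝ => uxx p.1 p.2) (Ioo x0 x1 ×ˢ Ioc t0 te)
  ct : ContinuousOn (fun p : ℝ × ℝ => ut p.1 p.2) (Ioo x0 x1 ×ˢ Ioc t0 te)
  pde : ∀ x ∈ Ioo x0 x1, ∀ t ∈ Ioc t0 te, ut x t = a x t * uxx x t + b x t * ux x t + c x t * u x t

namespace Sol
variable {x0 x1 t0 te : ℝ} {u ux uxx ut a b c : ℝ → ℝ → ℝ}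

lemma neg (S : Sol x0 x1 t0 te u ux uxx ut a b c) :
    Sol x0 x1 t0 te (fun x t => - u x t) (fun x t => - ux x t) (fun x t => - uxx x t) (fun x t => - ut x t) a b c :=
  ⟨S.cu.neg, S.apos, S.areg, S.cb, S.cc, fun x hx t ht => (S.dx x hx t ht).neg, fun x hx t ht => (S.dxx x hx t ht).neg,
    fun x hx t ht => (S.dt x hx t ht).neg, S.cx.neg, S.cxx.neg, S.ct.neg, fun x hx t ht => by rw [S.pde x hx t ht]; ring⟩

lemma nbhd (S : Sol x0 x1 t0 te u ux uxx ut a b c) {T p : ℝ} (hT : T ∈ Ioc t0 te) (hp : p ∈ Ioo x0 x1) (hu : u p T ≠ 0) :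
    ∃ r > 0, ∀ x t, |x - p| ≤ r → t ∈ Icc (T - r) T → x ∈ Ioo x0 x1 ∧ t ∈ Ioc t0 te ∧ 0 < u x t * u p T ∧ |u p T| / 2 ≤ |u x t| := by
  have hc := S.cu (p, T) ⟨⟨hp.1.le, hp.2.le⟩, ⟨hT.1.le, hT.2⟩⟩
  have hpos := abs_pos.2 hu
  obtain ⟨r, hr, hrb⟩ := Metric.continuousWithinAt_iff.1 hc (|u p T| / 2) (by positivity)
  set d := min (r / 2) (min ((p - x0) / 2) (min ((x1 - p) / 2) ((T - t0) / 2))) with hd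
  have h1 : d ≤ r / 2 := min_le_left _ _
  have h2 : d ≤ (p - x0) / 2 := (min_le_right _ _).trans (min_le_left _ _)
  have h3 : d ≤ (x1 - p) / 2 := (min_le_right _ _).trans ((min_le_right _ _).trans (min_le_left _ _))
  have h4 : d ≤ (T - t0) / 2 := (min_le_right _ _).trans ((min_le_right _ _).trans (min_le_right _ _))
  have hd0 : 0 < d := lt_min (by linarith) (lt_min (by linarith [hp.1]) (lt_min (by linarith [hp.2]) (by linarith [hT.1])))
  refine ⟨d, hd0, fun x t hx ht => ?_⟩
  have hxa := abs_le.1 hx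
  have hxm : x ∈ Ioo x0 x1 := ⟨by linarith [hp.1], by linarith [hp.2]⟩
  have htm : t ∈ Ioc t0 te := ⟨by linarith [hT.1, ht.1], ht.2.trans hT.2⟩
  have hb := hrb (x := (x, t)) ⟨⟨hxm.1.le, hxm.2.le⟩, ⟨htm.1.le, htm.2⟩⟩ (by
    rw [Prod.dist_eq]
    refine max_lt ?_ ?_
    · simp only [dist_eq]; linarith
    · simp only [dist_eq]; rw [abs_lt]; constructor <;> linarith [ht.1, ht.2])
  simp only [dist_eq] at hb
  refine ⟨hxm, htm, ?_, ?_⟩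
  · have e : u x t * u p T = (u x t - u p T) * u p T + |u p T| ^ 2 := by rw [sq_abs]; ring
    have := neg_abs_le ((u x t - u p T) * u p T)
    rw [abs_mul] at this
    first | nlinarith only [e, this, hb, hpos] | nlinarith
  · have := abs_sub_abs_le_abs_sub (u p T) (u x t)
    rw [abs_sub_comm] at this
    linarith
end Sol

lemma comp_nice {f : ℝ → ℝ → ℝ} {A B τ T : ℝ} {s ϖ : ℝ → ℝ} (hf : ContinuousOn (fun p : ℝ × ℝ => f p.1 p.2) (Icc A B ×ˢ Icc τ T))
    (hs : Continuous s) (hs' : ∀ x, s x ∈ Icc A B) (hϖ : Continuous ϖ) (hϖ' : ∀ t, ϖ t ∈ Icc τ T) :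
    Continuous (fun p : ℝ × ℝ => f (s p.1) (ϖ p.2)) ∧ ∃ M, 0 ≤ M ∧ ∀ x t, |f (s x) (ϖ t)| ≤ M := by
  constructor
  · exact hf.comp_continuous (f := fun p : ℝ × ℝ => (s p.1, ϖ p.2)) (by fun_prop) (fun p => ⟨hs' _, hϖ' _⟩)
  · obtain ⟨M, hM⟩ := (isCompact_Icc.prod isCompact_Icc).exists_bound_of_continuousOn hf
    exact ⟨M, (norm_nonneg _).trans (hM (s 0, ϖ 0) ⟨hs' _, hϖ' _⟩), fun x t => hM (s x, ϖ t) ⟨hs' _, hϖ' _⟩⟩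

lemma eq_in {X Y P Q R1 R2 A B : ℝ} (hX : 0 ≤ X) (hY : 0 ≤ Y) (hP : 0 ≤ P) (hQ : 0 ≤ Q) (h1 : 0 ≤ R1) (h2 : 0 ≤ R2) (hA : A ≤ P * X) (hB : B ≤ Q * Y) :
    A + B ≤ (P + Q + R1 + R2) * (Y + X) := by
  have := mul_nonneg hP hY
  have := mul_nonneg hQ hX
  have := mul_nonneg (add_nonneg h1 h2) (add_nonneg hX hY)
  linarith

lemma eq_out {X Y P Q R1 R2 A B : ℝ} (hX : 0 ≤ X) (hY : 1 ≤ Y) (hP : 0 ≤ P) (hQ : 0 ≤ Q) (h1 : 0 ≤ R1) (h2 : 0 ≤ R2) (hA : A ≤ R1) (hB : B ≤ R2) :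
    A + B ≤ (P + Q + R1 + R2) * (Y + X) := by
  have := mul_le_mul_of_nonneg_left (show 1 ≤ Y + X by linarith) (show 0 ≤ P + Q + R1 + R2 by linarith)
  linarith

namespace Sol
variable {x0 x1 t0 te : ℝ} {u ux uxx ut a b c : ℝ → ℝ → ℝ}

lemma a_deriv (S : Sol x0 x1 t0 te u ux uxx ut a b c) (hx : x0 < x1) (ht : t0 < te) : ∃ ax at' : ℝ → ℝ → ℝ,
    ContinuousOn (fun p : ℝ × ℝ => ax p.1 p.2) (Icc x0 x1 ×ˢ Icc t0 te) ∧
    ContinuousOn (fun p : ℝ × ℝ => at' p.1 p.2) (Icc x0 x1 ×ˢ Icc t0 te) ∧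
    (∀ x ∈ Ioo x0 x1, ∀ t ∈ Ioo t0 te, HasDerivAt (fun x => a x t) (ax x t) x) ∧
    (∀ x ∈ Ioo x0 x1, ∀ t ∈ Ioo t0 te, HasDerivAt (fun t => a x t) (at' x t) t) := by
  set D : Set (ℝ × ℝ) := Icc x0 x1 ×ˢ Icc t0 te with hD
  have hU : UniqueDiffOn ℝ D := (uniqueDiffOn_Icc hx).prod (uniqueDiffOn_Icc ht)
  have hc := S.areg.continuousOn_fderivWithin hU le_rfl
  set A' := fderivWithin ℝ (fun p : ℝ × ℝ => a p.1 p.2) D with hA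
  have hF : ∀ x ∈ Ioo x0 x1, ∀ t ∈ Ioo t0 te, HasFDerivAt (fun p : ℝ × ℝ => a p.1 p.2) (A' (x, t)) (x, t) := by
    intro x hx t ht
    have hm : D ∈ nhds (x, t) := prod_mem_nhds (Icc_mem_nhds hx.1 hx.2) (Icc_mem_nhds ht.1 ht.2)
    have := (S.areg.differentiableOn one_ne_zero (x, t) (mem_of_mem_nhds hm)).hasFDerivWithinAt
    exact this.hasFDerivAt hm
  refine ⟨fun x t => A' (x, t) (1, 0), fun x t => A' (x, t) (0, 1), ?_, ?_, ?_, ?_⟩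
  · exact hc.clm_apply continuousOn_const
  · exact hc.clm_apply continuousOn_const
  · intro x hx t ht
    exact (hF x hx t ht).comp_hasDerivAt x ((hasDerivAt_id x).prodMk (hasDerivAt_const x t))
  · intro x hx t ht
    exact (hF x hx t ht).comp_hasDerivAt t ((hasDerivAt_const t x).prodMk (hasDerivAt_id t))

set_option maxHeartbeats 1000000 in
lemma exists_pre (S : Sol x0 x1 t0 te u ux uxx ut a b c) {T p q xc : ℝ} (hT : T ∈ Ioc t0 te) (hp : x0 < p) (hpx : p < xc)
    (hxq : xc < q) (hq : q < x1) (hup : u p T ≠ 0) (huq : u q T ≠ 0) :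
    ∃ (U Ux Uxx Ut g gx gt : ℝ → ℝ → ℝ) (τ L K C c0 : ℝ), Pre U Ux Uxx Ut g gx gt τ T xc L K C c0 ∧ t0 < τ ∧ τ < T ∧ ∃ N > 0,
      (∀ x ∈ Icc p q, ∀ t ∈ Icc τ T, U x t = N * u x t) ∧ (∀ t ∈ Icc τ T, ∀ x ≤ p, 0 < U x t * u p t) ∧
      (∀ t ∈ Icc τ T, ∀ x, q ≤ x → 0 < U x t * u q t) ∧ Ux xc T = N * ux xc T ∧ Continuous (fun p : ℝ × ℝ => U p.1 p.2) ∧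
      Continuous (fun p : ℝ × ℝ => Ux p.1 p.2) := by
  have hpq := hpx.trans hxq
  obtain ⟨ax, at', cax, cat, dax, dat⟩ := S.a_deriv (by linarith) (hT.1.trans_le hT.2)
  obtain ⟨r1, hr1, h1⟩ := S.nbhd hT ⟨hp, by linarith⟩ hup
  obtain ⟨r2, hr2, h2⟩ := S.nbhd hT ⟨by linarith, hq⟩ huq
  set r := min r1 r2 with hr
  have hr0 : 0 < r := lt_min hr1 hr2
  have hrr1 : r ≤ r1 := min_le_left _ _
  have hrr2 : r ≤ r2 := min_le_right _ _
  obtain ⟨s, s1, s2, ds, ds1, cs2, sid, s12, sl, sr, b1, ⟨B2, b2⟩, s0⟩ := exists_clamp hpq hr0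
  have cs : Continuous s := continuous_iff_continuousAt.2 fun x => (ds x).continuousAt
  have cs1 : Continuous s1 := continuous_iff_continuousAt.2 fun x => (ds1 x).continuousAt
  have hsm : ∀ x, s x ∈ Icc (p - r) (q + r) := by
    intro x
    rcases le_total x p with h | h
    · exact ⟨(sl x h).1, by linarith [(sl x h).2]⟩
    rcases le_total q x with h' | h'
    · exact ⟨by linarith [(sr x h').1], (sr x h').2⟩
    · rw [sid x ⟨h, h'⟩]; exact ⟨by linarith, by linarith⟩
  have hlo := (h1 (p - r) T (by rw [abs_le]; constructor <;> linarith) ⟨by linarith, le_rfl⟩).1.1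
  have hhi := (h2 (q + r) T (by rw [abs_le]; constructor <;> linarith) ⟨by linarith, le_rfl⟩).1.2
  have hτ := (h1 p (T - r) (by simp [hr1.le]) ⟨by linarith, by linarith⟩).2.1.1
  set τ := T - r with hτd
  have hτT : τ < T := by linarith
  set ϖ : ℝ → ℝ := fun t => max τ (min t T) with hϖd
  have cϖ : Continuous ϖ := by fun_prop
  have hϖm : ∀ t, ϖ t ∈ Icc τ T := fun t => ⟨le_max_left _ _, max_le hτT.le (min_le_right _ _)⟩
  have hϖi : ∀ t ∈ Icc τ T, ϖ t = t := by
    intro t ht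
    simp only [hϖd]; rw [min_eq_left ht.2, max_eq_right ht.1]
  have hϖe : ∀ t ∈ Ioo τ T, ϖ =ᶠ[nhds t] id := by
    intro t ht
    filter_upwards [isOpen_Ioo.mem_nhds ht] with w hw
    exact hϖi w ⟨hw.1.le, hw.2.le⟩
  have hsx : ∀ x, s x ∈ Ioo x0 x1 := fun x => ⟨by linarith [(hsm x).1], by linarith [(hsm x).2]⟩
  have htm : ∀ t ∈ Ioo τ T, t ∈ Ioc t0 te := fun t ht => ⟨by linarith [ht.1], by linarith [ht.2, hT.2]⟩
  have hto : ∀ t ∈ Ioo τ T, t ∈ Ioo t0 te := fun t ht => ⟨by linarith [ht.1], by linarith [ht.2, hT.2]⟩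
  have hsub1 : Icc (p - r) (q + r) ×ˢ Icc τ T ⊆ Icc x0 x1 ×ˢ Icc t0 te := prod_mono (Icc_subset_Icc hlo.le hhi.le) (Icc_subset_Icc hτ.le hT.2)
  have hsub2 : Icc (p - r) (q + r) ×ˢ Icc τ T ⊆ Ioo x0 x1 ×ˢ Ioc t0 te :=
    prod_mono (fun x hx => ⟨by linarith [hx.1], by linarith [hx.2]⟩) (fun x hx => ⟨by linarith [hx.1], by linarith [hx.2, hT.2]⟩)
  obtain ⟨ku, Mu, Mu0, hMu⟩ := comp_nice (S.cu.mono hsub1) cs hsm cϖ hϖm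
  obtain ⟨kx, Mx, Mx0, hMx⟩ := comp_nice (S.cx.mono hsub2) cs hsm cϖ hϖm
  obtain ⟨kxx, Mxx, Mxx0, hMxx⟩ := comp_nice (S.cxx.mono hsub2) cs hsm cϖ hϖm
  obtain ⟨kt, Mt, Mt0, hMt⟩ := comp_nice (S.ct.mono hsub2) cs hsm cϖ hϖm
  obtain ⟨ka, Ma, Ma0, hMa⟩ := comp_nice (S.areg.continuousOn.mono hsub1) cs hsm cϖ hϖm
  obtain ⟨-, Mb, Mb0, hMb⟩ := comp_nice (S.cb.mono hsub1) cs hsm cϖ hϖm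
  obtain ⟨-, Mc, Mc0, hMc⟩ := comp_nice (S.cc.mono hsub1) cs hsm cϖ hϖm
  have hapos : ∀ z ∈ Icc x0 x1 ×ˢ Icc t0 te, 0 < a z.1 z.2 := fun z hz => S.apos _ hz.1 _ hz.2
  have cg0 : ContinuousOn (fun z : ℝ × ℝ => (√(a z.1 z.2))⁻¹) (Icc x0 x1 ×ˢ Icc t0 te) :=
    (continuous_sqrt.comp_continuousOn S.areg.continuousOn).inv₀ fun z hz => (sqrt_pos.2 (hapos z hz)).ne'
  have cgf : ∀ f : ℝ → ℝ → ℝ, ContinuousOn (fun z : ℝ × ℝ => f z.1 z.2) (Icc x0 x1 ×ˢ Icc t0 te) →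
      ContinuousOn (fun z : ℝ × ℝ => -(f z.1 z.2 / (2 * √(a z.1 z.2))) / √(a z.1 z.2) ^ 2) (Icc x0 x1 ×ˢ Icc t0 te) := by
    intro f hf
    have k := continuous_sqrt.comp_continuousOn S.areg.continuousOn
    refine ContinuousOn.div (ContinuousOn.neg (hf.div (continuousOn_const.mul k) fun z hz => ?_)) (k.pow 2) fun z hz => ?_
    · have := sqrt_pos.2 (hapos z hz); positivity
    · have := sqrt_pos.2 (hapos z hz); exact (pow_pos this 2).ne'
  obtain ⟨kg, Mg, Mg0, hMg⟩ := comp_nice (f := fun x t => (√(a x t))⁻¹) (cg0.mono hsub1) cs hsm cϖ hϖm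
  obtain ⟨kgx, Mgx, Mgx0, hMgx⟩ := comp_nice (f := fun x t => -(ax x t / (2 * √(a x t))) / √(a x t) ^ 2) ((cgf ax cax).mono hsub1) cs hsm cϖ hϖm
  obtain ⟨kgt, Mgt, Mgt0, hMgt⟩ := comp_nice (f := fun x t => -(at' x t / (2 * √(a x t))) / √(a x t) ^ 2) ((cgf at' cat).mono hsub1) cs hsm cϖ hϖm
  have hap : ∀ x t, 0 < a (s x) (ϖ t) := fun x t => hapos (s x, ϖ t) (hsub1 ⟨hsm x, hϖm t⟩)
  have hup' := abs_pos.2 hup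
  have huq' := abs_pos.2 huq
  set N := 2 / |u p T| + 2 / |u q T| with hN
  have hN0 : 0 < N := by positivity
  have big : ∀ x, x ∉ Ioo p q → ∀ t ∈ Icc τ T, 1 ≤ |N * u (s x) t| := by
    intro x hx t ht
    rw [abs_mul, abs_of_pos hN0]
    have e1 : 2 / |u p T| * (|u p T| / 2) = 1 := by field_simp
    have e2 : 2 / |u q T| * (|u q T| / 2) = 1 := by field_simp
    rcases le_or_gt x p with h | h
    · have h3 := (h1 (s x) t (by rw [abs_le]; constructor <;> linarith [(sl x h).1, (sl x h).2]) ⟨by linarith [ht.1], ht.2⟩).2.2.2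
      calc 1 = 2 / |u p T| * (|u p T| / 2) := e1.symm
        _ ≤ N * |u (s x) t| := mul_le_mul (by rw [hN]; have : 0 < 2 / |u q T| := by positivity
                                              linarith) h3 (by positivity) hN0.le
    · have h' : q ≤ x := by by_contra h'; exact hx ⟨h, not_le.1 h'⟩
      have h3 := (h2 (s x) t (by rw [abs_le]; constructor <;> linarith [(sr x h').1, (sr x h').2]) ⟨by linarith [ht.1], ht.2⟩).2.2.2
      calc 1 = 2 / |u q T| * (|u q T| / 2) := e2.symm
        _ ≤ N * |u (s x) t| := mul_le_mul (by rw [hN]; have : 0 < 2 / |u p T| := by positivity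
                                              linarith) h3 (by positivity) hN0.le
  have dsq : ∀ (f : ℝ → ℝ) (f' y : ℝ), HasDerivAt f f' y → 0 < f y → HasDerivAt (fun z => (√(f z))⁻¹) (-(f' / (2 * √(f y))) / √(f y) ^ 2) y :=
    fun f f' y h h0 => (h.sqrt h0.ne').inv (sqrt_pos.2 h0).ne'
  have B20 : 0 ≤ B2 := (abs_nonneg _).trans (b2 0)
  set C1 := N * (Mxx + Mx * B2) with hC1
  have hC10 : 0 ≤ C1 := by positivity
  set C := N * Mu + N * Mx + C1 + N * Mt + Mg + Mgx + Mgt with hC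
  have p1 : 0 ≤ N * Mu := by positivity
  have p2 : 0 ≤ N * Mx := by positivity
  have p3 : 0 ≤ N * Mt := by positivity
  have bxx : ∀ x t, |N * (uxx (s x) (ϖ t) * s1 x ^ 2 + ux (s x) (ϖ t) * s2 x)| ≤ C1 := by
    intro x t
    rw [abs_mul, abs_of_pos hN0, hC1]
    refine mul_le_mul_of_nonneg_left ((abs_add_le _ _).trans ?_) hN0.le
    rw [abs_mul, abs_mul, abs_pow]
    refine add_le_add ?_ ?_
    · calc _ ≤ Mxx * 1 := mul_le_mul (hMxx x t) (pow_le_one₀ (abs_nonneg _) (b1 x)) (by positivity) Mxx0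
        _ = Mxx := mul_one _
    · exact mul_le_mul (hMx x t) (b2 x) (abs_nonneg _) Mx0
  refine ⟨fun x t => N * u (s x) (ϖ t), fun x t => N * (ux (s x) (ϖ t) * s1 x), fun x t => N * (uxx (s x) (ϖ t) * s1 x ^ 2 + ux (s x) (ϖ t) * s2 x),
    fun x t => N * ut (s x) (ϖ t), fun x t => (√(a (s x) (ϖ t)))⁻¹,
    fun x t => -(ax (s x) (ϖ t) / (2 * √(a (s x) (ϖ t)))) / √(a (s x) (ϖ t)) ^ 2 * s1 x,
    fun x t => -(at' (s x) (ϖ t) / (2 * √(a (s x) (ϖ t)))) / √(a (s x) (ϖ t)) ^ 2,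
    τ, q - p + r, Mb + Mc + N * Mt + C1 * Ma, C, (√(Ma + 1))⁻¹, ?_, hτ, hτT, N, hN0, ?_, ?_, ?_, ?_, ?_, ?_⟩
  · have kx' : Continuous (fun p : ℝ × ℝ => N * (ux (s p.1) (ϖ p.2) * s1 p.1)) := continuous_const.mul (kx.mul (cs1.comp continuous_fst))
    have kxx' : Continuous (fun p : ℝ × ℝ => N * (uxx (s p.1) (ϖ p.2) * s1 p.1 ^ 2 + ux (s p.1) (ϖ p.2) * s2 p.1)) :=
      continuous_const.mul ((kxx.mul ((cs1.comp continuous_fst).pow 2)).add (kx.mul (cs2.comp continuous_fst)))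
    have kt' : Continuous (fun p : ℝ × ℝ => N * ut (s p.1) (ϖ p.2)) := continuous_const.mul kt
    refine ⟨hτT, by positivity, by positivity, by positivity, ?_, ?_, ?_, fun t _ x => kx'.continuousAt, fun t _ x => kxx'.continuousAt,
      fun t _ x => kt'.continuousAt, ?_, ?_, ?_, ?_, fun y => (continuous_const.mul ku).continuousWithinAt, ?_, ?_, kg, kgx.mul (cs1.comp continuous_fst), kgt, ?_, ?_, ?_, ?_, ?_, ?_⟩
    · intro t ht x
      simp only [hϖi t ⟨ht.1.le, ht.2.le⟩]
      exact ((S.dx (s x) (hsx x) t (htm t ht)).comp x (ds x)).const_mul N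
    · intro t ht x
      simp only [hϖi t ⟨ht.1.le, ht.2.le⟩]
      refine ((((S.dxx (s x) (hsx x) t (htm t ht)).comp x (ds x)).mul (ds1 x)).const_mul N).congr_deriv ?_
      simp only [Function.comp]; ring
    · intro t ht x
      simp only [hϖi t ⟨ht.1.le, ht.2.le⟩]
      refine ((S.dt (s x) (hsx x) t (htm t ht)).const_mul N).congr_of_eventuallyEq ?_
      filter_upwards [hϖe t ht] with w hw
      simp only [hw, id]
    · intro t _ y
      rw [abs_mul, abs_of_pos hN0]
      have := mul_le_mul_of_nonneg_left (hMu y t) hN0.le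
      linarith
    · intro t _ y
      rw [abs_mul, abs_of_pos hN0, abs_mul]
      have := mul_le_mul_of_nonneg_left (mul_le_mul (hMx y t) (b1 y) (abs_nonneg _) Mx0) hN0.le
      linarith
    · intro t _ y
      have := bxx y t
      linarith
    · intro t _ y
      rw [abs_mul, abs_of_pos hN0]
      have := mul_le_mul_of_nonneg_left (hMt y t) hN0.le
      linarith
    · intro t ht y hy
      have hy' : y ≤ p - r ∨ q + r ≤ y := by
        by_contra hcon
        push Not at hcon
        have : |y - xc| < q - p + r := by rw [abs_lt]; constructor <;> linarith [hcon.1, hcon.2]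
        linarith
      have hym : y ∉ Ioo p q := by
        rintro ⟨h3, h4⟩
        rcases hy' with h | h <;> linarith
      refine ⟨?_, by simp [s0 y hy']⟩
      simp only [hϖi t ⟨ht.1.le, ht.2.le⟩]
      exact big y hym t ⟨ht.1.le, ht.2.le⟩
    · intro t ht y
      have hinv : ∀ w, w / (√(a (s y) (ϖ t)))⁻¹ ^ 2 = w * a (s y) (ϖ t) := by
        intro w
        rw [inv_pow, sq_sqrt (hap y t).le, div_inv_eq_mul]
      simp only [hinv]
      have kb := hMb y t
      have kc := hMc y t
      have kT := hMt y t
      have kxx2 := bxx y t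
      have kA := hMa y t
      have hpt := hϖi t ⟨ht.1.le, ht.2.le⟩
      by_cases hy : y ∈ Ioo p q
      · rw [(s12 y hy).1, (s12 y hy).2]
        rw [hpt] at kb kc ⊢
        have hpde := S.pde (s y) (hsx y) t (htm t ht)
        have e : N * ut (s y) t - N * (uxx (s y) t * 1 ^ 2 + ux (s y) t * 0) * a (s y) t = b (s y) t * (N * (ux (s y) t * 1)) + c (s y) t * (N * u (s y) t) := by
          rw [hpde]; ring
        rw [e]
        refine (abs_add_le _ _).trans ?_
        rw [abs_mul, abs_mul (c _ _)]
        have q1 := mul_le_mul_of_nonneg_right kb (abs_nonneg (N * (ux (s y) t * 1)))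
        have q2 := mul_le_mul_of_nonneg_right kc (abs_nonneg (N * u (s y) t))
        have z1 := abs_nonneg (N * (ux (s y) t * 1))
        have z2 := abs_nonneg (N * u (s y) t)
        have z3 : 0 ≤ C1 * Ma := by positivity
        exact eq_in z1 z2 Mb0 Mc0 p3 z3 q1 q2
      · have hb := big y hy t ⟨ht.1.le, ht.2.le⟩
        rw [← hpt] at hb
        refine (abs_sub _ _).trans ?_
        rw [abs_mul, abs_of_pos hN0, abs_mul (N * (_ + _))]
        have q1 := mul_le_mul_of_nonneg_left kT hN0.le
        have q2 := mul_le_mul kxx2 kA (abs_nonneg _) hC10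
        have z1 := abs_nonneg (N * (ux (s y) (ϖ t) * s1 y))
        have z3 : 0 ≤ C1 * Ma := by positivity
        exact eq_out z1 hb Mb0 Mc0 p3 z3 q1 q2
    · intro x t
      exact inv_anti₀ (sqrt_pos.2 (hap x t)) (sqrt_le_sqrt (by linarith [le_abs_self (a (s x) (ϖ t)), hMa x t]))
    · intro x t
      have := hMg x t
      linarith
    · intro x t
      rw [abs_mul]
      have := mul_le_mul (hMgx x t) (b1 x) (abs_nonneg _) Mgx0
      linarith
    · intro x t
      have := hMgt x t
      linarith
    · intro t ht x
      have h0 := hap x t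
      simp only [hϖi t ⟨ht.1.le, ht.2.le⟩] at h0 ⊢
      exact (dsq (fun z => a z t) _ (s x) (dax (s x) (hsx x) t (hto t ht)) h0).comp x (ds x)
    · intro t ht x
      have h0 := hap x t
      simp only [hϖi t ⟨ht.1.le, ht.2.le⟩] at h0 ⊢
      refine (dsq (fun z => a (s x) z) _ t (dat (s x) (hsx x) t (hto t ht)) h0).congr_of_eventuallyEq ?_
      filter_upwards [hϖe t ht] with w hw
      simp only [hw, id]
  · intro x hx t ht
    simp only [hϖi t ht, sid x hx]
  · intro t ht x hx
    simp only [hϖi t ht]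
    have k1 := (h1 (s x) t (by rw [abs_le]; constructor <;> linarith [(sl x hx).1, (sl x hx).2]) ⟨by linarith [ht.1], ht.2⟩).2.2.1
    have k2 := (h1 p t (by simp [hr1.le]) ⟨by linarith [ht.1], ht.2⟩).2.2.1
    have k3 := mul_pos k1 k2
    have : 0 < u (s x) t * u p t := by
      by_contra hcon
      nlinarith [sq_nonneg (u p T)]
    rw [mul_assoc]; exact mul_pos hN0 this
  · intro t ht x hx
    simp only [hϖi t ht]
    have k1 := (h2 (s x) t (by rw [abs_le]; constructor <;> linarith [(sr x hx).1, (sr x hx).2]) ⟨by linarith [ht.1], ht.2⟩).2.2.1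
    have k2 := (h2 q t (by simp [hr2.le]) ⟨by linarith [ht.1], ht.2⟩).2.2.1
    have k3 := mul_pos k1 k2
    have : 0 < u (s x) t * u q t := by
      by_contra hcon
      nlinarith [sq_nonneg (u q T)]
    rw [mul_assoc]; exact mul_pos hN0 this
  · simp only [hϖi T ⟨hτT.le, le_rfl⟩, sid xc ⟨hpx.le, hxq.le⟩, (s12 xc ⟨hpx, hxq⟩).1, mul_one]
  · exact continuous_const.mul ku
  · exact continuous_const.mul (kx.mul (cs1.comp continuous_fst))
end Sol

namespace Pre
variable {U Ux Uxx Ut g gx gt : ℝ → ℝ → ℝ} {τ T xc L K C c0 : ℝ}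

lemma Y_inj (h : Pre U Ux Uxx Ut g gx gt τ T xc L K C c0) {x x' t : ℝ} (he : Y g xc x t = Y g xc x' t) : x = x' := by
  have := h.Y_low x x' t
  rw [he, sub_self, abs_zero] at this
  have h2 : |x - x'| ≤ 0 := by
    by_contra hc
    have := mul_pos h.hc0 (not_le.1 hc)
    linarith
  exact sub_eq_zero.1 (abs_nonpos_iff.1 h2)

lemma Y_mono (h : Pre U Ux Uxx Ut g gx gt τ T xc L K C c0) (t : ℝ) : StrictMono (fun x => Y g xc x t) :=
  strictMono_of_deriv_pos fun x => by rw [(h.Y_dx x t).deriv]; exact h.gpos x t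

lemma taylor (h : Pre U Ux Uxx Ut g gx gt τ T xc L K C c0) {t : ℝ} (ht : t ∈ Ioo τ T) (x : ℝ) :
    |U x t - U xc t - Ux xc t * (x - xc)| ≤ C * (x - xc) ^ 2 := by
  have h1 : ∀ y, |Ux y t - Ux xc t| ≤ C * |y - xc| := fun y =>
    convex_univ.norm_image_sub_le_of_norm_hasDerivWithin_le (f := fun y => Ux y t) (fun z _ => (h.dxx t ht z).hasDerivWithinAt)
      (fun z _ => h.bxx t ht z) (mem_univ _) (mem_univ _)
  have h2 := (convex_uIcc xc x).norm_image_sub_le_of_norm_hasDerivWithin_le (f := fun y => U y t - Ux xc t * y) (f' := fun y => Ux y t - Ux xc t * 1)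
    (C := C * |x - xc|) (x := xc) (y := x)
    (fun z _ => ((h.dx t ht z).sub ((hasDerivAt_id z).const_mul _)).hasDerivWithinAt)
    (fun z hz => by
      rw [mul_one]
      exact (h1 z).trans (mul_le_mul_of_nonneg_left (abs_sub_left_of_mem_uIcc hz) h.hC)) left_mem_uIcc right_mem_uIcc
  simp only [norm_eq_abs] at h2
  calc _ = |U x t - Ux xc t * x - (U xc t - Ux xc t * xc)| := by congr 1; ring
    _ ≤ _ := h2
    _ = C * (|x - xc| ^ 2) := by ring
    _ = _ := by rw [sq_abs]

lemma degen_bound (h : Pre U Ux Uxx Ut g gx gt τ T xc L K C c0) (cU : Continuous (fun p : ℝ × ℝ => U p.1 p.2))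
    (cUx : Continuous (fun p : ℝ × ℝ => Ux p.1 p.2)) (h0 : U xc T = 0) (h1 : Ux xc T = 0) {t : ℝ} (ht : t ∈ Ioo τ T) (x : ℝ) :
    |U x t| ≤ C * (x - xc) ^ 2 + C * (T - t) := by
  have sU : ∀ x, Continuous (fun t => U x t) := fun x => cU.comp (f := fun t : ℝ => (x, t)) (by fun_prop)
  have sUx : Continuous (fun t => Ux xc t) := cUx.comp (f := fun t : ℝ => (xc, t)) (by fun_prop)
  have e1 : |U x T| ≤ C * (x - xc) ^ 2 := by
    have k : Continuous (fun t => |U x t - U xc t - Ux xc t * (x - xc)|) := (((sU x).sub (sU xc)).sub (sUx.mul continuous_const)).abs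
    have := le_of_tendsto (k.continuousWithinAt (s := Iio T) (x := T)) (b := C * (x - xc) ^ 2) (by
      filter_upwards [Ioo_mem_nhdsLT h.hT] with w hw
      exact h.taylor hw x)
    simpa [h0, h1] using this
  have e2 : |U x T - U x t| ≤ C * (T - t) := by
    have k : Continuous (fun w => |U x w - U x t| - C * (w - t)) := (((sU x).sub continuous_const).abs.sub (by fun_prop))
    have := le_of_tendsto (k.continuousWithinAt (s := Iio T) (x := T)) (b := 0) (by
      filter_upwards [Ioo_mem_nhdsLT ht.2] with w hw
      have := (convex_Ioo τ T).norm_image_sub_le_of_norm_hasDerivWithin_le (f := fun w => U x w) (f' := fun w => Ut x w) (C := C) (x := t) (y := w)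
        (fun z hz => (h.dt z hz x).hasDerivWithinAt) (fun z hz => h.bt z hz x) ht ⟨ht.1.trans hw.1, hw.2⟩
      simp only [norm_eq_abs] at this
      rw [abs_of_pos (sub_pos.2 hw.1)] at this
      linarith)
    linarith
  have := abs_sub_abs_le_abs_sub (U x t) (U x T)
  rw [abs_sub_comm] at this
  linarith
end Pre

namespace Sol
variable {x0 x1 t0 te : ℝ} {u ux uxx ut a b c : ℝ → ℝ → ℝ}

lemma isolated (S : Sol x0 x1 t0 te u ux uxx ut a b c) {T p q xc : ℝ} (hT : T ∈ Ioc t0 te) (hp : x0 < p) (hpx : p < xc)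
    (hxq : xc < q) (hq : q < x1) (hup : u p T ≠ 0) (huq : u q T ≠ 0) :
    ∃ δ > 0, ∀ x, x ≠ xc → |x - xc| < δ → u x T ≠ 0 := by
  obtain ⟨U, Ux, Uxx, Ut, g, gx, gt, τ, L, K, C, c0, h, hτ, hτT, N, hN, hU, -, -, -, -, -⟩ := S.exists_pre hT hp hpx hxq hq hup huq
  choose X hX using fun y t => h.exists_X y t
  obtain ⟨L', K', C', hC⟩ := h.core hX
  obtain ⟨δ, hδ, hi⟩ := hC.isolated 0
  refine ⟨min (δ / (C + 1)) (min (xc - p) (q - xc)), lt_min (div_pos hδ (by linarith [h.hC])) (lt_min (by linarith) (by linarith)), fun x hx hd => ?_⟩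
  have d1 := hd.trans_le (min_le_left _ _)
  have d2 := abs_lt.1 (hd.trans_le ((min_le_right _ _).trans (min_le_left _ _)))
  have d3 := abs_lt.1 (hd.trans_le ((min_le_right _ _).trans (min_le_right _ _)))
  have hY0 : Pre.Y g xc xc T = 0 := by simp [Pre.Y]
  have hne : Pre.Y g xc x T ≠ 0 := fun h0 => hx (h.Y_inj (h0.trans hY0.symm))
  have hlt : |Pre.Y g xc x T - 0| < δ := by
    rw [sub_zero]
    have := h.Y_up x T
    rw [lt_div_iff₀ (by linarith [h.hC])] at d1
    linarith [abs_nonneg (x - xc)]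
  have := hi _ hne hlt
  rw [h.Y_inj (hX (Pre.Y g xc x T) T), hU x ⟨by linarith, by linarith⟩ T ⟨hτT.le, le_rfl⟩] at this
  exact right_ne_zero_of_mul this

lemma degen (S : Sol x0 x1 t0 te u ux uxx ut a b c) {T p q xc : ℝ} (hT : T ∈ Ioc t0 te) (hp : x0 < p) (hpx : p < xc)
    (hxq : xc < q) (hq : q < x1) (hup : u p T ≠ 0) (huq : u q T ≠ 0) (h0 : u xc T = 0) (h1 : ux xc T = 0) :
    ∃ σ > 0, ∀ t ∈ Ioo (T - σ) T, t0 < t ∧ ∀ ς : ℝ, |ς| = 1 → (¬ ∀ x ∈ Icc p q, 0 ≤ ς * u x t) ∧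
      ∀ x' ∈ Ioo p q, ¬ ∀ x ∈ Icc p q, 0 ≤ ς * u x t * (x - x') := by
  obtain ⟨U, Ux, Uxx, Ut, g, gx, gt, τ, L, K, C, c0, h, hτ, hτT, N, hN, hU, hUp, hUq, hUx, cU, cUx⟩ := S.exists_pre hT hp hpx hxq hq hup huq
  choose X hX using fun y t => h.exists_X y t
  obtain ⟨L', K', C', hC⟩ := h.core hX
  have hY0 : ∀ t, Pre.Y g xc xc t = 0 := fun t => by simp [Pre.Y]
  have hX0 : ∀ t, X 0 t = xc := fun t => h.Y_inj ((hX 0 t).trans (hY0 t).symm)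
  have hUc : U xc T = 0 := by rw [hU xc ⟨hpx.le, hxq.le⟩ T ⟨hτT.le, le_rfl⟩, h0, mul_zero]
  rw [h1, mul_zero] at hUx
  have c0p := h.hc0
  have hC0 := h.hC
  obtain ⟨σ, hσ, hns⟩ := hC.nosign (by simpa only [hX0] using hUc) (C' := C / c0 ^ 2 + C) (σ := T - τ) (by linarith) (by
    intro s hs z
    have hb := h.degen_bound cU cUx hUc hUx (t := T - s) ⟨by linarith [hs.2], by linarith [hs.1]⟩ (X z (T - s))
    have hl := h.Y_low (X z (T - s)) xc (T - s)
    rw [hX, hY0, sub_zero] at hl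
    have hl2 : c0 ^ 2 * (X z (T - s) - xc) ^ 2 ≤ z ^ 2 := by
      rw [← sq_abs (X _ _ - _), ← sq_abs z, ← mul_pow]
      exact pow_le_pow_left₀ (by positivity) hl 2
    have hl3 : C * (X z (T - s) - xc) ^ 2 ≤ C / c0 ^ 2 * z ^ 2 := by
      calc _ = C / c0 ^ 2 * (c0 ^ 2 * (X z (T - s) - xc) ^ 2) := by field_simp
        _ ≤ _ := mul_le_mul_of_nonneg_left hl2 (by positivity)
    have hq1 : 0 ≤ C / c0 ^ 2 * s := mul_nonneg (by positivity) hs.1.le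
    have hq2 : 0 ≤ C * z ^ 2 := by positivity
    refine hb.trans ?_
    have : T - (T - s) = s := by ring
    rw [this]
    linarith)
  refine ⟨min σ (T - τ), lt_min hσ (by linarith), fun t ht => ?_⟩
  have ht1 : t ∈ Ioo (T - σ) T := ⟨by linarith [ht.1, min_le_left σ (T - τ)], ht.2⟩
  have ht2 : t ∈ Ioo τ T := ⟨by linarith [ht.1, min_le_right σ (T - τ)], ht.2⟩
  have ht3 : t ∈ Icc τ T := ⟨ht2.1.le, ht2.2.le⟩
  have key := hns t ht1
  have aux : ∀ ς U v : ℝ, 0 < U * v → 0 ≤ ς * v → 0 ≤ ς * U := by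
    intro ς U v h1 h2
    by_contra hc
    have hv : 0 < v ^ 2 := by
      have : v ≠ 0 := fun h => by simp [h] at h1
      positivity
    nlinarith [mul_nonneg h2 h1.le]
  refine ⟨by linarith [ht2.1], fun ς hς => ⟨fun hpos => ?_, fun x' hx' hpos => ?_⟩⟩
  · refine key ς 0 (by simp [hς]) fun z => ?_
    have hall : ∀ x, 0 ≤ ς * U x t := by
      intro x
      rcases le_or_gt x p with hx | hx
      · exact aux ς _ _ (hUp t ht3 x hx) (hpos p ⟨le_rfl, by linarith⟩)
      rcases le_or_gt q x with hx' | hx'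
      · exact aux ς _ _ (hUq t ht3 x hx') (hpos q ⟨by linarith, le_rfl⟩)
      · rw [hU x ⟨hx.le, hx'.le⟩ t ht3]
        have := mul_nonneg hN.le (hpos x ⟨hx.le, hx'.le⟩)
        linarith
    have := hall (X z t)
    simp only [zero_mul, add_zero]
    linarith
  · set z' := Pre.Y g xc x' t with hz'
    have hden : 0 < 1 + |z'| := by positivity
    refine key (-(ς * z') / (1 + |z'|)) (ς / (1 + |z'|)) ?_ fun z => ?_
    · rw [abs_div, abs_div, abs_neg, abs_mul, hς, abs_of_pos hden]
      field_simp; ring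
    have hall : ∀ x, 0 ≤ ς * U x t * (x - x') := by
      intro x
      rcases le_or_gt x p with hx | hx
      · have k := hpos p ⟨le_rfl, by linarith⟩
        have k2 : 0 ≤ -ς * u p t := by
          by_contra hc
          nlinarith [hx'.1]
        have := aux (-ς) _ _ (hUp t ht3 x hx) k2
        nlinarith [hx'.1]
      rcases le_or_gt q x with hx'' | hx''
      · have k := hpos q ⟨by linarith, le_rfl⟩
        have k2 : 0 ≤ ς * u q t := by
          by_contra hc
          nlinarith [hx'.2]
        have := aux ς _ _ (hUq t ht3 x hx'') k2
        exact mul_nonneg this (by linarith [hx'.2])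
      · rw [hU x ⟨hx.le, hx''.le⟩ t ht3]
        have := mul_nonneg hN.le (hpos x ⟨hx.le, hx''.le⟩)
        linarith
    have h3 := hall (X z t)
    have e : U (X z t) t * (-(ς * z') / (1 + |z'|) + ς / (1 + |z'|) * z) = ς * U (X z t) t * (z - z') / (1 + |z'|) := by
      field_simp; ring
    rw [e]
    refine div_nonneg ?_ hden.le
    have hm := h.Y_mono t
    have hXz := hX z t
    rcases lt_trichotomy (X z t) x' with hlt | heq | hgt
    · have := hm hlt
      simp only [hXz, ← hz'] at this
      have k : ς * U (X z t) t ≤ 0 := by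
        by_contra hc
        nlinarith
      nlinarith
    · rw [heq] at hXz
      rw [← hXz, ← hz', sub_self, mul_zero]
    · have := hm hgt
      simp only [hXz, ← hz'] at this
      have k : 0 ≤ ς * U (X z t) t := by
        by_contra hc
        nlinarith
      exact mul_nonneg k (by linarith)
end Sol

lemma sec_min {f f' : ℝ → ℝ} {f'' x : ℝ} (h1 : ∀ᶠ y in nhds x, HasDerivAt f (f' y) y) (h2 : HasDerivAt f' f'' x) (hm : IsLocalMin f x) :
    f' x = 0 ∧ 0 ≤ f'' := by
  have h0 : f' x = 0 := hm.hasDerivAt_eq_zero h1.self_of_nhds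
  refine ⟨h0, ?_⟩
  by_contra hc
  have e : deriv f =ᶠ[nhds x] f' := h1.mono fun y hy => hy.deriv
  have e2 : deriv (deriv f) x = f'' := by rw [e.deriv_eq, h2.deriv]
  have hM : IsLocalMax f x := isLocalMax_of_deriv_deriv_neg (by rw [e2]; exact not_le.1 hc) (by rw [h1.self_of_nhds.deriv, h0]) h1.self_of_nhds.continuousAt
  have ec : f =ᶠ[nhds x] fun _ => f x := by
    filter_upwards [hm, hM] with y hy1 hy2
    exact le_antisymm hy2 hy1
  have e3 : deriv (deriv f) x = 0 := by
    rw [(ec.deriv).deriv_eq]; simp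
  rw [e3] at e2
  exact hc e2.le

lemma left_deriv_nonpos {f : ℝ → ℝ} {f' t T : ℝ} (h : HasDerivAt f f' t) (hT : T < t) (hm : ∀ s ∈ Ioo T t, f t ≤ f s) : f' ≤ 0 := by
  have h1 := (hasDerivWithinAt_iff_tendsto_slope' (s := Iio t) (lt_irrefl t)).1 h.hasDerivWithinAt
  refine le_of_tendsto h1 ?_
  filter_upwards [Ioo_mem_nhdsLT hT] with s hs
  rw [slope_def_field]
  exact div_nonpos_of_nonneg_of_nonpos (sub_nonneg.2 (hm s hs)) (by linarith [hs.2])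

namespace Sol
variable {x0 x1 t0 te : ℝ} {u ux uxx ut a b c : ℝ → ℝ → ℝ}

lemma cbound (S : Sol x0 x1 t0 te u ux uxx ut a b c) : ∃ M ≥ 0, ∀ x ∈ Icc x0 x1, ∀ t ∈ Icc t0 te, |c x t| ≤ M := by
  obtain ⟨M, hM⟩ := (isCompact_Icc.prod isCompact_Icc).exists_bound_of_continuousOn S.cc
  exact ⟨max M 0, le_max_right _ _, fun x hx t ht => (hM (x, t) ⟨hx, ht⟩).trans (le_max_left _ _)⟩

lemma at_min (S : Sol x0 x1 t0 te u ux uxx ut a b c) {x t : ℝ} (hx : x ∈ Ioo x0 x1) (ht : t ∈ Ioc t0 te) (hm : IsLocalMin (fun x => u x t) x) :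
    ux x t = 0 ∧ c x t * u x t ≤ ut x t := by
  have := sec_min (f := fun x => u x t) (f' := fun x => ux x t) (by
    filter_upwards [isOpen_Ioo.mem_nhds hx] with y hy using S.dx y hy t ht) (S.dxx x hx t ht) hm
  refine ⟨this.1, ?_⟩
  rw [S.pde x hx t ht, this.1]
  have := mul_nonneg (S.apos x ⟨hx.1.le, hx.2.le⟩ t ⟨ht.1.le, ht.2⟩).le this.2
  linarith

lemma pos_forward (S : Sol x0 x1 t0 te u ux uxx ut a b c) {T p q e : ℝ} (hT : t0 < T) (hTe : T ≤ e) (he : e ≤ te) (hp : x0 < p) (hpq : p < q)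
    (hq : q < x1) (hup : ∀ t ∈ Icc T e, 0 < u p t) (huq : ∀ t ∈ Icc T e, 0 < u q t) (h0 : ∀ x ∈ Icc p q, 0 ≤ u x T) :
    ∀ t ∈ Icc T e, ∀ x ∈ Icc p q, 0 ≤ u x t := by
  obtain ⟨M, hM0, hM⟩ := S.cbound
  have hsub : Icc p q ×ˢ Icc T e ⊆ Icc x0 x1 ×ˢ Icc t0 te := prod_mono (Icc_subset_Icc hp.le hq.le) (Icc_subset_Icc hT.le he)
  have hc : ContinuousOn (fun z : ℝ × ℝ => exp (-(M + 1) * z.2) * u z.1 z.2) (Icc p q ×ˢ Icc T e) :=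
    ContinuousOn.mul (by fun_prop) (S.cu.mono hsub)
  obtain ⟨⟨x, t⟩, ⟨hx, ht⟩, hmin⟩ := (isCompact_Icc.prod isCompact_Icc).exists_isMinOn ⟨(p, T), ⟨⟨le_rfl, hpq.le⟩, ⟨le_rfl, hTe⟩⟩⟩ hc
  simp only at hx ht
  have hm : ∀ y ∈ Icc p q, ∀ s ∈ Icc T e, exp (-(M + 1) * t) * u x t ≤ exp (-(M + 1) * s) * u y s := fun y hy s hs => hmin (a := (y, s)) ⟨hy, hs⟩
  suffices 0 ≤ u x t by
    intro s hs y hy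
    have := (mul_nonneg (exp_pos _).le this).trans (hm y hy s hs)
    exact nonneg_of_mul_nonneg_right this (exp_pos _)
  by_contra hneg
  push Not at hneg
  have hxp : x ≠ p := fun h => by subst h; linarith [hup t ht]
  have hxq : x ≠ q := fun h => by subst h; linarith [huq t ht]
  have htT : t ≠ T := fun h => by subst h; linarith [h0 x hx]
  have hx' : x ∈ Ioo p q := ⟨lt_of_le_of_ne hx.1 hxp.symm, lt_of_le_of_ne hx.2 hxq⟩
  have hxx : x ∈ Ioo x0 x1 := ⟨by linarith [hx'.1], by linarith [hx'.2]⟩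
  have htT' : T < t := lt_of_le_of_ne ht.1 htT.symm
  have htt : t ∈ Ioc t0 te := ⟨by linarith, by linarith [ht.2]⟩
  have h1 := S.at_min hxx htt (by
    filter_upwards [isOpen_Ioo.mem_nhds hx'] with y hy
    exact le_of_mul_le_mul_left (hm y ⟨hy.1.le, hy.2.le⟩ t ht) (exp_pos _))
  have hd := (((hasDerivAt_id t).const_mul (-(M + 1))).exp).mul (S.dt x hxx t htt)
  have h2 := left_deriv_nonpos hd htT' (fun s hs => hm x hx s ⟨hs.1.le, by linarith [hs.2, ht.2]⟩)
  simp only [id, mul_one] at h2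
  have h3 : ut x t - (M + 1) * u x t ≤ 0 := by
    by_contra hc
    have := mul_pos (exp_pos (-(M + 1) * t)) (not_le.1 hc)
    linarith
  have h4 := le_abs_self (c x t)
  have h5 := hM x ⟨hxx.1.le, hxx.2.le⟩ t ⟨htt.1.le, htt.2⟩
  nlinarith [h1.2]

lemma prod_forward (S : Sol x0 x1 t0 te u ux uxx ut a b c) {T p q e : ℝ} (hT : t0 < T) (hTe : T ≤ e) (he : e ≤ te) (hp : x0 < p) (hpq : p < q)
    (hq : q < x1) (hup : ∀ t ∈ Icc T e, u p t < 0) (huq : ∀ t ∈ Icc T e, 0 < u q t)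
    (h0 : ∀ x ∈ Icc p q, ∀ y ∈ Icc p q, x ≤ y → 0 < u x T → 0 ≤ u y T) :
    ∀ t ∈ Icc T e, ∀ x ∈ Icc p q, ∀ y ∈ Icc p q, x ≤ y → 0 < u x t → 0 ≤ u y t := by
  obtain ⟨M, hM0, hM⟩ := S.cbound
  have hsub : Icc p q ×ˢ Icc T e ⊆ Icc x0 x1 ×ˢ Icc t0 te := prod_mono (Icc_subset_Icc hp.le hq.le) (Icc_subset_Icc hT.le he)
  set D : Set (ℝ × ℝ × ℝ) := (Icc p q ×ˢ (Icc p q ×ˢ Icc T e)) ∩ {z | z.1 ≤ z.2.1} with hD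
  have hDc : IsCompact D := (isCompact_Icc.prod (isCompact_Icc.prod isCompact_Icc)).inter_right (isClosed_le continuous_fst (continuous_fst.comp continuous_snd))
  set F : ℝ → ℝ → ℝ → ℝ := fun x y t => exp (-(2 * M + 1) * t) * (max (u x t) 0 * min (u y t) 0) with hF
  have hcu := S.cu.mono hsub
  have hc : ContinuousOn (fun z : ℝ × ℝ × ℝ => F z.1 z.2.1 z.2.2) D := by
    have k1 : ContinuousOn (fun z : ℝ × ℝ × ℝ => u z.1 z.2.2) D :=
      hcu.comp (f := fun z : ℝ × ℝ × ℝ => (z.1, z.2.2)) (by fun_prop) (fun z hz => ⟨hz.1.1, hz.1.2.2⟩)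
    have k2 : ContinuousOn (fun z : ℝ × ℝ × ℝ => u z.2.1 z.2.2) D :=
      hcu.comp (f := fun z : ℝ × ℝ × ℝ => (z.2.1, z.2.2)) (by fun_prop) (fun z hz => ⟨hz.1.2.1, hz.1.2.2⟩)
    exact ContinuousOn.mul (by fun_prop) ((k1.sup continuousOn_const).mul (k2.inf continuousOn_const))
  obtain ⟨⟨x, y, t⟩, ⟨⟨hx, hy, ht⟩, hxy⟩, hmin⟩ := hDc.exists_isMinOn ⟨(p, p, T), ⟨⟨⟨le_rfl, hpq.le⟩, ⟨le_rfl, hpq.le⟩, ⟨le_rfl, hTe⟩⟩, le_refl p⟩⟩ hc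
  simp only [mem_ofPred_eq] at hx hy ht hxy
  have hm : ∀ x' ∈ Icc p q, ∀ y' ∈ Icc p q, x' ≤ y' → ∀ s ∈ Icc T e, F x y t ≤ F x' y' s := fun x' hx' y' hy' hl s hs =>
    hmin (a := (x', y', s)) ⟨⟨hx', hy', hs⟩, hl⟩
  intro s hs x' hx' y' hy' hl hpos
  by_contra hneg
  push Not at hneg
  have hFn : F x y t < 0 := by
    refine (hm x' hx' y' hy' hl s hs).trans_lt ?_
    simp only [hF]
    rw [max_eq_left hpos.le, min_eq_left hneg.le]
    exact mul_neg_of_pos_of_neg (exp_pos _) (mul_neg_of_pos_of_neg hpos hneg)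
  have hux : 0 < u x t := by
    by_contra hcon
    simp only [hF] at hFn
    rw [max_eq_right (not_lt.1 hcon)] at hFn
    simp at hFn
  have huy : u y t < 0 := by
    by_contra hcon
    simp only [hF] at hFn
    rw [min_eq_right (not_lt.1 hcon)] at hFn
    simp at hFn
  have hle : ∀ x' ∈ Icc p q, ∀ y' ∈ Icc p q, x' ≤ y' → ∀ s ∈ Icc T e, 0 < u x' s → u y' s < 0 →
      exp (-(2 * M + 1) * t) * (u x t * u y t) ≤ exp (-(2 * M + 1) * s) * (u x' s * u y' s) := by
    intro x' hx' y' hy' hl s hs h1 h2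
    have := hm x' hx' y' hy' hl s hs
    simp only [hF] at this
    rwa [max_eq_left hux.le, min_eq_left huy.le, max_eq_left h1.le, min_eq_left h2.le] at this
  have hne : x ≠ y := fun h => by subst h; linarith
  have hlt : x < y := lt_of_le_of_ne hxy hne
  have hxp : x ≠ p := fun h => by subst h; linarith [hup t ht]
  have hyq : y ≠ q := fun h => by subst h; linarith [huq t ht]
  have htT : t ≠ T := fun h => by subst h; linarith [h0 x hx y hy hxy hux]
  have hx1 : p < x := lt_of_le_of_ne hx.1 hxp.symm
  have hy1 : y < q := lt_of_le_of_ne hy.2 hyq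
  have hxx : x ∈ Ioo x0 x1 := ⟨by linarith, by linarith⟩
  have hyy : y ∈ Ioo x0 x1 := ⟨by linarith, by linarith⟩
  have htT' : T < t := lt_of_le_of_ne ht.1 htT.symm
  have htt : t ∈ Ioc t0 te := ⟨by linarith, by linarith [ht.2]⟩
  have hy2 := S.at_min hyy htt (by
    filter_upwards [isOpen_Ioo.mem_nhds (show y ∈ Ioo x q from ⟨hlt, hy1⟩), (S.dx y hyy t htt).continuousAt.eventually (gt_mem_nhds huy)] with w hw hw2
    have := hle x hx w ⟨by linarith [hw.1], hw.2.le⟩ hw.1.le t ht hux hw2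
    exact le_of_mul_le_mul_left (le_of_mul_le_mul_left this (exp_pos _)) hux)
  have hx2 := S.neg.at_min hxx htt (by
    filter_upwards [isOpen_Ioo.mem_nhds (show x ∈ Ioo p y from ⟨hx1, hlt⟩), (S.dx x hxx t htt).continuousAt.eventually (lt_mem_nhds hux)] with w hw hw2
    have := le_of_mul_le_mul_left (hle w ⟨hw.1.le, by linarith [hw.2]⟩ y hy hw.2.le t ht hw2 huy) (exp_pos _)
    first | nlinarith only [this, huy] | nlinarith)
  have hd := (((hasDerivAt_id t).const_mul (-(2 * M + 1))).exp).mul ((S.dt x hxx t htt).mul (S.dt y hyy t htt))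
  have e1 : ∀ᶠ s in nhds t, 0 < u x s := (S.dt x hxx t htt).continuousAt.eventually (lt_mem_nhds hux)
  have e2 : ∀ᶠ s in nhds t, u y s < 0 := (S.dt y hyy t htt).continuousAt.eventually (gt_mem_nhds huy)
  obtain ⟨ε, hε, hεb⟩ := Metric.eventually_nhds_iff.1 (e1.and e2)
  have h2 := left_deriv_nonpos hd (T := max T (t - ε)) (max_lt htT' (by linarith)) (fun s hs => by
    have h3 := (le_max_left T (t - ε)).trans_lt hs.1
    have h4 := (le_max_right T (t - ε)).trans_lt hs.1
    have h5 := hεb (y := s) (by rw [dist_eq, abs_lt]; constructor <;> linarith [hs.2])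
    exact hle x hx y hy hxy s ⟨h3.le, by linarith [hs.2, ht.2]⟩ h5.1 h5.2)
  simp only [id, mul_one, Pi.mul_apply] at h2
  have h3 : ut x t * u y t + u x t * ut y t - (2 * M + 1) * (u x t * u y t) ≤ 0 := by
    by_contra hc
    have := mul_pos (exp_pos (-(2 * M + 1) * t)) (not_le.1 hc)
    linarith
  have i1 := (le_abs_self (c x t)).trans (hM x ⟨hxx.1.le, hxx.2.le⟩ t ⟨htt.1.le, htt.2⟩)
  have i2 := (le_abs_self (c y t)).trans (hM y ⟨hyy.1.le, hyy.2.le⟩ t ⟨htt.1.le, htt.2⟩)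
  have j1 : ut x t ≤ M * u x t := by nlinarith [hx2.2]
  have j2 : M * u y t ≤ ut y t := by nlinarith [hy2.2]
  have j3 := mul_le_mul_of_nonpos_right j1 huy.le
  have j4 := mul_le_mul_of_nonneg_left j2 hux.le
  have j5 := mul_neg_of_pos_of_neg hux huy
  linarith
end Sol

lemma no_zero_sign {f : ℝ → ℝ} {p q : ℝ} (hf : ContinuousOn f (Icc p q)) (hz : ∀ x ∈ Icc p q, f x ≠ 0) {x y : ℝ} (hx : x ∈ Icc p q) (hy : y ∈ Icc p q)
    (h : 0 < f x) : 0 < f y := by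
  by_contra hc
  have hc' : f y ≤ 0 := not_lt.1 hc
  have := isPreconnected_Icc.intermediate_value hy hx hf (show (0 : ℝ) ∈ Icc (f y) (f x) from ⟨hc', h.le⟩)
  obtain ⟨z, hz1, hz2⟩ := this
  exact hz z hz1 hz2

namespace Sol
variable {x0 x1 t0 te : ℝ} {u ux uxx ut a b c : ℝ → ℝ → ℝ}

lemma secc (S : Sol x0 x1 t0 te u ux uxx ut a b c) {t : ℝ} (ht : t ∈ Icc t0 te) : ContinuousOn (fun x => u x t) (Icc x0 x1) :=
  S.cu.comp (f := fun x : ℝ => (x, t)) (by fun_prop) (fun x hx => ⟨hx, ht⟩)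

lemma one_pp (S : Sol x0 x1 t0 te u ux uxx ut a b c) {T p q e : ℝ} (hT : t0 < T) (hTe : T < e) (he : e ≤ te) (hp : x0 < p) (hpq : p < q)
    (hq : q < x1) (hup : ∀ t ∈ Icc T e, 0 < u p t) (huq : ∀ t ∈ Icc T e, 0 < u q t) (h0 : ∀ x ∈ Icc p q, 0 ≤ u x T) :
    ∀ x ∈ Icc p q, u x e ≠ 0 := by
  have hf := S.pos_forward hT hTe.le he hp hpq hq hup huq h0
  intro x hx hxe
  have hee : e ∈ Icc T e := ⟨hTe.le, le_rfl⟩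
  have hxp : x ≠ p := fun h => by subst h; linarith [hup e hee]
  have hxq : x ≠ q := fun h => by subst h; linarith [huq e hee]
  have hx' : x ∈ Ioo p q := ⟨lt_of_le_of_ne hx.1 hxp.symm, lt_of_le_of_ne hx.2 hxq⟩
  have hxx : x ∈ Ioo x0 x1 := ⟨by linarith [hx'.1], by linarith [hx'.2]⟩
  have hem : e ∈ Ioc t0 te := ⟨by linarith, he⟩
  have hm := S.at_min hxx hem (by
    filter_upwards [isOpen_Ioo.mem_nhds hx'] with y hy
    rw [hxe]
    exact hf e hee y ⟨hy.1.le, hy.2.le⟩)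
  obtain ⟨σ, hσ, hd⟩ := S.degen hem hp hx'.1 hx'.2 hq (hup e hee).ne' (huq e hee).ne' hxe hm.1
  obtain ⟨s, hs1, hs2⟩ := exists_between (max_lt (show e - σ < e by linarith) hTe)
  have := ((hd s ⟨(le_max_left _ _).trans_lt hs1, hs2⟩).2 1 (by simp)).1
  refine this fun y hy => ?_
  rw [one_mul]
  exact hf s ⟨((le_max_right _ _).trans_lt hs1).le, hs2.le⟩ y hy

lemma one_np (S : Sol x0 x1 t0 te u ux uxx ut a b c) {T p q e : ℝ} (hT : t0 < T) (hTe : T < e) (he : e ≤ te) (hp : x0 < p) (hpq : p < q)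
    (hq : q < x1) (hup : ∀ t ∈ Icc T e, u p t < 0) (huq : ∀ t ∈ Icc T e, 0 < u q t)
    (h0 : ∀ x ∈ Icc p q, ∀ y ∈ Icc p q, x ≤ y → 0 < u x T → 0 ≤ u y T) :
    ∀ x ∈ Icc p q, ∀ y ∈ Icc p q, u x e = 0 → u y e = 0 → x < y → False := by
  have hf := S.prod_forward hT hTe.le he hp hpq hq hup huq h0
  have hee : e ∈ Icc T e := ⟨hTe.le, le_rfl⟩
  have hem : e ∈ Ioc t0 te := ⟨by linarith, he⟩
  have hI : ∀ x ∈ Icc p q, x ∈ Ioo x0 x1 := fun x hx => ⟨by linarith [hx.1], by linarith [hx.2]⟩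
  have hpm : p ∈ Icc p q := ⟨le_rfl, hpq.le⟩
  have hqm : q ∈ Icc p q := ⟨hpq.le, le_rfl⟩
  have inner : ∀ x ∈ Icc p q, u x e = 0 → x ∈ Ioo p q := by
    intro x hx hxe
    have hxp : x ≠ p := fun h => by subst h; linarith [hup e hee]
    have hxq : x ≠ q := fun h => by subst h; linarith [huq e hee]
    exact ⟨lt_of_le_of_ne hx.1 hxp.symm, lt_of_le_of_ne hx.2 hxq⟩
  have nd : ∀ x ∈ Ioo p q, u x e = 0 → ux x e ≠ 0 := by
    intro x hx' hxe hux
    obtain ⟨σ, hσ, hd⟩ := S.degen hem hp hx'.1 hx'.2 hq (hup e hee).ne (huq e hee).ne' hxe hux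
    obtain ⟨s, hs1, hs2⟩ := exists_between (max_lt (show e - σ < e by linarith) hTe)
    have hsT : s ∈ Icc T e := ⟨((le_max_right _ _).trans_lt hs1).le, hs2.le⟩
    have hsm : s ∈ Ioc t0 te := ⟨by linarith [hsT.1], by linarith⟩
    have hdd := ((hd s ⟨(le_max_left _ _).trans_lt hs1, hs2⟩).2 1 (by simp)).2
    have hfs := hf s hsT
    set P := {x ∈ Icc p q | 0 < u x s} with hP
    have hbd : BddBelow P := ⟨p, fun x hx => hx.1.1⟩
    obtain ⟨ε1, hε1, hb1⟩ := Metric.eventually_nhds_iff.1 ((S.dx p (hI p hpm) s hsm).continuousAt.eventually (gt_mem_nhds (hup s hsT)))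
    obtain ⟨ε2, hε2, hb2⟩ := Metric.eventually_nhds_iff.1 ((S.dx q (hI q hqm) s hsm).continuousAt.eventually (lt_mem_nhds (huq s hsT)))
    have hq' : max p (q - ε2 / 2) ∈ P := by
      refine ⟨⟨le_max_left _ _, max_le hpq.le (by linarith)⟩, hb2 ?_⟩
      rw [dist_eq, abs_lt]
      constructor
      · linarith [le_max_right p (q - ε2 / 2)]
      · linarith [max_le hpq.le (show q - ε2 / 2 ≤ q by linarith)]
    have hne : P.Nonempty := ⟨_, hq'⟩
    have l1 : sInf P < q := (csInf_le hbd hq').trans_lt (max_lt hpq (by linarith))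
    have l2 : p < sInf P := by
      refine (show p < p + ε1 by linarith).trans_le (le_csInf hne fun x hx => ?_)
      by_contra hc
      have := hb1 (y := x) (by rw [dist_eq, abs_lt]; constructor <;> linarith [hx.1.1])
      linarith [hx.2]
    refine hdd (sInf P) ⟨l2, l1⟩ fun y hy => ?_
    rw [one_mul]
    rcases lt_trichotomy y (sInf P) with h | h | h
    · have : u y s ≤ 0 := by
        by_contra hc
        have := csInf_le hbd (show y ∈ P from ⟨hy, not_le.1 hc⟩)
        linarith
      exact mul_nonneg_of_nonpos_of_nonpos this (by linarith)
    · rw [h]; simp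
    · obtain ⟨w, hw, hwy⟩ := exists_lt_of_csInf_lt hne h
      exact mul_nonneg (hfs w hw.1 y hy hwy.le hw.2) (by linarith)
  have key : ∀ x ∈ Ioo p q, u x e = 0 → 0 < ux x e := by
    intro x hx hxe
    by_contra hc
    have hlt : ux x e < 0 := lt_of_le_of_ne (not_lt.1 hc) (nd x hx hxe)
    have hd := S.dx x (hI x ⟨hx.1.le, hx.2.le⟩) e hem
    have hs := (hasDerivAt_iff_tendsto_slope.1 hd).eventually (gt_mem_nhds hlt)
    obtain ⟨ε, hε, hb⟩ := Metric.eventually_nhds_iff.1 (eventually_nhdsWithin_iff.1 hs)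
    set d := min (ε / 2) (min ((x - p) / 2) ((q - x) / 2)) with hdd
    have d1 : d ≤ ε / 2 := min_le_left _ _
    have d2 : d ≤ (x - p) / 2 := (min_le_right _ _).trans (min_le_left _ _)
    have d3 : d ≤ (q - x) / 2 := (min_le_right _ _).trans (min_le_right _ _)
    have d0 : 0 < d := lt_min (by linarith) (lt_min (by linarith [hx.1]) (by linarith [hx.2]))
    have k1 := hb (y := x - d) (by rw [dist_eq, abs_lt]; constructor <;> linarith) (by simp [d0.ne'])
    have k2 := hb (y := x + d) (by rw [dist_eq, abs_lt]; constructor <;> linarith) (by simp [d0.ne'])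
    rw [slope_def_field, hxe] at k1 k2
    have g1 : 0 < u (x - d) e := by
      by_contra hcon
      have : 0 ≤ (u (x - d) e - 0) / (x - d - x) := div_nonneg_of_nonpos (by linarith) (by linarith)
      linarith
    have g2 : u (x + d) e < 0 := by
      by_contra hcon
      have : 0 ≤ (u (x + d) e - 0) / (x + d - x) := div_nonneg (by linarith) (by linarith)
      linarith
    have := hf e hee (x - d) ⟨by linarith, by linarith⟩ (x + d) ⟨by linarith, by linarith⟩ (by linarith) g1
    linarith
  intro x hx y hy hxe hye hxy
  have hx' := inner x hx hxe
  have hy' := inner y hy hye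
  have kx := key x hx' hxe
  have ky := key y hy' hye
  have sx := (hasDerivAt_iff_tendsto_slope.1 (S.dx x (hI x hx) e hem)).eventually (lt_mem_nhds kx)
  have sy := (hasDerivAt_iff_tendsto_slope.1 (S.dx y (hI y hy) e hem)).eventually (lt_mem_nhds ky)
  obtain ⟨ε1, hε1, hb1⟩ := Metric.eventually_nhds_iff.1 (eventually_nhdsWithin_iff.1 sx)
  obtain ⟨ε2, hε2, hb2⟩ := Metric.eventually_nhds_iff.1 (eventually_nhdsWithin_iff.1 sy)
  set d := min (ε1 / 2) (min (ε2 / 2) ((y - x) / 2)) with hdd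
  have d1 : d ≤ ε1 / 2 := min_le_left _ _
  have d2 : d ≤ ε2 / 2 := (min_le_right _ _).trans (min_le_left _ _)
  have d3 : d ≤ (y - x) / 2 := (min_le_right _ _).trans (min_le_right _ _)
  have d0 : 0 < d := lt_min (by linarith) (lt_min (by linarith) (by linarith))
  have k1 := hb1 (y := x + d) (by rw [dist_eq, abs_lt]; constructor <;> linarith) (by simp [d0.ne'])
  have k2 := hb2 (y := y - d) (by rw [dist_eq, abs_lt]; constructor <;> linarith) (by simp [d0.ne'])
  rw [slope_def_field, hxe] at k1
  rw [slope_def_field, hye] at k2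
  have g1 : 0 < u (x + d) e := by
    by_contra hcon
    have : (u (x + d) e - 0) / (x + d - x) ≤ 0 := div_nonpos_of_nonpos_of_nonneg (by linarith) (by linarith)
    linarith
  have g2 : u (y - d) e < 0 := by
    by_contra hcon
    have : (u (y - d) e - 0) / (y - d - y) ≤ 0 := div_nonpos_of_nonneg_of_nonpos (by linarith) (by linarith)
    linarith
  have := hf e hee (x + d) ⟨by linarith [hx.1], by linarith [hy.2]⟩ (y - d) ⟨by linarith [hx.1], by linarith [hy.2]⟩ (by linarith) g1
  linarith

lemma one_aux (S : Sol x0 x1 t0 te u ux uxx ut a b c) {T p q e xc : ℝ} (hT : t0 < T) (hTe : T < e) (he : e ≤ te) (hp : x0 < p) (hpq : p < q)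
    (hq : q < x1) (hup : ∀ t ∈ Icc T e, 0 < u p t * u p T) (huq : ∀ t ∈ Icc T e, 0 < u q t * u q T) (hxc : xc ∈ Ioo p q)
    (h0 : ∀ x ∈ Icc p q, u x T = 0 → x = xc) (hqpos : 0 < u q T) :
    ∀ x ∈ Icc p q, ∀ y ∈ Icc p q, u x e = 0 → u y e = 0 → x < y → False := by
  have hTT : T ∈ Icc T e := ⟨le_rfl, hTe.le⟩
  have hq' : ∀ t ∈ Icc T e, 0 < u q t := fun t ht => pos_of_mul_pos_left (huq t ht) hqpos.le
  have hc := (S.secc (t := T) ⟨hT.le, by linarith⟩).mono (Icc_subset_Icc hp.le hq.le)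
  have hr : ∀ y ∈ Icc p q, xc < y → 0 < u y T := by
    intro y hy hxy
    refine no_zero_sign (hc.mono (Icc_subset_Icc hy.1 le_rfl)) (fun x hx hx0 => ?_) (right_mem_Icc.2 hy.2) (left_mem_Icc.2 hy.2) hqpos
    have := h0 x ⟨hy.1.trans hx.1, hx.2⟩ hx0
    linarith [hx.1]
  have hxc0 : 0 ≤ u xc T := by
    by_contra hcon
    have hcon' := not_le.1 hcon
    have := isPreconnected_Icc.intermediate_value (show xc ∈ Icc xc q from ⟨le_rfl, hxc.2.le⟩) ⟨hxc.2.le, le_rfl⟩ (hc.mono (Icc_subset_Icc hxc.1.le le_rfl))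
      (show (0 : ℝ) ∈ Icc (u xc T) (u q T) from ⟨hcon'.le, hqpos.le⟩)
    obtain ⟨z, hz1, hz2⟩ := this
    have := h0 z ⟨hxc.1.le.trans hz1.1, hz1.2⟩ hz2
    subst this
    have h3 : u z T = 0 := hz2
    linarith
  rcases lt_trichotomy (u p T) 0 with hpn | hpn | hpn
  · refine S.one_np hT hTe he hp hpq hq (fun t ht => ?_) hq' ?_
    · have := hup t ht
      by_contra hcon
      nlinarith
    · intro x hx y hy hxy hxp
      rcases lt_trichotomy x xc with h | h | h
      · exfalso
        have := isPreconnected_Icc.intermediate_value (show p ∈ Icc p x from ⟨le_rfl, hx.1⟩) ⟨hx.1, le_rfl⟩ (hc.mono (Icc_subset_Icc le_rfl hx.2))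
          (show (0 : ℝ) ∈ Icc (u p T) (u x T) from ⟨hpn.le, hxp.le⟩)
        obtain ⟨z, hz1, hz2⟩ := this
        have := h0 z ⟨hz1.1, hz1.2.trans hx.2⟩ hz2
        linarith [hz1.2]
      · rcases hxy.eq_or_lt with h2 | h2
        · rw [← h2]; exact hxp.le
        · exact (hr y hy (h ▸ h2)).le
      · exact (hr y hy (h.trans_le hxy)).le
  · have := hup T hTT
    simp [hpn] at this
  · intro x hx y hy hxe _ _
    refine S.one_pp hT hTe he hp hpq hq (fun t ht => pos_of_mul_pos_left (hup t ht) hpn.le) hq' ?_ x hx hxe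
    intro x hx
    rcases lt_trichotomy x xc with h | h | h
    · refine (no_zero_sign (hc.mono (Icc_subset_Icc le_rfl hx.2)) (fun z hz hz0 => ?_) (left_mem_Icc.2 hx.1) (right_mem_Icc.2 hx.1) hpn).le
      have := h0 z ⟨hz.1, hz.2.trans hx.2⟩ hz0
      linarith [hz.2]
    · rw [h]; exact hxc0
    · exact (hr x hx h).le

lemma one (S : Sol x0 x1 t0 te u ux uxx ut a b c) {T p q e xc : ℝ} (hT : t0 < T) (hTe : T < e) (he : e ≤ te) (hp : x0 < p) (hpq : p < q)
    (hq : q < x1) (hup : ∀ t ∈ Icc T e, 0 < u p t * u p T) (huq : ∀ t ∈ Icc T e, 0 < u q t * u q T) (hxc : xc ∈ Ioo p q)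
    (h0 : ∀ x ∈ Icc p q, u x T = 0 → x = xc) :
    ∀ x ∈ Icc p q, ∀ y ∈ Icc p q, u x e = 0 → u y e = 0 → x = y := by
  have main : ∀ x ∈ Icc p q, ∀ y ∈ Icc p q, u x e = 0 → u y e = 0 → x < y → False := by
    rcases lt_trichotomy (u q T) 0 with h | h | h
    · have := S.neg.one_aux (xc := xc) hT hTe he hp hpq hq (fun t ht => by simpa using hup t ht) (fun t ht => by simpa using huq t ht) hxc
        (fun x hx hx0 => h0 x hx (by simpa using hx0)) (by simpa using h)
      intro x hx y hy hxe hye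
      exact this x hx y hy (by simpa using hxe) (by simpa using hye)
    · have := huq T ⟨le_rfl, hTe.le⟩
      simp [h] at this
    · exact S.one_aux hT hTe he hp hpq hq hup huq hxc h0 h
  intro x hx y hy hxe hye
  rcases lt_trichotomy x y with h | h | h
  · exact (main x hx y hy hxe hye h).elim
  · exact h
  · exact (main y hy x hx hye hxe h).elim
end Sol

lemma z_anti {t0 te : ℝ} {z : ℝ → ℕ} (hb : ∀ T ∈ Ioc t0 te, ∀ᶠ t in nhdsWithin T (Iio T), z T ≤ z t)
    (hf : ∀ T ∈ Ioo t0 te, ∀ᶠ t in nhdsWithin T (Ioi T), z t ≤ z T) {s e : ℝ} (hs : t0 < s) (hse : s ≤ e) (he : e ≤ te) : z e ≤ z s := by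
  set A := {t ∈ Icc s e | ∀ t' ∈ Icc s t, z t' ≤ z s} with hA
  have hsA : s ∈ A := ⟨⟨le_rfl, hse⟩, fun t' ht' => by rw [le_antisymm ht'.2 ht'.1]⟩
  have hbd : BddAbove A := ⟨e, fun t ht => ht.1.2⟩
  set m := sSup A with hm
  have hsm : s ≤ m := le_csSup hbd hsA
  have hme : m ≤ e := csSup_le ⟨s, hsA⟩ fun t ht => ht.1.2
  have hlt : ∀ t' ∈ Ico s m, z t' ≤ z s := by
    intro t' ht'
    obtain ⟨w, hw, hw'⟩ := exists_lt_of_lt_csSup ⟨s, hsA⟩ ht'.2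
    exact hw.2 t' ⟨ht'.1, hw'.le⟩
  have hzm : z m ≤ z s := by
    rcases hsm.eq_or_lt with h | h
    · rw [← h]
    · have h1 := hb m ⟨by linarith, by linarith⟩
      obtain ⟨t, ht1, ht2⟩ := (h1.and (Ioo_mem_nhdsLT h)).exists
      exact ht1.trans (hlt t ⟨ht2.1.le, ht2.2⟩)
  rcases hme.eq_or_lt with h | h
  · rw [← h]; exact hzm
  exfalso
  have h1 := hf m ⟨by linarith, by linarith⟩
  obtain ⟨w, hw, hwb⟩ := (mem_nhdsGT_iff_exists_Ioo_subset' h).1 h1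
  obtain ⟨v, hv1, hv2⟩ := exists_between (lt_min hw h)
  have : v ∈ A := by
    refine ⟨⟨by linarith, (hv2.trans_le (min_le_right _ _)).le⟩, fun t' ht' => ?_⟩
    rcases lt_trichotomy t' m with h2 | h2 | h2
    · exact hlt t' ⟨ht'.1, h2⟩
    · rw [h2]; exact hzm
    · have : z t' ≤ z m := hwb ⟨h2, ht'.2.trans_lt (hv2.trans_le (min_le_left _ _))⟩
      exact this.trans hzm
  have := le_csSup hbd this
  linarith

lemma two_zeros {f : ℝ → ℝ} {p q : ℝ} (hpq : p < q) (hf : ContinuousOn f (Icc p q)) (hp : f p ≠ 0) (hq : f q ≠ 0)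
    (H : ∀ ς : ℝ, |ς| = 1 → (¬ ∀ x ∈ Icc p q, 0 ≤ ς * f x) ∧ ∀ x' ∈ Ioo p q, ¬ ∀ x ∈ Icc p q, 0 ≤ ς * f x * (x - x')) :
    ∃ y ∈ Icc p q, f y = 0 ∧ ∃ y' ∈ Icc p q, y' ≠ y ∧ f y' = 0 := by
  have h1 := (H 1 (by simp)).1
  have h2 := (H (-1) (by simp)).1
  push Not at h1 h2
  obtain ⟨a, ha, ha'⟩ := h1
  obtain ⟨b, hb, hb'⟩ := h2
  obtain ⟨y, hy, hy0⟩ := isPreconnected_Icc.intermediate_value ha hb hf (show (0 : ℝ) ∈ Icc (f a) (f b) from ⟨by linarith, by linarith⟩)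
  refine ⟨y, hy, hy0, ?_⟩
  by_contra hcon
  push Not at hcon
  have hyp : y ≠ p := fun h => hp (h ▸ hy0)
  have hyq : y ≠ q := fun h => hq (h ▸ hy0)
  have hy' : y ∈ Ioo p q := ⟨lt_of_le_of_ne hy.1 hyp.symm, lt_of_le_of_ne hy.2 hyq⟩
  have sg : ∀ v : ℝ, v ≠ 0 → ∃ ς : ℝ, |ς| = 1 ∧ 0 < ς * v := by
    intro v hv
    rcases lt_or_gt_of_ne hv with h | h
    · exact ⟨-1, by simp, by linarith⟩
    · exact ⟨1, by simp, by linarith⟩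
  obtain ⟨ς, hς, hςq⟩ := sg (f q) hq
  have hςn : ς ≠ 0 := fun h => by simp [h] at hς
  have hr : ∀ x ∈ Icc p q, y < x → 0 < ς * f x := by
    intro x hx hyx
    refine no_zero_sign (f := fun x => ς * f x) ((continuousOn_const.mul hf).mono (Icc_subset_Icc hx.1 le_rfl)) (fun z hz hz0 => ?_)
      (right_mem_Icc.2 hx.2) (left_mem_Icc.2 hx.2) hςq
    exact hcon z ⟨hx.1.trans hz.1, hz.2⟩ (by linarith [hz.1]) ((mul_eq_zero.1 hz0).resolve_left hςn)
  obtain ⟨ς', hς', hςp⟩ := sg (f p) hp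
  have hςn' : ς' ≠ 0 := fun h => by simp [h] at hς'
  have hl : ∀ x ∈ Icc p q, x < y → 0 < ς' * f x := by
    intro x hx hyx
    refine no_zero_sign (f := fun x => ς' * f x) ((continuousOn_const.mul hf).mono (Icc_subset_Icc le_rfl hx.2)) (fun z hz hz0 => ?_)
      (left_mem_Icc.2 hx.1) (right_mem_Icc.2 hx.1) hςp
    exact hcon z ⟨hz.1, hz.2.trans hx.2⟩ (by linarith [hz.2]) ((mul_eq_zero.1 hz0).resolve_left hςn')
  have hor : ς' = ς ∨ ς' = -ς := abs_eq_abs.1 (hς'.trans hς.symm)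
  rcases hor with h | h
  · refine (H ς hς).1 fun x hx => ?_
    rcases lt_trichotomy x y with h3 | h3 | h3
    · rw [← h]; exact (hl x hx h3).le
    · rw [h3, hy0, mul_zero]
    · exact (hr x hx h3).le
  · refine (H ς hς).2 y hy' fun x hx => ?_
    rcases lt_trichotomy x y with h3 | h3 | h3
    · have := hl x hx h3
      rw [h] at this
      exact mul_nonneg_of_nonpos_of_nonpos (by linarith) (by linarith)
    · rw [h3, hy0, mul_zero, zero_mul]
    · exact mul_nonneg (hr x hx h3).le (by linarith)

namespace Sol
variable {x0 x1 t0 te : ℝ} {u ux uxx ut a b c : ℝ → ℝ → ℝ}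

lemma unif (S : Sol x0 x1 t0 te u ux uxx ut a b c) {T : ℝ} (hT : T ∈ Icc t0 te) {K : Set ℝ} (hK : IsCompact K) (hKs : K ⊆ Icc x0 x1)
    (h0 : ∀ x ∈ K, u x T ≠ 0) : ∃ η > 0, ∀ t ∈ Icc t0 te, |t - T| < η → ∀ x ∈ K, 0 < u x t * u x T := by
  rcases K.eq_empty_or_nonempty with rfl | hne
  · exact ⟨1, one_pos, by simp⟩
  obtain ⟨x', hx', hmin⟩ := hK.exists_isMinOn hne (((S.secc hT).mono hKs).abs)
  have hm : 0 < |u x' T| := abs_pos.2 (h0 x' hx')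
  have huc := (isCompact_Icc.prod isCompact_Icc).uniformContinuousOn_of_continuous S.cu
  obtain ⟨η, hη, hb⟩ := Metric.uniformContinuousOn_iff.1 huc _ hm
  refine ⟨η, hη, fun t ht htT x hx => ?_⟩
  have h1 := hb (x, t) ⟨hKs hx, ht⟩ (x, T) ⟨hKs hx, hT⟩ (by
    rw [Prod.dist_eq]
    refine max_lt (by simpa using hη) (by simpa [dist_eq] using htT))
  rw [dist_eq] at h1
  have h2 : |u x' T| ≤ |u x T| := hmin hx
  have h3 : |u x t - u x T| < |u x T| := h1.trans_le h2
  have e : u x t * u x T = (u x t - u x T) * u x T + |u x T| ^ 2 := by rw [sq_abs]; ring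
  have := neg_abs_le ((u x t - u x T) * u x T)
  rw [abs_mul] at this
  nlinarith [abs_nonneg (u x t - u x T)]

lemma iso_all (S : Sol x0 x1 t0 te u ux uxx ut a b c) {T : ℝ} (hT : T ∈ Ioc t0 te) (hx : x0 < x1) (hl : u x0 T ≠ 0) (hr : u x1 T ≠ 0) :
    ∀ xc ∈ Icc x0 x1, ∃ δ > 0, ∀ x ∈ Icc x0 x1, x ≠ xc → |x - xc| < δ → u x T ≠ 0 := by
  have hc := S.secc (t := T) ⟨hT.1.le, hT.2⟩
  have nz : ∀ w ∈ Icc x0 x1, u w T ≠ 0 → ∃ δ > 0, ∀ x ∈ Icc x0 x1, |x - w| < δ → u x T ≠ 0 := by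
    intro w hw hw0
    have := (hc w hw).eventually_ne hw0
    obtain ⟨δ, hδ, hb⟩ := Metric.eventually_nhds_iff.1 (eventually_nhdsWithin_iff.1 this)
    exact ⟨δ, hδ, fun x hx hxd => hb (by rwa [dist_eq]) hx⟩
  intro xc hxc
  by_cases hz : u xc T = 0
  · have h1 : xc ≠ x0 := fun h => hl (h ▸ hz)
    have h2 : xc ≠ x1 := fun h => hr (h ▸ hz)
    have hxc' : xc ∈ Ioo x0 x1 := ⟨lt_of_le_of_ne hxc.1 h1.symm, lt_of_le_of_ne hxc.2 h2⟩
    obtain ⟨d1, hd1, hb1⟩ := nz x0 ⟨le_rfl, hx.le⟩ hl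
    obtain ⟨d2, hd2, hb2⟩ := nz x1 ⟨hx.le, le_rfl⟩ hr
    obtain ⟨p, hp1, hp2⟩ := exists_between (lt_min hxc'.1 (show x0 < x0 + d1 by linarith))
    obtain ⟨q, hq1, hq2⟩ := exists_between (max_lt hxc'.2 (show x1 - d2 < x1 by linarith))
    have hp3 := hp2.trans_le (min_le_left _ _)
    have hp4 := hp2.trans_le (min_le_right _ _)
    have hq3 := (le_max_left _ _).trans_lt hq1
    have hq4 := (le_max_right _ _).trans_lt hq1
    obtain ⟨δ, hδ, hb⟩ := S.isolated hT hp1 hp3 hq3 hq2 (hb1 p ⟨by linarith, by linarith⟩ (by rw [abs_lt]; constructor <;> linarith))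
      (hb2 q ⟨by linarith, by linarith⟩ (by rw [abs_lt]; constructor <;> linarith))
    exact ⟨δ, hδ, fun x _ hne hd => hb x hne hd⟩
  · obtain ⟨δ, hδ, hb⟩ := nz xc hxc hz
    exact ⟨δ, hδ, fun x hx _ hd => hb x hx hd⟩

lemma finZ (S : Sol x0 x1 t0 te u ux uxx ut a b c) {T : ℝ} (hT : T ∈ Ioc t0 te) (hx : x0 < x1) (hl : u x0 T ≠ 0) (hr : u x1 T ≠ 0) :
    {x ∈ Icc x0 x1 | u x T = 0}.Finite := by
  by_contra hinf
  obtain ⟨xc, hxc, hacc⟩ := Set.Infinite.exists_accPt_of_subset_isCompact hinf isCompact_Icc (fun x hx => hx.1)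
  obtain ⟨δ, hδ, hb⟩ := S.iso_all hT hx hl hr xc hxc
  rw [accPt_iff_frequently] at hacc
  obtain ⟨y, ⟨hy1, hy2⟩, hy3⟩ := (hacc.and_eventually (Metric.ball_mem_nhds xc hδ)).exists
  exact hb y hy2.1 hy1 (by simpa [dist_eq] using hy3) hy2.2

lemma back_one (S : Sol x0 x1 t0 te u ux uxx ut a b c) {T p q xc : ℝ} (hT : T ∈ Ioc t0 te) (hp : x0 < p) (hpx : p < xc)
    (hxq : xc < q) (hq : q < x1) (hup : u p T ≠ 0) (huq : u q T ≠ 0) (h0 : u xc T = 0) :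
    ∀ᶠ t in nhdsWithin T (Iio T), ∃ y ∈ Icc p q, u y t = 0 ∧ (ux xc T = 0 → ∃ y' ∈ Icc p q, y' ≠ y ∧ u y' t = 0) := by
  have hTm : T ∈ Icc t0 te := ⟨hT.1.le, hT.2⟩
  by_cases hd : ux xc T = 0
  · obtain ⟨σ, hσ, hds⟩ := S.degen hT hp hpx hxq hq hup huq h0 hd
    obtain ⟨η, hη, hu⟩ := S.unif hTm (K := {p, q}) (Set.toFinite _).isCompact
      (by rintro x (rfl | rfl) <;> constructor <;> linarith) (by rintro x (rfl | rfl) <;> assumption)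
    filter_upwards [Ioo_mem_nhdsLT (show T - σ < T by linarith), Ioo_mem_nhdsLT (show T - η < T by linarith)] with t h1 h2
    have h3 := hds t h1
    have htm : t ∈ Icc t0 te := ⟨h3.1.le, by linarith [h1.2, hT.2]⟩
    have h4 := hu t htm (by rw [abs_lt]; constructor <;> linarith [h2.1, h2.2])
    obtain ⟨y, hy, hy0, y', hy', hne, hy0'⟩ := two_zeros (f := fun x => u x t) (hpx.trans hxq) ((S.secc htm).mono (Icc_subset_Icc hp.le hq.le))
      (left_ne_zero_of_mul (h4 p (by simp)).ne') (left_ne_zero_of_mul (h4 q (by simp)).ne') h3.2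
    exact ⟨y, hy, hy0, fun _ => ⟨y', hy', hne, hy0'⟩⟩
  · have hs := (hasDerivAt_iff_tendsto_slope.1 (S.dx xc ⟨by linarith, by linarith⟩ T hT)).eventually_ne hd
    have hder := S.dx xc ⟨by linarith, by linarith⟩ T hT
    have hs2 : ∀ᶠ y in nhdsWithin xc {xc}ᶜ, 0 < slope (fun x => u x T) xc y * ux xc T :=
      ((hasDerivAt_iff_tendsto_slope.1 hder).mul_const (ux xc T)).eventually (lt_mem_nhds (mul_self_pos.2 hd))
    obtain ⟨ε, hε, hb⟩ := Metric.eventually_nhds_iff.1 (eventually_nhdsWithin_iff.1 hs2)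
    set d := min (ε / 2) (min ((xc - p) / 2) ((q - xc) / 2)) with hdd
    have d1 : d ≤ ε / 2 := min_le_left _ _
    have d2 : d ≤ (xc - p) / 2 := (min_le_right _ _).trans (min_le_left _ _)
    have d3 : d ≤ (q - xc) / 2 := (min_le_right _ _).trans (min_le_right _ _)
    have d0 : 0 < d := lt_min (by linarith) (lt_min (by linarith) (by linarith))
    have k1 := hb (y := xc - d) (by rw [dist_eq, abs_lt]; constructor <;> linarith) (by simp [d0.ne'])
    have k2 := hb (y := xc + d) (by rw [dist_eq, abs_lt]; constructor <;> linarith) (by simp [d0.ne'])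
    rw [slope_def_field, h0] at k1 k2
    have e1 : u (xc - d) T * ux xc T < 0 := by
      have : (u (xc - d) T - 0) / (xc - d - xc) * ux xc T * d = -(u (xc - d) T * ux xc T) := by
        have : xc - d - xc = -d := by ring
        rw [this]; field_simp; ring
      have := mul_pos k1 d0
      linarith
    have e2 : 0 < u (xc + d) T * ux xc T := by
      have : (u (xc + d) T - 0) / (xc + d - xc) * ux xc T * d = (u (xc + d) T * ux xc T) := by
        have : xc + d - xc = d := by ring
        rw [this]; field_simp; ring
      have := mul_pos k2 d0
      linarith
    obtain ⟨η, hη, hu⟩ := S.unif hTm (K := {xc - d, xc + d}) (Set.toFinite _).isCompact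
      (by rintro x (rfl | rfl) <;> constructor <;> linarith)
      (by rintro x (rfl | rfl)
          · exact left_ne_zero_of_mul e1.ne
          · exact left_ne_zero_of_mul e2.ne')
    filter_upwards [Ioo_mem_nhdsLT hT.1, Ioo_mem_nhdsLT (show T - η < T by linarith)] with t h1 h2
    have htm : t ∈ Icc t0 te := ⟨h1.1.le, by linarith [h1.2, hT.2]⟩
    have h4 := hu t htm (by rw [abs_lt]; constructor <;> linarith [h2.1, h2.2])
    have f1 := h4 (xc - d) (by simp)
    have f2 := h4 (xc + d) (by simp)
    have g1 : u (xc - d) t * ux xc T < 0 := by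
      by_contra hcon
      linarith [mul_nonneg (not_lt.1 hcon) f1.le, mul_neg_of_pos_of_neg f1 e1, sq_nonneg (u (xc - d) t), sq_pos_of_ne_zero hd,
        mul_pos f1 f1, mul_nonneg (not_lt.1 hcon) (neg_pos.2 e1).le, mul_pos f1 (sq_pos_of_ne_zero hd)]
    have g2 : 0 < u (xc + d) t * ux xc T := by
      by_contra hcon
      linarith [mul_nonneg (neg_nonneg.2 (not_lt.1 hcon)) e2.le, mul_pos f2 (sq_pos_of_ne_zero hd)]
    have hcc : ContinuousOn (fun x => u x t * ux xc T) (Icc p q) := ((S.secc htm).mono (Icc_subset_Icc hp.le hq.le)).mul continuousOn_const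
    obtain ⟨y, hy, hy0⟩ := isPreconnected_Icc.intermediate_value (show xc - d ∈ Icc p q from ⟨by linarith, by linarith⟩)
      (show xc + d ∈ Icc p q from ⟨by linarith, by linarith⟩) hcc (show (0 : ℝ) ∈ Icc _ _ from ⟨g1.le, g2.le⟩)
    exact ⟨y, hy, (mul_eq_zero.1 hy0).resolve_right hd, fun h => (hd h).elim⟩

lemma sep (S : Sol x0 x1 t0 te u ux uxx ut a b c) {T : ℝ} (hT : T ∈ Ioc t0 te) (hx : x0 < x1) (hl : u x0 T ≠ 0) (hr : u x1 T ≠ 0) :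
    ∃ ρ > 0, ∀ x ∈ {x ∈ Icc x0 x1 | u x T = 0}, x0 < x - ρ ∧ x + ρ < x1 ∧ ∀ y ∈ {x ∈ Icc x0 x1 | u x T = 0}, y ≠ x → 2 * ρ < |y - x| := by
  set F := {x ∈ Icc x0 x1 | u x T = 0} ∪ {x0, x1} with hF
  have hfin : F.Finite := (S.finZ hT hx hl hr).union (Set.toFinite _)
  have h0 : x0 ∈ F := Or.inr (by simp)
  have h1 : x1 ∈ F := Or.inr (by simp)
  have hpos : 0 < F.infsep := (hfin.infsep_pos_iff_nontrivial).2 ⟨x0, h0, x1, h1, hx.ne⟩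
  have hd : ∀ x ∈ F, ∀ y ∈ F, y ≠ x → 2 * (F.infsep / 3) < |y - x| := by
    intro x hx y hy hne
    have := Set.infsep_le_dist_of_mem hy hx hne
    rw [dist_eq] at this
    linarith
  refine ⟨F.infsep / 3, by positivity, fun x hxm => ⟨?_, ?_, fun y hy hne => hd x (Or.inl hxm) y (Or.inl hy) hne⟩⟩
  · have := hd x (Or.inl hxm) x0 h0 (fun h => hl (h ▸ hxm.2))
    rw [abs_sub_comm, abs_of_nonneg (sub_nonneg.2 hxm.1.1)] at this
    linarith
  · have := hd x (Or.inl hxm) x1 h1 (fun h => hr (h ▸ hxm.2))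
    rw [abs_of_nonneg (sub_nonneg.2 hxm.1.2)] at this
    linarith
end Sol
namespace Sol
variable {x0 x1 t0 te : ℝ} {u ux uxx ut a b c : ℝ → ℝ → ℝ}

lemma backward (S : Sol x0 x1 t0 te u ux uxx ut a b c) (hx : x0 < x1) (hbd : ∀ t ∈ Icc t0 te, u x0 t ≠ 0 ∧ u x1 t ≠ 0) {T : ℝ} (hT : T ∈ Ioc t0 te) :
    ∀ᶠ t in nhdsWithin T (Iio T), {x ∈ Icc x0 x1 | u x T = 0}.ncard ≤ {x ∈ Icc x0 x1 | u x t = 0}.ncard ∧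
      ∀ xc ∈ Icc x0 x1, u xc T = 0 → ux xc T = 0 → {x ∈ Icc x0 x1 | u x T = 0}.ncard < {x ∈ Icc x0 x1 | u x t = 0}.ncard := by
  have hTm : T ∈ Icc t0 te := ⟨hT.1.le, hT.2⟩
  obtain ⟨hl, hr⟩ := hbd T hTm
  have hfin := S.finZ hT hx hl hr
  obtain ⟨ρ, hρ, hsep⟩ := S.sep hT hx hl hr
  set F := {x ∈ Icc x0 x1 | u x T = 0} with hF
  have hnz : ∀ x ∈ F, ∀ w ∈ Icc x0 x1, w ≠ x → |w - x| ≤ 2 * ρ → u w T ≠ 0 := by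
    intro x hxm w hw hne hle h0
    have := (hsep x hxm).2.2 w ⟨hw, h0⟩ hne
    linarith
  have hall : ∀ᶠ t in nhdsWithin T (Iio T), ∀ x ∈ F, ∃ y ∈ Icc (x - ρ) (x + ρ), u y t = 0 ∧ (ux x T = 0 → ∃ y' ∈ Icc (x - ρ) (x + ρ), y' ≠ y ∧ u y' t = 0) := by
    rw [Filter.eventually_all_finite hfin]
    intro x hxm
    have h := hsep x hxm
    refine S.back_one hT h.1 (by linarith) (by linarith) h.2.1 ?_ ?_ hxm.2
    · exact hnz x hxm (x - ρ) ⟨h.1.le, by linarith⟩ (by linarith) (by rw [abs_le]; constructor <;> linarith)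
    · exact hnz x hxm (x + ρ) ⟨by linarith, h.2.1.le⟩ (by linarith) (by rw [abs_le]; constructor <;> linarith)
  filter_upwards [hall, Ioo_mem_nhdsLT hT.1] with t ht htm
  have htm' : t ∈ Ioc t0 te := ⟨htm.1, by linarith [htm.2, hT.2]⟩
  obtain ⟨hl', hr'⟩ := hbd t ⟨htm'.1.le, htm'.2⟩
  have hfin' := S.finZ htm' hx hl' hr'
  choose! f hf1 hf2 hf3 using ht
  have hin : ∀ x ∈ F, ∀ y ∈ Icc (x - ρ) (x + ρ), y ∈ Icc x0 x1 := fun x hxm y hy => ⟨by linarith [(hsep x hxm).1, hy.1], by linarith [(hsep x hxm).2.1, hy.2]⟩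
  have hdis : ∀ x ∈ F, ∀ x' ∈ F, ∀ y, y ∈ Icc (x - ρ) (x + ρ) → y ∈ Icc (x' - ρ) (x' + ρ) → x = x' := by
    intro x hxm x' hxm' y hy hy'
    by_contra hne
    have := (hsep x' hxm').2.2 x hxm hne
    have h2 : |x - x'| ≤ 2 * ρ := by rw [abs_le]; constructor <;> linarith [hy.1, hy.2, hy'.1, hy'.2]
    linarith
  have hinj : InjOn f F := by
    intro x hxm x' hxm' he
    exact hdis x hxm x' hxm' (f x) (hf1 x hxm) (he ▸ hf1 x' hxm')
  refine ⟨Set.ncard_le_ncard_of_injOn f (fun x hxm => ⟨hin x hxm _ (hf1 x hxm), hf2 x hxm⟩) hinj hfin', fun xc hxc h0 h1 => ?_⟩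
  have hxm : xc ∈ F := ⟨hxc, h0⟩
  obtain ⟨y, hy, hne, hy0⟩ := hf3 xc hxm h1
  have hym : y ∈ {x ∈ Icc x0 x1 | u x t = 0} := ⟨hin xc hxm y hy, hy0⟩
  have h2 : F.ncard ≤ ({x ∈ Icc x0 x1 | u x t = 0} \ {y}).ncard := by
    refine Set.ncard_le_ncard_of_injOn f (fun x hxm' => ⟨⟨hin x hxm' _ (hf1 x hxm'), hf2 x hxm'⟩, fun he => ?_⟩) hinj hfin'.diff
    have he' : f x = y := he
    have := hdis x hxm' xc hxm y (he' ▸ hf1 x hxm') hy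
    rw [this] at he'
    exact hne he'.symm
  exact h2.trans_lt (Set.ncard_diff_singleton_lt_of_mem hym hfin')

lemma forward (S : Sol x0 x1 t0 te u ux uxx ut a b c) (hx : x0 < x1) (hbd : ∀ t ∈ Icc t0 te, u x0 t ≠ 0 ∧ u x1 t ≠ 0) {T : ℝ} (hT : T ∈ Ioo t0 te) :
    ∀ᶠ t in nhdsWithin T (Ioi T), {x ∈ Icc x0 x1 | u x t = 0}.ncard ≤ {x ∈ Icc x0 x1 | u x T = 0}.ncard := by
  have hTm : T ∈ Icc t0 te := ⟨hT.1.le, hT.2.le⟩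
  have hT' : T ∈ Ioc t0 te := ⟨hT.1, hT.2.le⟩
  obtain ⟨hl, hr⟩ := hbd T hTm
  have hfin := S.finZ hT' hx hl hr
  obtain ⟨ρ, hρ, hsep⟩ := S.sep hT' hx hl hr
  set F := {x ∈ Icc x0 x1 | u x T = 0} with hF
  set K := Icc x0 x1 \ ⋃ x ∈ F, Ioo (x - ρ) (x + ρ) with hK
  have hKc : IsCompact K := isCompact_Icc.diff (isOpen_biUnion fun _ _ => isOpen_Ioo)
  have hKz : ∀ x ∈ K, u x T ≠ 0 := by
    intro x hxK h0
    exact hxK.2 (mem_biUnion (show x ∈ F from ⟨hxK.1, h0⟩) ⟨by linarith, by linarith⟩)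
  obtain ⟨η, hη, hu⟩ := S.unif hTm hKc diff_subset hKz
  have hend : ∀ x ∈ F, ∀ w ∈ Icc x0 x1, |w - x| = ρ → w ∈ K := by
    intro x hxm w hw hwx
    refine ⟨hw, fun hmem => ?_⟩
    simp only [mem_iUnion] at hmem
    obtain ⟨x', hxm', hw'⟩ := hmem
    have h3 : |w - x'| < ρ := by rw [abs_lt]; constructor <;> linarith [hw'.1, hw'.2]
    by_cases he : x' = x
    · rw [he] at h3; linarith
    · have := (hsep x hxm).2.2 x' hxm' he
      have h4 := abs_sub_le x' w x
      rw [abs_sub_comm x' w] at h4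
      linarith
  filter_upwards [Ioo_mem_nhdsGT hT.2, Ioo_mem_nhdsGT (show T < T + η by linarith)] with t h1 h2
  have hper : ∀ s ∈ Icc T t, ∀ x ∈ K, 0 < u x s * u x T := fun s hs => hu s ⟨by linarith [hs.1, hT.1], by linarith [hs.2, h1.2]⟩
    (by rw [abs_lt]; constructor <;> linarith [hs.1, hs.2, h2.2])
  have hcov : ∀ y ∈ {x ∈ Icc x0 x1 | u x t = 0}, ∃ x ∈ F, y ∈ Ioo (x - ρ) (x + ρ) := by
    intro y hy
    by_contra hcon
    have hyK : y ∈ K := ⟨hy.1, fun hmem => by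
      simp only [mem_iUnion] at hmem
      obtain ⟨x', hxm', hw'⟩ := hmem
      exact hcon ⟨x', hxm', hw'⟩⟩
    have := hper t ⟨h1.1.le, le_rfl⟩ y hyK
    rw [hy.2, zero_mul] at this
    exact lt_irrefl _ this
  choose! f hf1 hf2 using hcov
  refine Set.ncard_le_ncard_of_injOn f hf1 ?_ hfin
  intro y hy y' hy' he
  have hxm := hf1 y hy
  have hs := hsep _ hxm
  have k1 := hf2 y hy
  have k2 := hf2 y' hy'
  rw [← he] at k2
  refine S.one (T := T) (e := t) (p := f y - ρ) (q := f y + ρ) (xc := f y) hT.1 h1.1 h1.2.le hs.1 (by linarith) hs.2.1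
    (fun s hs' => hper s hs' _ (hend _ hxm _ ⟨hs.1.le, by linarith⟩ (by rw [sub_sub_cancel_left, abs_neg, abs_of_pos hρ])))
    (fun s hs' => hper s hs' _ (hend _ hxm _ ⟨by linarith, hs.2.1.le⟩ (by rw [add_sub_cancel_left, abs_of_pos hρ])))
    ⟨by linarith, by linarith⟩ (fun x hx' h0 => ?_) y ⟨k1.1.le, k1.2.le⟩ y' ⟨k2.1.le, k2.2.le⟩ hy.2 hy'.2
  by_contra hne
  have := hs.2.2 x ⟨⟨by linarith [hx'.1], by linarith [hx'.2]⟩, h0⟩ hne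
  have h3 : |x - f y| ≤ ρ := by rw [abs_le]; constructor <;> linarith [hx'.1, hx'.2]
  linarith

lemma drop (S : Sol x0 x1 t0 te u ux uxx ut a b c) (hx : x0 < x1) (hbd : ∀ t ∈ Icc t0 te, u x0 t ≠ 0 ∧ u x1 t ≠ 0) {tc xc tm tp : ℝ}
    (htc : tc ∈ Ioo t0 te) (hxc : xc ∈ Icc x0 x1) (h0 : u xc tc = 0) (h1 : ux xc tc = 0) (htm : tm ∈ Ioc t0 te) (htp : tp ∈ Ioc t0 te)
    (hmc : tm < tc) (hcp : tc ≤ tp) : {x ∈ Icc x0 x1 | u x tp = 0}.ncard < {x ∈ Icc x0 x1 | u x tm = 0}.ncard := by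
  have anti : ∀ {s e : ℝ}, t0 < s → s ≤ e → e ≤ te → {x ∈ Icc x0 x1 | u x e = 0}.ncard ≤ {x ∈ Icc x0 x1 | u x s = 0}.ncard := fun {s e} =>
    z_anti (z := fun t => {x ∈ Icc x0 x1 | u x t = 0}.ncard) (fun T hT => (S.backward hx hbd hT).mono fun t ht => ht.1) (fun T hT => S.forward hx hbd hT)
  obtain ⟨t, ht1, ht2⟩ := ((S.backward hx hbd ⟨htc.1, htc.2.le⟩).and (Ioo_mem_nhdsLT hmc)).exists
  calc _ ≤ _ := anti htc.1 hcp htp.2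
    _ < _ := ht1.2 xc hxc h0 h1
    _ ≤ _ := anti htm.1 ht2.1.le (by linarith [ht2.2, htc.2])
end Sol
end Ang

/-- Angenent's zero-counting theorem: for a classical solution u of the linear
parabolic equation ∂ₜu = a∂ₓ²u + b∂ₓu + cu on (x0,x1) × (t0,te], continuous up to the boundary,
with u nonvanishing on the lateral boundary: (i) the zero set Z(t) is finite for t ∈ (t0,te];
(ii) if there is a degenerate zero (u = ∂ₓu = 0) at time t_c ∈ (t0,te), then the number of
zeros strictly drops: z(t₋) > z(t₊) whenever t₋ < t_c ≤ t₊. -/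
theorem angenent_zero_counting (x₀ x₁ t₀ t₁ : ℝ) (hx : x₀ < x₁) (ht : t₀ < t₁)
    (u a b c : ℝ → ℝ → ℝ)
    (hu_cont : ContinuousOn (fun p : ℝ × ℝ => u p.1 p.2) (Icc x₀ x₁ ×ˢ Icc t₀ t₁))
    (ha_pos : ∀ x ∈ Icc x₀ x₁, ∀ t ∈ Icc t₀ t₁, 0 < a x t)
    (ha_reg : ContDiffOn ℝ 2 (fun p : ℝ × ℝ => a p.1 p.2) (Icc x₀ x₁ ×ˢ Icc t₀ t₁))
    (hb_reg : ContDiffOn ℝ 1 (fun p : ℝ × ℝ => b p.1 p.2) (Icc x₀ x₁ ×ˢ Icc t₀ t₁))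
    (hc_reg : ContinuousOn (fun p : ℝ × ℝ => c p.1 p.2) (Icc x₀ x₁ ×ˢ Icc t₀ t₁))
    -- classical solution: the relevant partial derivatives exist and are continuous
    -- on the parabolic interior
    (h_ut : ContinuousOn (fun p : ℝ × ℝ => deriv (fun s => u p.1 s) p.2)
      (Ioo x₀ x₁ ×ˢ Ioc t₀ t₁))
    (h_ux : ContinuousOn (fun p : ℝ × ℝ => deriv (fun y => u y p.2) p.1)
      (Ioo x₀ x₁ ×ˢ Ioc t₀ t₁))
    (h_uxx : ContinuousOn (fun p : ℝ × ℝ => deriv (fun y => deriv (fun z => u z p.2) y) p.1)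
      (Ioo x₀ x₁ ×ˢ Ioc t₀ t₁))
    (h_diff_t : ∀ x ∈ Ioo x₀ x₁, ∀ t ∈ Ioc t₀ t₁, DifferentiableAt ℝ (fun s => u x s) t)
    (h_diff_x : ∀ x ∈ Ioo x₀ x₁, ∀ t ∈ Ioc t₀ t₁, DifferentiableAt ℝ (fun y => u y t) x)
    (h_diff_xx : ∀ x ∈ Ioo x₀ x₁, ∀ t ∈ Ioc t₀ t₁,
      DifferentiableAt ℝ (fun y => deriv (fun z => u z t) y) x)
    (h_pde : ∀ x ∈ Ioo x₀ x₁, ∀ t ∈ Ioc t₀ t₁,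
      deriv (fun s => u x s) t
        = a x t * deriv (fun y => deriv (fun z => u z t) y) x
            + b x t * deriv (fun y => u y t) x + c x t * u x t)
    (h_bdry : ∀ t ∈ Icc t₀ t₁, u x₀ t ≠ 0 ∧ u x₁ t ≠ 0) :
    (∀ t ∈ Ioc t₀ t₁, {x ∈ Icc x₀ x₁ | u x t = 0}.Finite) ∧
    (∀ tc ∈ Ioo t₀ t₁, ∀ xc ∈ Icc x₀ x₁,
      u xc tc = 0 → deriv (fun y => u y tc) xc = 0 →
      ∀ tm ∈ Ioc t₀ t₁, ∀ tp ∈ Ioc t₀ t₁, tm < tc → tc ≤ tp →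
        {x ∈ Icc x₀ x₁ | u x tp = 0}.ncard < {x ∈ Icc x₀ x₁ | u x tm = 0}.ncard) := by
  have S : Ang.Sol x₀ x₁ t₀ t₁ u (fun x t => deriv (fun y => u y t) x) (fun x t => deriv (fun y => deriv (fun z => u z t) y) x)
      (fun x t => deriv (fun s => u x s) t) a b c :=
    ⟨hu_cont, ha_pos, ha_reg.of_le (by norm_num), hb_reg.continuousOn, hc_reg, fun x hx t ht => (h_diff_x x hx t ht).hasDerivAt,
      fun x hx t ht => (h_diff_xx x hx t ht).hasDerivAt, fun x hx t ht => (h_diff_t x hx t ht).hasDerivAt, h_ux, h_uxx, h_ut, h_pde⟩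
  refine ⟨fun t htm => S.finZ htm hx (h_bdry t ⟨htm.1.le, htm.2⟩).1 (h_bdry t ⟨htm.1.le, htm.2⟩).2, ?_⟩
  intro tc htc xc hxc h0 h1 tm htm tp htp hmc hcp
  exact S.drop hx h_bdry htc hxc h0 h1 htm htp hmc hcp
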